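/- There exist positive constants C, β, δ (depending only on the distribution of ξ) such that for all n ≥ 1 (with P(|𝒯| = n) > 0), the generating function f_n(z) := Σ_{k≥1} E P_k(T_n) z^k extends to an analytic function on the domain Δ(β, δ), and |f_n(z)| ≤ C n |1 − z|^{−2} for all z ∈ Δ(β, δ). -/

import Mathlib

open scoped ENNReal BigOperators
open Set Filter

/-- Plane (ordered rooted) trees. -/
inductive PlaneTree : Type
  | node : List PlaneTree → PlaneTree

namespace PlaneTree

/-- The list of subtrees hanging off the root. -/
def children : PlaneTree → List PlaneTree
  | .node ts => ts

/-- The subtree rooted at a given position (sequence of child indices), if it exists. -/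
def subtreeAt : PlaneTree → List ℕ → Option PlaneTree
  | t, [] => some t
  | .node ts, i :: q =>
    match ts[i]? with
    | some t' => subtreeAt t' q
    | none => none

/-- The vertex set of a tree, with vertices identified with their positions. -/
def vertexSet (t : PlaneTree) : Set (List ℕ) := {q | (subtreeAt t q).isSome}

/-- The number of vertices of a tree. -/
noncomputable def size (t : PlaneTree) : ℕ := (vertexSet t).ncard

/-- The number of children of the vertex at position `q`. -/
def childCount (t : PlaneTree) (q : List ℕ) : ℕ :=
  ((subtreeAt t q).map fun t' => t'.children.length).getD 0

end PlaneTree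

/-- Longest common prefix of two positions; this is the position of the last common
ancestor of the two vertices. -/
def lca : List ℕ → List ℕ → List ℕ
  | a :: as, b :: bs => if a = b then a :: lca as bs else []
  | _, _ => []

/-- The distance from `v` up to the last common ancestor of `v` and `w`. -/
def dUp (v w : List ℕ) : ℕ := v.length - (lca v w).length

/-- The graph distance between the vertices at positions `v` and `w`. -/
def treeDist (v w : List ℕ) : ℕ := dUp v w + dUp w v

/-- The Galton–Watson probability of a given finite tree: the product, over all vertices,
of the probability that the offspring distribution takes the value given by the number of
children of the vertex. -/
noncomputable def gwProb (p : ℕ → ℝ≥0∞) (t : PlaneTree) : ℝ≥0∞ :=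
  ∏ᶠ v ∈ PlaneTree.vertexSet t, p (PlaneTree.childCount t v)

/-- `P(|𝒯| = n)` for the Galton–Watson tree `𝒯`. -/
noncomputable def probSize (p : ℕ → ℝ≥0∞) (n : ℕ) : ℝ≥0∞ :=
  ∑' t : PlaneTree, if PlaneTree.size t = n then gwProb p t else 0

/-- `E f(T_n)` where `T_n` is the Galton–Watson tree conditioned to have `n` vertices. -/
noncomputable def condExp (p : ℕ → ℝ≥0∞) (n : ℕ) (f : PlaneTree → ℝ≥0∞) : ℝ≥0∞ :=
  (∑' t : PlaneTree, if PlaneTree.size t = n then gwProb p t * f t else 0) / probSize p n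

/-- The variance of the offspring distribution `p` (which has mean `1`). -/
noncomputable def xiVar (p : ℕ → ℝ≥0∞) : ℝ≥0∞ :=
  ∑' k : ℕ, p k * ENNReal.ofReal (((k : ℝ) - 1) ^ 2)

/-- `P_k(t)`: the number of unordered pairs of vertices of `t` at graph distance `k`. -/
noncomputable def pairCount (t : PlaneTree) (k : ℕ) : ℕ :=
  {s : Set (List ℕ) | ∃ v w, v ∈ PlaneTree.vertexSet t ∧ w ∈ PlaneTree.vertexSet t ∧
    s = {v, w} ∧ treeDist v w = k}.ncard

/-- The singularity-analysis domain `Δ(β, δ)`. -/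
def Delta (β δ : ℝ) : Set ℂ :=
  {z : ℂ | ‖z‖ < 1 + δ ∧ z ≠ 1 ∧ Real.pi / 2 - β < |Complex.arg (z - 1)|}

/-- `E P_k(T_n)` as a real number. -/
noncomputable def expPairCount (p : ℕ → ℝ≥0∞) (n k : ℕ) : ℝ :=
  (condExp p n (fun t => (pairCount t k : ℝ≥0∞))).toReal

/-- The generating function `f_n(z) = ∑_{k ≥ 1} E P_k(T_n) z^k`. -/
noncomputable def genFun (p : ℕ → ℝ≥0∞) (n : ℕ) (z : ℂ) : ℂ :=
  ∑' k : ℕ, (expPairCount p n (k + 1) : ℂ) * z ^ (k + 1)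

namespace PlaneTree

/-- The tree whose root has the subtrees `f 0, …, f (m - 1)`. -/
def ofFn {m : ℕ} (f : Fin m → PlaneTree) : PlaneTree := node (List.ofFn f)

/-- A plane tree is the same as the tuple of the subtrees at its root. -/
def equivSigma : (Σ m, Fin m → PlaneTree) ≃ PlaneTree where
  toFun s := ofFn s.2
  invFun t := List.equivSigmaTuple t.children
  left_inv s := List.equivSigmaTuple.right_inv s
  right_inv t := by
    cases t with
    | node ts => exact congrArg node (List.equivSigmaTuple.left_inv ts)

theorem induction_ofFn {motive : PlaneTree → Prop}
    (h : ∀ (m : ℕ) (f : Fin m → PlaneTree), (∀ i, motive (f i)) → motive (ofFn f))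
    (t : PlaneTree) : motive t := by
  refine PlaneTree.rec (motive_1 := motive) (motive_2 := fun l => ∀ s ∈ l, motive s)
    ?_ (by simp) ?_ t
  · intro ts hts
    have := h ts.length ts.get fun i => hts _ (ts.get_mem i)
    simpa [ofFn] using this
  · intro a l ha hl s hs
    rcases List.mem_cons.1 hs with rfl | hs
    exacts [ha, hl s hs]

theorem subtreeAt_nil (t : PlaneTree) : subtreeAt t [] = some t := by
  cases t; rfl

theorem subtreeAt_ofFn_cons {m : ℕ} (f : Fin m → PlaneTree) (i : ℕ) (q : List ℕ) :
    subtreeAt (ofFn f) (i :: q) = if h : i < m then subtreeAt (f ⟨i, h⟩) q else none := by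
  rw [ofFn, subtreeAt]
  by_cases h : i < m
  · simp [h]
  · simp [h]

theorem nil_mem_vertexSet (t : PlaneTree) : [] ∈ vertexSet t := by
  simp [vertexSet, subtreeAt_nil]

theorem cons_mem_vertexSet_ofFn {m : ℕ} {f : Fin m → PlaneTree} {i : ℕ} {q : List ℕ} :
    i :: q ∈ vertexSet (ofFn f) ↔ ∃ h : i < m, q ∈ vertexSet (f ⟨i, h⟩) := by
  by_cases h : i < m <;> simp [vertexSet, subtreeAt_ofFn_cons, h]

theorem childCount_ofFn_nil {m : ℕ} (f : Fin m → PlaneTree) : childCount (ofFn f) [] = m := by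
  simp [childCount, subtreeAt_nil, ofFn, children]

theorem childCount_ofFn_cons {m : ℕ} (f : Fin m → PlaneTree) (i : Fin m) (q : List ℕ) :
    childCount (ofFn f) ((i : ℕ) :: q) = childCount (f i) q := by
  simp [childCount, subtreeAt_ofFn_cons]

theorem vertexSet_ofFn {m : ℕ} (f : Fin m → PlaneTree) :
    vertexSet (ofFn f) = insert [] (⋃ i : Fin m, List.cons (i : ℕ) '' vertexSet (f i)) := by
  ext q
  cases q with
  | nil => simp [nil_mem_vertexSet]
  | cons i q =>
    simp only [cons_mem_vertexSet_ofFn, mem_insert_iff, mem_iUnion, mem_image, List.cons.injEq,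
      reduceCtorEq, false_or]
    constructor
    · rintro ⟨h, hq⟩
      exact ⟨⟨i, h⟩, q, hq, rfl, rfl⟩
    · rintro ⟨j, q', hq, rfl, rfl⟩
      exact ⟨j.2, hq⟩

theorem finite_vertexSet (t : PlaneTree) : (vertexSet t).Finite := by
  induction t using induction_ofFn with
  | h m f ih =>
    rw [vertexSet_ofFn]
    exact (finite_iUnion fun i => (ih i).image _).insert _

/-- The vertex set as a finset. -/
noncomputable def verts (t : PlaneTree) : Finset (List ℕ) := (finite_vertexSet t).toFinset

theorem mem_verts {t : PlaneTree} {v : List ℕ} : v ∈ verts t ↔ v ∈ vertexSet t := by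
  simp [verts]

theorem card_verts (t : PlaneTree) : (verts t).card = size t :=
  (ncard_eq_toFinset_card _ (finite_vertexSet t)).symm

/-- The map attaching the vertices of the subtrees at the root to the whole tree. -/
def consEmbedding (m : ℕ) : (Σ _ : Fin m, List ℕ) ↪ List ℕ where
  toFun s := (s.1 : ℕ) :: s.2
  inj' := by
    rintro ⟨i, v⟩ ⟨j, w⟩ h
    simp only [List.cons.injEq] at h
    obtain ⟨h, rfl⟩ := h
    obtain rfl := Fin.ext h
    rfl

theorem verts_ofFn {m : ℕ} (f : Fin m → PlaneTree) :
    verts (ofFn f) = Finset.cons []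
      ((Finset.univ.sigma fun i => verts (f i)).map (consEmbedding m))
      (by simp [consEmbedding]) := by
  ext q
  simp only [mem_verts, vertexSet_ofFn, mem_insert_iff, mem_iUnion, mem_image, Finset.mem_cons,
    Finset.mem_map, Finset.mem_sigma, Finset.mem_univ, true_and, Sigma.exists, consEmbedding]
  rfl

theorem sum_verts_ofFn {M : Type*} [AddCommMonoid M] {m : ℕ} (f : Fin m → PlaneTree)
    (F : List ℕ → M) :
    ∑ v ∈ verts (ofFn f), F v = F [] + ∑ i, ∑ v ∈ verts (f i), F ((i : ℕ) :: v) := by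
  rw [verts_ofFn, Finset.sum_cons, Finset.sum_map, Finset.sum_sigma]
  rfl

theorem prod_verts_ofFn {M : Type*} [CommMonoid M] {m : ℕ} (f : Fin m → PlaneTree)
    (F : List ℕ → M) :
    ∏ v ∈ verts (ofFn f), F v = F [] * ∏ i, ∏ v ∈ verts (f i), F ((i : ℕ) :: v) := by
  rw [verts_ofFn, Finset.prod_cons, Finset.prod_map, Finset.prod_sigma]
  rfl

theorem size_ofFn {m : ℕ} (f : Fin m → PlaneTree) : size (ofFn f) = 1 + ∑ i, size (f i) := by
  simp only [← card_verts, Finset.card_eq_sum_ones]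
  exact sum_verts_ofFn f fun _ => 1

theorem size_pos (t : PlaneTree) : 0 < size t := by
  rw [← card_verts, Finset.card_pos]
  exact ⟨[], mem_verts.2 (nil_mem_vertexSet t)⟩

theorem gwProb_ofFn (p : ℕ → ℝ≥0∞) {m : ℕ} (f : Fin m → PlaneTree) :
    gwProb p (ofFn f) = p m * ∏ i, gwProb p (f i) := by
  have key (t : PlaneTree) : gwProb p t = ∏ v ∈ verts t, p (childCount t v) :=
    finprod_mem_eq_finite_toFinset_prod _ (finite_vertexSet t)
  rw [key, prod_verts_ofFn, childCount_ofFn_nil]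
  simp_rw [childCount_ofFn_cons, ← key]

theorem length_lt_size {t : PlaneTree} {v : List ℕ} (hv : v ∈ vertexSet t) :
    v.length < size t := by
  induction t using induction_ofFn generalizing v with
  | h m f ih =>
    cases v with
    | nil => exact size_pos _
    | cons i v =>
      obtain ⟨h, hv⟩ := cons_mem_vertexSet_ofFn.1 hv
      have h1 := ih _ hv
      have h2 : size (f ⟨i, h⟩) ≤ ∑ i, size (f i) :=
        Finset.single_le_sum (f := fun i => size (f i)) (fun _ _ => Nat.zero_le _)
          (Finset.mem_univ _)
      rw [size_ofFn, List.length_cons]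
      omega

/-- The depth generating polynomial `∑ z ^ |v|`, the sum being over the vertices. -/
noncomputable def depthSum (z : ℂ) (t : PlaneTree) : ℂ := ∑ v ∈ verts t, z ^ v.length

/-- The distance generating polynomial `∑ z ^ d(v, w)` over all ordered pairs of vertices. -/
noncomputable def distSum (z : ℂ) (t : PlaneTree) : ℂ :=
  ∑ v ∈ verts t, ∑ w ∈ verts t, z ^ treeDist v w

theorem depthSum_ofFn (z : ℂ) {m : ℕ} (f : Fin m → PlaneTree) :
    depthSum z (ofFn f) = 1 + z * ∑ i, depthSum z (f i) := by
  simp only [depthSum, sum_verts_ofFn, List.length_nil, pow_zero, List.length_cons, pow_succ',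
    Finset.mul_sum]

end PlaneTree

theorem lca_nil_left (w : List ℕ) : lca [] w = [] := by
  simp [lca]

theorem lca_nil_right (v : List ℕ) : lca v [] = [] := by
  cases v <;> simp [lca]

theorem treeDist_nil_left (w : List ℕ) : treeDist [] w = w.length := by
  simp [treeDist, dUp, lca_nil_left, lca_nil_right]

theorem treeDist_comm (v w : List ℕ) : treeDist v w = treeDist w v := by
  simp [treeDist, Nat.add_comm]

theorem treeDist_cons_self (i : ℕ) (v w : List ℕ) :
    treeDist (i :: v) (i :: w) = treeDist v w := by
  simp [treeDist, dUp, lca]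

theorem treeDist_cons_of_ne {i j : ℕ} (h : i ≠ j) (v w : List ℕ) :
    treeDist (i :: v) (j :: w) = 2 + v.length + w.length := by
  simp only [treeDist, dUp, lca, h, h.symm, if_false, List.length_cons, List.length_nil]
  omega

theorem treeDist_eq_zero_iff {v w : List ℕ} : treeDist v w = 0 ↔ v = w := by
  induction v generalizing w with
  | nil => rw [treeDist_nil_left, List.length_eq_zero_iff, eq_comm]
  | cons i v ih =>
    cases w with
    | nil => rw [treeDist_comm, treeDist_nil_left]; simp
    | cons j w =>
      by_cases h : i = j
      · subst h; rw [treeDist_cons_self, ih]; simp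
      · rw [treeDist_cons_of_ne h]; simp [h]

theorem treeDist_le (v w : List ℕ) : treeDist v w ≤ v.length + w.length := by
  unfold treeDist dUp; omega

namespace PlaneTree

theorem distSum_ofFn (z : ℂ) {m : ℕ} (f : Fin m → PlaneTree) :
    distSum z (ofFn f) = 1 + 2 * z * ∑ i, depthSum z (f i) + ∑ i, distSum z (f i) +
      z ^ 2 * ((∑ i, depthSum z (f i)) ^ 2 - ∑ i, depthSum z (f i) ^ 2) := by
  have hroot (i : Fin m) :
      ∑ v ∈ verts (f i), z ^ treeDist ((i : ℕ) :: v) [] = z * depthSum z (f i) := by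
    simp only [treeDist_comm _ [], treeDist_nil_left, List.length_cons, pow_succ', depthSum,
      Finset.mul_sum]
  have hpair (i j : Fin m) :
      ∑ v ∈ verts (f i), ∑ w ∈ verts (f j), z ^ treeDist ((i : ℕ) :: v) ((j : ℕ) :: w) =
        z ^ 2 * (depthSum z (f i) * depthSum z (f j)) +
          if i = j then distSum z (f i) - z ^ 2 * depthSum z (f i) ^ 2 else 0 := by
    split_ifs with h
    · subst h
      simp only [treeDist_cons_self, distSum]
      ring
    · have h' : (i : ℕ) ≠ j := fun e => h (Fin.ext e)
      simp only [treeDist_cons_of_ne h', pow_add, depthSum, add_zero]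
      rw [Finset.sum_mul_sum, Finset.mul_sum]
      simp only [Finset.mul_sum]
      exact Finset.sum_congr rfl fun v _ => Finset.sum_congr rfl fun w _ => by ring
  have hinner (i : Fin m) :
      ∑ v ∈ verts (f i), ∑ w ∈ verts (ofFn f), z ^ treeDist ((i : ℕ) :: v) w =
        z * depthSum z (f i) + (z ^ 2 * (depthSum z (f i) * ∑ j, depthSum z (f j)) +
          (distSum z (f i) - z ^ 2 * depthSum z (f i) ^ 2)) := by
    simp only [sum_verts_ofFn, Finset.sum_add_distrib, hroot]
    rw [Finset.sum_comm]
    simp only [hpair, Finset.sum_add_distrib, Finset.sum_ite_eq, Finset.mem_univ, if_true,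
      Finset.mul_sum]
  rw [distSum, sum_verts_ofFn]
  simp only [hinner, Finset.sum_add_distrib, treeDist_nil_left, Finset.sum_sub_distrib,
    ← Finset.mul_sum, ← Finset.sum_mul]
  have h0 : ∑ w ∈ verts (ofFn f), z ^ w.length = 1 + z * ∑ i, depthSum z (f i) :=
    depthSum_ofFn z f
  rw [h0]
  ring

theorem norm_depthSum_le {z : ℂ} {R : ℝ} (hR : 1 ≤ R) (hz : ‖z‖ ≤ R) (t : PlaneTree) :
    ‖depthSum z t‖ ≤ size t * R ^ size t := by
  rw [← card_verts, ← nsmul_eq_mul]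
  refine (norm_sum_le _ _).trans (Finset.sum_le_card_nsmul _ _ _ fun v hv => ?_)
  rw [norm_pow, card_verts]
  exact (pow_le_pow_left₀ (norm_nonneg _) hz _).trans
    (pow_le_pow_right₀ hR (length_lt_size (mem_verts.1 hv)).le)

theorem norm_distSum_le {z : ℂ} {R : ℝ} (hR : 1 ≤ R) (hz : ‖z‖ ≤ R) (t : PlaneTree) :
    ‖distSum z t‖ ≤ (size t : ℝ) ^ 2 * (R ^ 2) ^ size t := by
  rw [sq, mul_assoc, ← card_verts, ← nsmul_eq_mul, ← nsmul_eq_mul]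
  refine (norm_sum_le _ _).trans (Finset.sum_le_card_nsmul _ _ _ fun v hv => ?_)
  refine (norm_sum_le _ _).trans (Finset.sum_le_card_nsmul _ _ _ fun w hw => ?_)
  rw [norm_pow, card_verts, ← pow_mul]
  refine (pow_le_pow_left₀ (norm_nonneg _) hz _).trans (pow_le_pow_right₀ hR ?_)
  have h1 := length_lt_size (mem_verts.1 hv)
  have h2 := length_lt_size (mem_verts.1 hw)
  have h3 := treeDist_le v w
  omega

theorem treeDist_lt {t : PlaneTree} {v w : List ℕ} (hv : v ∈ vertexSet t)
    (hw : w ∈ vertexSet t) : treeDist v w < 2 * size t := by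
  have h1 := length_lt_size hv
  have h2 := length_lt_size hw
  have h3 := treeDist_le v w
  omega

/-- The number of ordered pairs at distance `k ≥ 1` is twice the number of unordered ones. -/
theorem card_filter_treeDist (t : PlaneTree) {k : ℕ} (hk : k ≠ 0) :
    (((verts t) ×ˢ (verts t)).filter fun a => treeDist a.1 a.2 = k).card =
      2 * pairCount t k := by
  classical
  set S := ((verts t) ×ˢ (verts t)).filter fun a => treeDist a.1 a.2 = k with hS
  have himg : pairCount t k = (S.image fun a => s(a.1, a.2)).card := by
    have hinj : Function.Injective fun e : Sym2 (List ℕ) => {x | x ∈ e} := by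
      intro a b h
      exact Sym2.ext fun x => by simpa using congrArg (x ∈ ·) h
    rw [pairCount, ← ncard_coe_finset, ← ncard_image_of_injective _ hinj]
    congr 1
    ext s
    simp only [mem_ofPred_eq, hS, Finset.coe_image, mem_image, Finset.mem_coe, Finset.mem_filter,
      Finset.mem_product, mem_verts, Prod.exists]
    constructor
    · rintro ⟨v, w, hv, hw, rfl, h⟩
      refine ⟨s(v, w), ⟨v, w, ⟨⟨hv, hw⟩, h⟩, rfl⟩, ?_⟩
      ext x; simp
    · rintro ⟨_, ⟨v, w, ⟨⟨hv, hw⟩, h⟩, rfl⟩, rfl⟩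
      refine ⟨v, w, hv, hw, ?_, h⟩
      ext x; simp
  rw [himg, Finset.card_eq_sum_card_image (fun a => s(a.1, a.2)) S, Finset.sum_const_nat (m := 2),
    mul_comm]
  intro e he
  obtain ⟨⟨v, w⟩, ha, rfl⟩ := Finset.mem_image.1 he
  simp only [hS, Finset.mem_filter, Finset.mem_product] at ha
  have hne : v ≠ w := by
    rintro rfl
    exact hk (ha.2.symm.trans (treeDist_eq_zero_iff.2 rfl))
  have : (S.filter fun a => s(a.1, a.2) = s(v, w)) = {(v, w), (w, v)} := by
    ext ⟨a, b⟩
    simp only [hS, Finset.mem_filter, Finset.mem_product, Sym2.eq_iff, Finset.mem_insert,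
      Finset.mem_singleton, Prod.mk.injEq]
    constructor
    · exact fun h => h.2
    · rintro (⟨rfl, rfl⟩ | ⟨rfl, rfl⟩)
      · exact ⟨ha, Or.inl ⟨rfl, rfl⟩⟩
      · exact ⟨⟨ha.1.symm, treeDist_comm a b ▸ ha.2⟩, Or.inr ⟨rfl, rfl⟩⟩
  rw [this, Finset.card_pair]
  simpa using fun h : v = w => absurd h hne

theorem pairCount_eq_zero {t : PlaneTree} {k : ℕ} (hk : 2 * size t ≤ k) : pairCount t k = 0 := by
  have : {s : Set (List ℕ) | ∃ v w, v ∈ vertexSet t ∧ w ∈ vertexSet t ∧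
      s = {v, w} ∧ treeDist v w = k} = ∅ := by
    refine eq_empty_of_forall_notMem ?_
    rintro _ ⟨v, w, hv, hw, -, h⟩
    have := treeDist_lt hv hw
    omega
  rw [pairCount, this, ncard_empty]

theorem distSum_eq (z : ℂ) (t : PlaneTree) :
    distSum z t = size t + 2 * ∑ k ∈ Finset.range (2 * size t),
      (pairCount t (k + 1) : ℂ) * z ^ (k + 1) := by
  classical
  have hmaps : ∀ a ∈ verts t ×ˢ verts t,
      treeDist a.1 a.2 ∈ Finset.range (2 * size t + 1) := by
    intro a ha
    rw [Finset.mem_product] at ha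
    have := treeDist_lt (mem_verts.1 ha.1) (mem_verts.1 ha.2)
    exact Finset.mem_range.2 (by omega)
  have hfiber (k : ℕ) :
      ∑ a ∈ (verts t ×ˢ verts t).filter (fun a => treeDist a.1 a.2 = k), z ^ treeDist a.1 a.2 =
        (((verts t ×ˢ verts t).filter fun a => treeDist a.1 a.2 = k).card : ℂ) * z ^ k := by
    rw [← nsmul_eq_mul]
    refine Finset.sum_eq_card_nsmul fun a ha => ?_
    rw [(Finset.mem_filter.1 ha).2]
  have hdiag : ((verts t ×ˢ verts t).filter fun a => treeDist a.1 a.2 = 0).card = size t := by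
    rw [← card_verts, ← Finset.diag_card (verts t)]
    congr 1
    ext ⟨a, b⟩
    simp only [Finset.mem_filter, Finset.mem_product, treeDist_eq_zero_iff, Finset.mem_diag]
    constructor
    · exact fun h => ⟨h.1.1, h.2⟩
    · rintro ⟨h, rfl⟩
      exact ⟨⟨h, h⟩, rfl⟩
  rw [distSum, ← Finset.sum_product', ← Finset.sum_fiberwise_of_maps_to hmaps]
  simp only [hfiber]
  rw [Finset.sum_range_succ', hdiag, pow_zero, mul_one, add_comm, Finset.mul_sum]
  congr 1
  refine Finset.sum_congr rfl fun k _ => ?_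
  rw [card_filter_treeDist t k.succ_ne_zero]
  push_cast
  ring

end PlaneTree

/-- Absolute convergence of a complex series to a given sum. -/
def AbsHasSum {ι : Type*} (f : ι → ℂ) (s : ℂ) : Prop := Summable (fun i => ‖f i‖) ∧ HasSum f s

namespace AbsHasSum

variable {ι κ : Type*}

theorem add {f g : ι → ℂ} {s t : ℂ} (hf : AbsHasSum f s) (hg : AbsHasSum g t) :
    AbsHasSum (fun i => f i + g i) (s + t) :=
  ⟨.of_nonneg_of_le (fun _ => norm_nonneg _) (fun _ => norm_add_le _ _) (hf.1.add hg.1),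
    hf.2.add hg.2⟩

theorem const_mul {f : ι → ℂ} {s : ℂ} (c : ℂ) (hf : AbsHasSum f s) :
    AbsHasSum (fun i => c * f i) (c * s) :=
  ⟨by simpa only [norm_mul] using hf.1.mul_left ‖c‖, hf.2.mul_left c⟩

theorem mul {f : ι → ℂ} {g : κ → ℂ} {s t : ℂ} (hf : AbsHasSum f s) (hg : AbsHasSum g t) :
    AbsHasSum (fun x : ι × κ => f x.1 * g x.2) (s * t) :=
  ⟨by simpa only [norm_mul] using hf.1.mul_norm hg.1,
    hf.2.mul hg.2 (hf.1.mul_norm hg.1).of_norm⟩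

theorem comp_consEquiv {T : Type*} {m : ℕ} {F : (Fin (m + 1) → T) → ℂ} {s : ℂ}
    (h : AbsHasSum (fun x : T × (Fin m → T) => F (Fin.cons x.1 x.2)) s) : AbsHasSum F s := by
  have e : (fun x : T × (Fin m → T) => F (Fin.cons x.1 x.2)) =
    F ∘ (Fin.consEquiv fun _ : Fin (m + 1) => T) := rfl
  constructor
  · exact (Fin.consEquiv fun _ : Fin (m + 1) => T).summable_iff.1 h.1
  · exact (Fin.consEquiv fun _ : Fin (m + 1) => T).hasSum_iff.1 (e ▸ h.2)

theorem congr {f g : ι → ℂ} {s t : ℂ} (hf : AbsHasSum f s) (hfg : ∀ i, g i = f i)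
    (hst : t = s) : AbsHasSum g t := by
  obtain rfl : g = f := funext hfg
  exact hst ▸ hf

theorem of_unique [Unique ι] (f : ι → ℂ) : AbsHasSum f (f default) :=
  ⟨(hasSum_unique _).summable, hasSum_unique f⟩

variable {T : Type*} {a D : T → ℂ} {α β : ℂ}

theorem prod_tuple (ha : AbsHasSum a α) (m : ℕ) :
    AbsHasSum (fun f : Fin m → T => ∏ i, a (f i)) (α ^ m) := by
  induction m with
  | zero => simpa using of_unique fun f : Fin 0 → T => ∏ i, a (f i)
  | succ m ih =>
    refine comp_consEquiv ?_
    simpa only [Fin.prod_univ_succ, Fin.cons_zero, Fin.cons_succ, pow_succ'] using ha.mul ih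

theorem prod_mul_sum_tuple (ha : AbsHasSum a α) (hD : AbsHasSum (fun t => a t * D t) β) (m : ℕ) :
    AbsHasSum (fun f : Fin m → T => (∏ i, a (f i)) * ∑ i, D (f i)) (m * α ^ (m - 1) * β) := by
  induction m with
  | zero => simpa using of_unique fun f : Fin 0 → T => (∏ i, a (f i)) * ∑ i, D (f i)
  | succ m ih =>
    refine comp_consEquiv ?_
    refine ((hD.mul (prod_tuple ha m)).add (ha.mul ih)).congr (fun x => ?_) ?_
    · simp only [Fin.prod_univ_succ, Fin.sum_univ_succ, Fin.cons_zero, Fin.cons_succ]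
      ring
    · cases m with
      | zero => simp
      | succ m =>
        simp only [Nat.add_sub_cancel]
        push_cast
        ring

theorem prod_mul_sq_sum_tuple (ha : AbsHasSum a α) (hD : AbsHasSum (fun t => a t * D t) β)
    (m : ℕ) :
    AbsHasSum (fun f : Fin m → T => (∏ i, a (f i)) * ((∑ i, D (f i)) ^ 2 - ∑ i, D (f i) ^ 2))
      (m * (m - 1) * α ^ (m - 2) * β ^ 2) := by
  induction m with
  | zero =>
    exact (of_unique fun _ : Fin 0 → T => (0 : ℂ)).congr (fun f => by simp) (by simp)
  | succ m ih =>
    refine comp_consEquiv ?_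
    refine (((hD.mul (prod_mul_sum_tuple ha hD m)).const_mul 2).add (ha.mul ih)).congr
      (fun x => ?_) ?_
    · simp only [Fin.prod_univ_succ, Fin.sum_univ_succ, Fin.cons_zero, Fin.cons_succ]
      ring
    · obtain _ | _ | m := m
      · simp
      · simp; ring
      · rw [show m + 1 + 1 + 1 - 2 = m + 1 by omega, show m + 1 + 1 - 1 = m + 1 by omega,
          show m + 1 + 1 - 2 = m by omega]
        push_cast
        ring

end AbsHasSum

/-- Total mass of the trees with a bounded number of generations: an upper bound for the total
mass of the Galton–Watson weights. -/
theorem tsum_gwProb_le_one {p : ℕ → ℝ≥0∞} (hp : ∑' k, p k = 1) :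
    ∑' t : PlaneTree, gwProb p t ≤ 1 := by
  classical
  have hpi (w : PlaneTree → ℝ≥0∞) (m : ℕ) :
      ∑' f : Fin m → PlaneTree, ∏ i, w (f i) = (∑' t, w t) ^ m := by
    induction m with
    | zero => simp
    | succ m ih =>
      rw [← (Fin.consEquiv fun _ : Fin (m + 1) => PlaneTree).tsum_eq, ENNReal.tsum_prod']
      simp [Fin.consEquiv, Fin.prod_univ_succ, ENNReal.tsum_mul_left, ENNReal.tsum_mul_right, ih,
        pow_succ']
  rw [ENNReal.tsum_eq_iSup_sum]
  refine iSup_le fun s => ?_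
  have key (h : ℕ) :
      ∑' t : PlaneTree, (if t.size ≤ h then gwProb p t else 0) ≤ 1 := by
    induction h with
    | zero =>
      have : ∀ t : PlaneTree, ¬ t.size ≤ 0 := fun t => by have := t.size_pos; omega
      simp [this]
    | succ h ih =>
      rw [← PlaneTree.equivSigma.tsum_eq, ENNReal.tsum_sigma']
      calc _ ≤ ∑' m : ℕ, ∑' f : Fin m → PlaneTree,
            p m * ∏ i, (if (f i).size ≤ h then gwProb p (f i) else 0) := by
            refine ENNReal.tsum_le_tsum fun m => ENNReal.tsum_le_tsum fun f => ?_
            change (if (PlaneTree.ofFn f).size ≤ h + 1 then gwProb p (PlaneTree.ofFn f) else 0) ≤ _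
            split_ifs with hs
            · rw [PlaneTree.gwProb_ofFn]
              gcongr with i
              rw [if_pos]
              have : (f i).size ≤ ∑ i, (f i).size :=
                Finset.single_le_sum (f := fun i => (f i).size) (fun _ _ => Nat.zero_le _)
                  (Finset.mem_univ i)
              rw [PlaneTree.size_ofFn] at hs
              omega
            · exact zero_le
        _ = ∑' m : ℕ, p m *
            (∑' t : PlaneTree, (if t.size ≤ h then gwProb p t else 0)) ^ m := by
            simp only [ENNReal.tsum_mul_left, hpi fun t => if t.size ≤ h then gwProb p t else 0]
        _ ≤ ∑' m : ℕ, p m := by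
            refine ENNReal.tsum_le_tsum fun m => ?_
            exact mul_le_of_le_one_right' (pow_le_one' ih m)
        _ = 1 := hp
  refine le_trans ?_ (key (s.sup PlaneTree.size))
  refine le_trans (Finset.sum_le_sum fun t ht => ?_) (ENNReal.sum_le_tsum s)
  rw [if_pos (Finset.le_sup (f := PlaneTree.size) ht)]

namespace PlaneTree

/-- The weight `P(𝒯 = t) x ^ |t|`. -/
noncomputable def weight (p : ℕ → ℝ≥0∞) (x : ℂ) (t : PlaneTree) : ℂ :=
  ((gwProb p t).toReal : ℂ) * x ^ size t

theorem weight_ofFn (p : ℕ → ℝ≥0∞) (x : ℂ) {m : ℕ} (f : Fin m → PlaneTree) :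
    weight p x (ofFn f) = ((p m).toReal : ℂ) * x * ∏ i, weight p x (f i) := by
  simp only [weight, gwProb_ofFn, size_ofFn, ENNReal.toReal_mul, ENNReal.toReal_prod, pow_add,
    pow_one, Finset.prod_mul_distrib, Finset.prod_pow_eq_pow_sum, Complex.ofReal_mul,
    Complex.ofReal_prod]
  ring

theorem summable_gwProb {p : ℕ → ℝ≥0∞} (hp : ∑' k, p k = 1) :
    Summable fun t : PlaneTree => (gwProb p t).toReal :=
  ENNReal.summable_toReal (ne_top_of_le_ne_top ENNReal.one_ne_top (tsum_gwProb_le_one hp))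

theorem absHasSum_weight_mul {p : ℕ → ℝ≥0∞} (hp : ∑' k, p k = 1) {x : ℂ} {D : PlaneTree → ℂ}
    {M : ℝ} (hD : ∀ t, ‖x ^ size t * D t‖ ≤ M) :
    AbsHasSum (fun t => weight p x t * D t) (∑' t, weight p x t * D t) := by
  have h : Summable fun t => ‖weight p x t * D t‖ := by
    refine .of_nonneg_of_le (fun _ => norm_nonneg _) (fun t => ?_)
      ((summable_gwProb hp).mul_right M)
    rw [weight, mul_assoc, norm_mul, Complex.norm_of_nonneg ENNReal.toReal_nonneg]
    exact mul_le_mul_of_nonneg_left (hD t) ENNReal.toReal_nonneg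
  exact ⟨h, h.of_norm.hasSum⟩

theorem absHasSum_weight {p : ℕ → ℝ≥0∞} (hp : ∑' k, p k = 1) {x : ℂ} (hx : ‖x‖ ≤ 1) :
    AbsHasSum (weight p x) (∑' t, weight p x t) := by
  simpa using absHasSum_weight_mul hp (x := x) (D := 1) (M := 1) fun t => by
    simpa using pow_le_one₀ (norm_nonneg _) hx

/-- The sum over trees decomposed according to the degree of the root. -/
theorem hasSum_degree {F : PlaneTree → ℂ} {s : ℂ} (hF : HasSum F s) {G : ℕ → ℂ}
    (hG : ∀ m, HasSum (fun f : Fin m → PlaneTree => F (ofFn f)) (G m)) : HasSum G s :=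
  HasSum.sigma (f := fun x : Σ m, Fin m → PlaneTree => F (ofFn x.2))
    (equivSigma.hasSum_iff.2 hF) hG

section Recursion

variable {p : ℕ → ℝ≥0∞} {x z α β γ : ℂ}

theorem hasSum_weight_rec (ha : AbsHasSum (weight p x) α) :
    HasSum (fun m : ℕ => ((p m).toReal : ℂ) * x * α ^ m) α := by
  refine hasSum_degree ha.2 fun m => ?_
  simp only [weight_ofFn]
  exact ((ha.prod_tuple m).const_mul _).2

theorem hasSum_depth_rec (ha : AbsHasSum (weight p x) α)
    (hb : AbsHasSum (fun t => weight p x t * depthSum z t) β) :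
    HasSum (fun m : ℕ => ((p m).toReal : ℂ) * x * (α ^ m + z * (m * α ^ (m - 1) * β))) β := by
  refine hasSum_degree hb.2 fun m => ?_
  have h := ((ha.prod_tuple m).add ((ha.prod_mul_sum_tuple hb m).const_mul z)).const_mul
    (((p m).toReal : ℂ) * x)
  convert h.2 using 2 with f
  rw [weight_ofFn, depthSum_ofFn]
  ring

theorem hasSum_dist_rec (ha : AbsHasSum (weight p x) α)
    (hb : AbsHasSum (fun t => weight p x t * depthSum z t) β)
    (hc : AbsHasSum (fun t => weight p x t * distSum z t) γ) :
    HasSum (fun m : ℕ => ((p m).toReal : ℂ) * x * (α ^ m + 2 * z * (m * α ^ (m - 1) * β) +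
      m * α ^ (m - 1) * γ + z ^ 2 * (m * (m - 1) * α ^ (m - 2) * β ^ 2))) γ := by
  refine hasSum_degree hc.2 fun m => ?_
  have h := ((((ha.prod_tuple m).add ((ha.prod_mul_sum_tuple hb m).const_mul (2 * z))).add
    (ha.prod_mul_sum_tuple hc m)).add ((ha.prod_mul_sq_sum_tuple hb m).const_mul (z ^ 2))).const_mul
    (((p m).toReal : ℂ) * x)
  convert h.2 using 2 with f
  rw [weight_ofFn, distSum_ofFn]
  ring

end Recursion

end PlaneTree

/-- The power series with real coefficients `c`, evaluated at a complex number. -/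
noncomputable def realSeries (c : ℕ → ℝ) (s : ℂ) : ℂ := ∑' k, (c k : ℂ) * s ^ k

/-- The coefficients of the derivative of a power series. -/
def derivCoeff (c : ℕ → ℝ) (k : ℕ) : ℝ := (k + 1) * c (k + 1)

/-- The slope `(F 1 - F s) / (1 - s)` of `F = realSeries c`. -/
noncomputable def slopeSeries (c : ℕ → ℝ) (s : ℂ) : ℂ :=
  ∑' k, (c k : ℂ) * ∑ i ∈ Finset.range k, s ^ i

/-- The second order slope `(F s - F 1 + F' 1 * (1 - s)) / (1 - s) ^ 2` of `F = realSeries c`. -/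
noncomputable def slopeSeries₂ (c : ℕ → ℝ) (s : ℂ) : ℂ :=
  ∑' k, (c k : ℂ) * ∑ i ∈ Finset.range k, ∑ j ∈ Finset.range i, s ^ j

section RealSeries

variable {c : ℕ → ℝ} {s : ℂ}

theorem norm_coeff_mul_le (hc : ∀ k, 0 ≤ c k) {a : ℂ} {M : ℝ} {k : ℕ} (ha : ‖a‖ ≤ M) :
    ‖(c k : ℂ) * a‖ ≤ c k * M := by
  rw [norm_mul, Complex.norm_of_nonneg (hc k)]
  exact mul_le_mul_of_nonneg_left ha (hc k)

theorem norm_geom_sum_le (hs : ‖s‖ ≤ 1) (k : ℕ) : ‖∑ i ∈ Finset.range k, s ^ i‖ ≤ k := by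
  refine (norm_sum_le_of_le _ (n := fun _ => (1 : ℝ)) fun i _ => ?_).trans (by simp)
  rw [norm_pow]
  exact pow_le_one₀ (norm_nonneg _) hs

theorem norm_geom_sum₂_le (hs : ‖s‖ ≤ 1) (k : ℕ) :
    ‖∑ i ∈ Finset.range k, ∑ j ∈ Finset.range i, s ^ j‖ ≤ (k : ℝ) ^ 2 := by
  refine (norm_sum_le_of_le _ (n := fun _ => (k : ℝ)) fun i hi => ?_).trans (by simp [sq])
  refine (norm_geom_sum_le hs i).trans ?_
  exact_mod_cast (Finset.mem_range.1 hi).le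

theorem summable_realSeries (hc : ∀ k, 0 ≤ c k) (hs : Summable c) (h : ‖s‖ ≤ 1) :
    Summable fun k => (c k : ℂ) * s ^ k := by
  refine .of_norm_bounded hs fun k => ?_
  simpa using norm_coeff_mul_le hc (a := s ^ k) (M := 1) (k := k)
    (by rw [norm_pow]; exact pow_le_one₀ (norm_nonneg _) h)

theorem hasSum_realSeries (hc : ∀ k, 0 ≤ c k) (hs : Summable c) (h : ‖s‖ ≤ 1) :
    HasSum (fun k => (c k : ℂ) * s ^ k) (realSeries c s) :=
  (summable_realSeries hc hs h).hasSum

theorem norm_realSeries_le (hc : ∀ k, 0 ≤ c k) (hs : Summable c) (h : ‖s‖ ≤ 1) :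
    ‖realSeries c s‖ ≤ ∑' k, c k := by
  refine tsum_of_norm_bounded hs.hasSum fun k => ?_
  simpa using norm_coeff_mul_le hc (a := s ^ k) (M := 1) (k := k)
    (by rw [norm_pow]; exact pow_le_one₀ (norm_nonneg _) h)

theorem realSeries_one (c : ℕ → ℝ) : realSeries c 1 = ((∑' k, c k : ℝ) : ℂ) := by
  simp [realSeries, Complex.ofReal_tsum]

theorem continuousOn_realSeries (hc : ∀ k, 0 ≤ c k) (hs : Summable c) :
    ContinuousOn (realSeries c) (Metric.closedBall 0 1) := by
  refine continuousOn_tsum (fun k => by fun_prop) hs fun k s h => ?_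
  simpa using norm_coeff_mul_le hc (a := s ^ k) (M := 1) (k := k)
    (by rw [norm_pow]; exact pow_le_one₀ (norm_nonneg _) (by simpa using h))

theorem differentiableOn_realSeries (hc : ∀ k, 0 ≤ c k) (hs : Summable c) :
    DifferentiableOn ℂ (realSeries c) (Metric.ball 0 1) := by
  refine Complex.differentiableOn_tsum_of_summable_norm hs (fun k => by fun_prop) Metric.isOpen_ball
    fun k s h => ?_
  simpa using norm_coeff_mul_le hc (a := s ^ k) (M := 1) (k := k)
    (by rw [norm_pow]; exact pow_le_one₀ (norm_nonneg _)
          (by simpa using (mem_ball_zero_iff.1 h).le))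

theorem hasDerivAt_realSeries (hc : ∀ k, 0 ≤ c k) (hs : Summable fun k : ℕ => k * c k)
    (h : ‖s‖ < 1) : HasDerivAt (realSeries c) (realSeries (derivCoeff c) s) s := by
  have h1 := hasDerivAt_tsum_of_isPreconnected (g := fun k s => (c k : ℂ) * s ^ k)
    (g' := fun k s => (c k : ℂ) * (k * s ^ (k - 1))) (t := Metric.ball (0 : ℂ) 1) (y₀ := 0) hs
    Metric.isOpen_ball (convex_ball _ _).isPreconnected
    (fun k y _ => (hasDerivAt_pow k y).const_mul _) (fun k y hy => ?_) (by simp)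
    (summable_of_ne_finset_zero (s := {0}) fun k hk => by simp_all) (mem_ball_zero_iff.2 h)
  · refine h1.congr_deriv ?_
    have hsum : Summable fun k => (c k : ℂ) * (k * s ^ (k - 1)) := by
      refine .of_norm_bounded hs fun k => ?_
      rw [mul_comm (k : ℝ)]
      refine norm_coeff_mul_le hc ?_
      rw [norm_mul, norm_pow, Complex.norm_natCast]
      exact mul_le_of_le_one_right (Nat.cast_nonneg _) (pow_le_one₀ (norm_nonneg _) h.le)
    rw [hsum.tsum_eq_zero_add]
    simp only [realSeries, derivCoeff]
    push_cast
    simp only [zero_mul, mul_zero, zero_add]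
    exact tsum_congr fun k => by ring
  · rw [mul_comm (k : ℝ)]
    refine norm_coeff_mul_le hc ?_
    rw [norm_mul, norm_pow, Complex.norm_natCast]
    exact mul_le_of_le_one_right (Nat.cast_nonneg _)
      (pow_le_one₀ (norm_nonneg _) (mem_ball_zero_iff.1 hy).le)

theorem continuousOn_slopeSeries (hc : ∀ k, 0 ≤ c k) (hs : Summable fun k : ℕ => k * c k) :
    ContinuousOn (slopeSeries c) (Metric.closedBall 0 1) := by
  refine continuousOn_tsum (fun k => by fun_prop) hs fun k s h => ?_
  rw [mul_comm (k : ℝ)]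
  exact norm_coeff_mul_le hc (norm_geom_sum_le (by simpa using h) k)

theorem continuousOn_slopeSeries₂ (hc : ∀ k, 0 ≤ c k)
    (hs : Summable fun k : ℕ => (k : ℝ) ^ 2 * c k) :
    ContinuousOn (slopeSeries₂ c) (Metric.closedBall 0 1) := by
  refine continuousOn_tsum (fun k => by fun_prop) hs fun k s h => ?_
  rw [mul_comm _ (c k)]
  exact norm_coeff_mul_le hc (norm_geom_sum₂_le (by simpa using h) k)

theorem realSeries_eq_slope (hc : ∀ k, 0 ≤ c k) (hs : Summable c)
    (hs1 : Summable fun k : ℕ => k * c k) (h : ‖s‖ ≤ 1) :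
    realSeries c s = realSeries c 1 - (1 - s) * slopeSeries c s := by
  have h2 : Summable fun k => (c k : ℂ) * ∑ i ∈ Finset.range k, s ^ i := by
    refine .of_norm_bounded hs1 fun k => ?_
    rw [mul_comm (k : ℝ)]
    exact norm_coeff_mul_le hc (norm_geom_sum_le h k)
  rw [realSeries, realSeries, slopeSeries, ← tsum_mul_left,
    ← (summable_realSeries hc hs (by simp)).tsum_sub (h2.mul_left _)]
  refine tsum_congr fun k => ?_
  have := mul_neg_geom_sum s k
  linear_combination (c k : ℂ) * this

theorem realSeries_eq_slope₂ (hc : ∀ k, 0 ≤ c k) (hs : Summable c)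
    (hs1 : Summable fun k : ℕ => k * c k) (hs2 : Summable fun k : ℕ => (k : ℝ) ^ 2 * c k)
    (h : ‖s‖ ≤ 1) :
    realSeries c s = realSeries c 1 - (1 - s) * ((∑' k : ℕ, k * c k : ℝ) : ℂ) +
      (1 - s) ^ 2 * slopeSeries₂ c s := by
  have h2 : Summable fun k => (c k : ℂ) * ∑ i ∈ Finset.range k, ∑ j ∈ Finset.range i, s ^ j := by
    refine .of_norm_bounded hs2 fun k => ?_
    rw [mul_comm _ (c k)]
    exact norm_coeff_mul_le hc (norm_geom_sum₂_le h k)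
  have h1 : Summable fun k : ℕ => ((k * c k : ℝ) : ℂ) := Complex.summable_ofReal.2 hs1
  rw [realSeries_eq_slope hc hs hs1 h, sub_add, sub_right_inj, Complex.ofReal_tsum, slopeSeries,
    slopeSeries₂, ← tsum_mul_left, ← tsum_mul_left, ← tsum_mul_left,
    ← (h1.mul_left (1 - s)).tsum_sub (h2.mul_left _)]
  refine tsum_congr fun k => ?_
  have e : ∑ i ∈ Finset.range k, s ^ i =
      k - (1 - s) * ∑ i ∈ Finset.range k, ∑ j ∈ Finset.range i, s ^ j := by
    rw [Finset.mul_sum]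
    simp only [mul_neg_geom_sum, Finset.sum_sub_distrib]
    simp
  rw [e]
  push_cast
  ring

end RealSeries

/-- Critical offspring distributions with finite variance and positive extinction rate. -/
structure CriticalOffspring (q : ℕ → ℝ) : Prop where
  nonneg : ∀ k, 0 ≤ q k
  hasSum : HasSum q 1
  hasSum_mean : HasSum (fun k : ℕ => k * q k) 1
  summable_sq : Summable fun k : ℕ => (k : ℝ) ^ 2 * q k
  zero_pos : 0 < q 0

/-- The variance `∑ k (k - 1) q k` of a critical offspring distribution. -/
noncomputable def offspringVar (q : ℕ → ℝ) : ℝ := ∑' k : ℕ, (k : ℝ) * (k - 1) * q k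

namespace CriticalOffspring

variable {q : ℕ → ℝ}

theorem exists_two_le (hq : CriticalOffspring q) : ∃ k, 2 ≤ k ∧ 0 < q k := by
  by_contra! h
  have h0 : ∀ k, 2 ≤ k → q k = 0 := fun k hk => le_antisymm (h k hk) (hq.nonneg k)
  have h1 : HasSum q (∑ k ∈ Finset.range 2, q k) :=
    hasSum_sum_of_ne_finset_zero fun k hk => h0 k (by simp at hk; omega)
  have h2 : HasSum (fun k : ℕ => k * q k) (∑ k ∈ Finset.range 2, (k : ℕ) * q k) :=
    hasSum_sum_of_ne_finset_zero fun k hk => by rw [h0 k (by simp at hk; omega), mul_zero]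
  have e1 := h1.unique hq.hasSum
  have e2 := h2.unique hq.hasSum_mean
  simp only [Finset.sum_range_succ, Finset.sum_range_zero] at e1 e2
  have := hq.zero_pos
  norm_num at e2
  linarith

theorem summable_factorial (hq : CriticalOffspring q) :
    Summable fun k : ℕ => (k : ℝ) * (k - 1) * q k := by
  refine (hq.summable_sq.sub hq.hasSum_mean.summable).congr fun k => by ring

theorem factorial_nonneg (hq : CriticalOffspring q) (k : ℕ) : 0 ≤ (k : ℝ) * (k - 1) * q k := by
  refine mul_nonneg ?_ (hq.nonneg k)
  rcases k with _ | k
  · simp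
  · push_cast; rw [add_sub_cancel_right]; positivity

theorem var_pos (hq : CriticalOffspring q) : 0 < offspringVar q := by
  obtain ⟨k, hk, hqk⟩ := hq.exists_two_le
  refine hq.summable_factorial.tsum_pos hq.factorial_nonneg k ?_
  have : (2 : ℝ) ≤ k := by exact_mod_cast hk
  exact mul_pos (mul_pos (by linarith) (by linarith)) hqk

theorem deriv_nonneg (hq : CriticalOffspring q) (k : ℕ) : 0 ≤ derivCoeff q k :=
  mul_nonneg (by positivity) (hq.nonneg _)

theorem hasSum_deriv (hq : CriticalOffspring q) : HasSum (derivCoeff q) 1 := by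
  have := (hasSum_nat_add_iff' 1).2 hq.hasSum_mean
  simp only [Finset.sum_range_one, Nat.cast_zero, zero_mul, sub_zero] at this
  exact this.congr_fun fun k => by simp [derivCoeff]

theorem hasSum_deriv_mean (hq : CriticalOffspring q) :
    HasSum (fun k : ℕ => k * derivCoeff q k) (offspringVar q) := by
  have := (hasSum_nat_add_iff' 1).2 hq.summable_factorial.hasSum
  simp only [Finset.sum_range_one, Nat.cast_zero, zero_mul, sub_zero, Nat.cast_add, Nat.cast_one,
    add_sub_cancel_right] at this
  exact this.congr_fun fun k => by simp only [derivCoeff]; ring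

theorem deriv₂_nonneg (hq : CriticalOffspring q) (k : ℕ) : 0 ≤ derivCoeff (derivCoeff q) k :=
  mul_nonneg (by positivity) (hq.deriv_nonneg _)

theorem hasSum_deriv₂ (hq : CriticalOffspring q) :
    HasSum (derivCoeff (derivCoeff q)) (offspringVar q) := by
  have := (hasSum_nat_add_iff' 1).2 hq.hasSum_deriv_mean
  simp only [Finset.sum_range_one, Nat.cast_zero, zero_mul, sub_zero] at this
  exact this.congr_fun fun k => by simp [derivCoeff]

theorem realSeries_one_eq (hq : CriticalOffspring q) : realSeries q 1 = 1 := by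
  rw [realSeries_one, hq.hasSum.tsum_eq, Complex.ofReal_one]

theorem realSeries_deriv_one (hq : CriticalOffspring q) : realSeries (derivCoeff q) 1 = 1 := by
  rw [realSeries_one, hq.hasSum_deriv.tsum_eq, Complex.ofReal_one]

theorem realSeries_deriv₂_one (hq : CriticalOffspring q) :
    realSeries (derivCoeff (derivCoeff q)) 1 = offspringVar q := by
  rw [realSeries_one, hq.hasSum_deriv₂.tsum_eq]

theorem slopeSeries_deriv_one (hq : CriticalOffspring q) :
    slopeSeries (derivCoeff q) 1 = offspringVar q := by
  rw [← hq.hasSum_deriv_mean.tsum_eq, Complex.ofReal_tsum, slopeSeries]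
  refine tsum_congr fun k => ?_
  simp [mul_comm]

theorem slopeSeries₂_one : slopeSeries₂ q 1 = offspringVar q / 2 := by
  rw [offspringVar, Complex.ofReal_tsum, slopeSeries₂, ← tsum_div_const]
  refine tsum_congr fun k => ?_
  have : ∑ i ∈ Finset.range k, (i : ℂ) = k * (k - 1) / 2 := by
    induction k with
    | zero => simp
    | succ k ih => rw [Finset.sum_range_succ, ih]; push_cast; ring
  simp only [one_pow, Finset.sum_const, Finset.card_range, nsmul_eq_mul, mul_one, this]
  push_cast
  ring

/-- Second order expansion of the offspring generating function at `1`. -/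
theorem realSeries_eq (hq : CriticalOffspring q) {s : ℂ} (h : ‖s‖ ≤ 1) :
    realSeries q s = s + (1 - s) ^ 2 * slopeSeries₂ q s := by
  rw [realSeries_eq_slope₂ hq.nonneg hq.hasSum.summable hq.hasSum_mean.summable hq.summable_sq h,
    hq.realSeries_one_eq, hq.hasSum_mean.tsum_eq]
  push_cast
  ring

theorem realSeries_deriv_eq (hq : CriticalOffspring q) {s : ℂ} (h : ‖s‖ ≤ 1) :
    realSeries (derivCoeff q) s = 1 - (1 - s) * slopeSeries (derivCoeff q) s := by
  rw [realSeries_eq_slope hq.deriv_nonneg hq.hasSum_deriv.summable hq.hasSum_deriv_mean.summable h,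
    hq.realSeries_deriv_one]

theorem norm_realSeries_le_one (hq : CriticalOffspring q) {s : ℂ} (h : ‖s‖ ≤ 1) :
    ‖realSeries q s‖ ≤ 1 :=
  (norm_realSeries_le hq.nonneg hq.hasSum.summable h).trans_eq hq.hasSum.tsum_eq

theorem norm_deriv_le_one (hq : CriticalOffspring q) {s : ℂ} (h : ‖s‖ ≤ 1) :
    ‖realSeries (derivCoeff q) s‖ ≤ 1 :=
  (norm_realSeries_le hq.deriv_nonneg hq.hasSum_deriv.summable h).trans_eq hq.hasSum_deriv.tsum_eq

theorem norm_deriv₂_le (hq : CriticalOffspring q) {s : ℂ} (h : ‖s‖ ≤ 1) :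
    ‖realSeries (derivCoeff (derivCoeff q)) s‖ ≤ offspringVar q :=
  (norm_realSeries_le hq.deriv₂_nonneg hq.hasSum_deriv₂.summable h).trans_eq
    hq.hasSum_deriv₂.tsum_eq

theorem hasDerivAt_realSeries (hq : CriticalOffspring q) {s : ℂ} (h : ‖s‖ < 1) :
    HasDerivAt (realSeries q) (realSeries (derivCoeff q) s) s :=
  _root_.hasDerivAt_realSeries hq.nonneg hq.hasSum_mean.summable h

theorem hasDerivAt_deriv (hq : CriticalOffspring q) {s : ℂ} (h : ‖s‖ < 1) :
    HasDerivAt (realSeries (derivCoeff q)) (realSeries (derivCoeff (derivCoeff q)) s) s :=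
  _root_.hasDerivAt_realSeries hq.deriv_nonneg hq.hasSum_deriv_mean.summable h

theorem differentiableAt_deriv₂ (hq : CriticalOffspring q) {s : ℂ} (h : ‖s‖ < 1) :
    DifferentiableAt ℂ (realSeries (derivCoeff (derivCoeff q))) s :=
  (differentiableOn_realSeries hq.deriv₂_nonneg hq.hasSum_deriv₂.summable).differentiableAt
    (Metric.isOpen_ball.mem_nhds (mem_ball_zero_iff.2 h))

/-- Cauchy's estimate for the third derivative of the offspring generating function. -/
theorem norm_deriv_deriv₂_le (hq : CriticalOffspring q) {s : ℂ} (h : ‖s‖ < 1) :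
    ‖deriv (realSeries (derivCoeff (derivCoeff q))) s‖ ≤ 2 * offspringVar q / (1 - ‖s‖) := by
  have hr : 0 < (1 - ‖s‖) / 2 := by linarith
  have hsub : ∀ w ∈ Metric.closedBall s ((1 - ‖s‖) / 2), ‖w‖ < 1 := by
    intro w hw
    have h1 : ‖w - s‖ ≤ (1 - ‖s‖) / 2 := by simpa [dist_eq_norm] using hw
    have h2 := norm_sub_norm_le w s
    linarith
  have key := Complex.norm_deriv_le_of_forall_mem_sphere_norm_le hr
    (f := realSeries (derivCoeff (derivCoeff q))) (c := s) (C := offspringVar q) ?_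
    fun w hw => hq.norm_deriv₂_le (hsub w (Metric.sphere_subset_closedBall hw)).le
  · refine key.trans_eq ?_
    have : 1 - ‖s‖ ≠ 0 := by linarith
    field_simp
  · refine DifferentiableOn.diffContOnCl fun w hw => ?_
    rw [closure_ball _ hr.ne'] at hw
    exact (hq.differentiableAt_deriv₂ (hsub w hw)).differentiableWithinAt

/-- The derivative of the generating function stays away from the unit circle away from `1`. -/
theorem exists_norm_deriv_le (hq : CriticalOffspring q) : ∃ c > 0, ∀ s : ℂ, ‖s‖ ≤ 1 →
    ‖realSeries (derivCoeff q) s‖ ≤ 1 - c * (1 - ‖s‖) := by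
  obtain ⟨k, hk, hqk⟩ := hq.exists_two_le
  obtain ⟨j, rfl⟩ := Nat.exists_eq_add_of_le hk
  have hpos : 0 < derivCoeff q (j + 1) := by
    rw [derivCoeff, show j + 1 + 1 = 2 + j by omega]; positivity
  refine ⟨derivCoeff q (j + 1), hpos, fun s hs => ?_⟩
  have hb : HasSum (fun k => derivCoeff q k - if k = j + 1 then
      derivCoeff q (j + 1) * (1 - ‖s‖) else 0) (1 - derivCoeff q (j + 1) * (1 - ‖s‖)) :=
    hq.hasSum_deriv.sub (hasSum_ite_eq _ _)
  refine tsum_of_norm_bounded hb fun k => ?_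
  split_ifs with hkj
  · subst hkj
    refine (norm_coeff_mul_le hq.deriv_nonneg (M := ‖s‖) ?_).trans_eq (by ring)
    rw [norm_pow, pow_succ]
    exact mul_le_of_le_one_left (norm_nonneg _) (pow_le_one₀ (norm_nonneg _) hs)
  · rw [sub_zero]
    refine (norm_coeff_mul_le hq.deriv_nonneg (M := 1) ?_).trans_eq (mul_one _)
    rw [norm_pow]
    exact pow_le_one₀ (norm_nonneg _) hs

/-- If the generating function has modulus one on the unit circle then all relevant powers are
equal to one. -/
theorem pow_eq_one_of_norm_eq_one (hq : CriticalOffspring q) {s : ℂ} (hs : ‖s‖ ≤ 1)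
    (h : ‖realSeries q s‖ = 1) {k : ℕ}
    (hk : q k ≠ 0) : s ^ k = 1 := by
  set e := realSeries q s with he
  have hsum : HasSum (fun k => q k * (1 - (star e * s ^ k).re)) (1 - 1) := by
    have h1 : HasSum (fun k => (star e * ((q k : ℂ) * s ^ k)).re) ((star e * e).re) :=
      Complex.hasSum_re ((hasSum_realSeries hq.nonneg hq.hasSum.summable hs).mul_left (star e))
    have h2 : (star e * e).re = 1 := by
      rw [Complex.star_def, Complex.conj_mul', h]; simp
    rw [h2] at h1
    refine (hq.hasSum.sub h1).congr_fun fun k => ?_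
    rw [mul_left_comm, Complex.re_ofReal_mul]
    ring
  rw [sub_self] at hsum
  have hre : ∀ k, (star e * s ^ k).re ≤ 1 := fun k => by
    refine (Complex.re_le_norm _).trans ?_
    rw [norm_mul, norm_star, h, one_mul, norm_pow]
    exact pow_le_one₀ (norm_nonneg _) hs
  have hzero := (hasSum_zero_iff_of_nonneg fun k =>
    mul_nonneg (hq.nonneg k) (sub_nonneg.2 (hre k))).1 hsum
  have hpow : ∀ k, q k ≠ 0 → s ^ k = e := by
    intro k hk
    have h1 : (star e * s ^ k).re = 1 := by
      have := congrFun hzero k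
      simp only [Pi.zero_apply, mul_eq_zero, hk, false_or] at this
      linarith
    have h2 : ‖s ^ k - e‖ ^ 2 ≤ 0 := by
      have h3 : ‖s ^ k‖ ≤ 1 := by rw [norm_pow]; exact pow_le_one₀ (norm_nonneg _) hs
      have h4 : ‖s ^ k - e‖ ^ 2 = ‖s ^ k‖ ^ 2 + ‖e‖ ^ 2 - 2 * (star e * s ^ k).re := by
        simp only [← Complex.normSq_eq_norm_sq, Complex.normSq_sub, Complex.star_def]
        rw [mul_comm (s ^ k)]
      rw [h4, h1, h]
      nlinarith [norm_nonneg (s ^ k)]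
    have h5 : ‖s ^ k - e‖ = 0 := pow_eq_zero_iff two_ne_zero |>.1 (le_antisymm h2 (sq_nonneg _))
    exact sub_eq_zero.1 (norm_eq_zero.1 h5)
  rw [hpow k hk, ← hpow 0 hq.zero_pos.ne', pow_zero]

end CriticalOffspring

/-- `d` is the span of the distribution `q`: the greatest common divisor of its support. -/
structure IsSpan (q : ℕ → ℝ) (d : ℕ) : Prop where
  pos : 0 < d
  dvd : ∀ k, q k ≠ 0 → d ∣ k
  pow_eq_one : ∀ ζ : ℂ, (∀ k, q k ≠ 0 → ζ ^ k = 1) → ζ ^ d = 1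

theorem CriticalOffspring.exists_isSpan {q : ℕ → ℝ} (hq : CriticalOffspring q) :
    ∃ d, IsSpan q d := by
  set S : Set ℤ := {m | ∃ k : ℕ, q k ≠ 0 ∧ (k : ℤ) = m}
  obtain ⟨a, ha⟩ := Int.subgroup_cyclic (AddSubgroup.closure S)
  have hmem : ∀ k : ℕ, q k ≠ 0 → a ∣ (k : ℤ) := by
    intro k hk
    have : (k : ℤ) ∈ AddSubgroup.closure S := AddSubgroup.subset_closure ⟨k, hk, rfl⟩
    rw [ha, AddSubgroup.mem_closure_singleton] at this
    obtain ⟨n, hn⟩ := this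
    exact ⟨n, by rw [← hn, smul_eq_mul, mul_comm]⟩
  obtain ⟨k, hk, hqk⟩ := hq.exists_two_le
  refine ⟨a.natAbs, Int.natAbs_pos.2 ?_, fun k hk => Int.natAbs_dvd_natAbs.2 (hmem k hk),
    fun ζ hζ => ?_⟩
  · rintro rfl
    have := zero_dvd_iff.1 (hmem k hqk.ne')
    omega
  · have hζ0 : ζ ≠ 0 := by
      rintro rfl
      have := hζ k hqk.ne'
      rw [zero_pow (by omega)] at this
      exact zero_ne_one this
    have key : ∀ m ∈ AddSubgroup.closure S, ζ ^ m = 1 := by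
      intro m hm
      induction hm using AddSubgroup.closure_induction with
      | mem m hm =>
        obtain ⟨k, hk, rfl⟩ := hm
        rw [zpow_natCast, hζ k hk]
      | zero => simp
      | add m n _ _ h1 h2 => rw [zpow_add₀ hζ0, h1, h2, one_mul]
      | neg m _ h => rw [zpow_neg, h, inv_one]
    have h1 : ζ ^ a = 1 := key a (by rw [ha]; exact AddSubgroup.subset_closure rfl)
    rcases Int.natAbs_eq a with h | h
    · rw [← zpow_natCast, ← h, h1]
    · rw [← zpow_natCast, ← inv_inj, ← zpow_neg, ← h, h1, inv_one]

/-- `g` is the total progeny distribution for the critical offspring distribution `q`, which has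
span `d`. -/
structure IsProgeny (q g : ℕ → ℝ) (d : ℕ) : Prop where
  critical : CriticalOffspring q
  span : IsSpan q d
  nonneg : ∀ n, 0 ≤ g n
  summable : Summable g
  tsum_le : ∑' n, g n ≤ 1
  rec_eq : ∀ x : ℂ, ‖x‖ ≤ 1 → realSeries g x = x * realSeries q (realSeries g x)
  exists_eq : ∀ n, g n ≠ 0 → ∃ m, n = d * m + 1

/-- The function `x Φ'(G(x))`, where `Φ` and `G` are the generating functions of the offspring and
of the total progeny. -/
noncomputable def spineSeries (q g : ℕ → ℝ) (x : ℂ) : ℂ :=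
  x * realSeries (derivCoeff q) (realSeries g x)

theorem slopeSeries₂_ne_zero {q : ℕ → ℝ} (hq : CriticalOffspring q) {s : ℝ} (h0 : 0 ≤ s)
    (h1 : s ≤ 1) : slopeSeries₂ q s ≠ 0 := by
  have e : slopeSeries₂ q s =
      ((∑' k, q k * ∑ i ∈ Finset.range k, ∑ j ∈ Finset.range i, s ^ j : ℝ) : ℂ) := by
    rw [slopeSeries₂, Complex.ofReal_tsum]
    push_cast
    rfl
  rw [e, Complex.ofReal_ne_zero]
  have hnn : ∀ k, 0 ≤ q k * ∑ i ∈ Finset.range k, ∑ j ∈ Finset.range i, s ^ j := fun k =>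
    mul_nonneg (hq.nonneg k) (by positivity)
  have hsum : Summable fun k => q k * ∑ i ∈ Finset.range k, ∑ j ∈ Finset.range i, s ^ j := by
    refine .of_norm_bounded hq.summable_sq fun k => ?_
    rw [Real.norm_of_nonneg (hnn k), mul_comm _ (q k)]
    refine mul_le_mul_of_nonneg_left ?_ (hq.nonneg k)
    have := norm_geom_sum₂_le (s := s) (by rwa [Complex.norm_of_nonneg h0]) k
    have e : ∑ i ∈ Finset.range k, ∑ j ∈ Finset.range i, (s : ℂ) ^ j =
      ((∑ i ∈ Finset.range k, ∑ j ∈ Finset.range i, s ^ j : ℝ) : ℂ) := by push_cast; rfl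
    rw [e, Complex.norm_real] at this
    exact (le_abs_self _).trans this
  obtain ⟨k, hk, hqk⟩ := hq.exists_two_le
  refine (hsum.tsum_pos hnn k (mul_pos hqk ?_)).ne'
  refine Finset.sum_pos' (fun i _ => by positivity) ⟨1, Finset.mem_range.2 (by omega), by simp⟩

namespace IsProgeny

variable {q g : ℕ → ℝ} {d : ℕ} {x : ℂ}

theorem norm_le_one (h : IsProgeny q g d) (hx : ‖x‖ ≤ 1) : ‖realSeries g x‖ ≤ 1 :=
  (norm_realSeries_le h.nonneg h.summable hx).trans h.tsum_le

theorem norm_le (h : IsProgeny q g d) (hx : ‖x‖ ≤ 1) : ‖realSeries g x‖ ≤ ‖x‖ := by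
  rw [h.rec_eq x hx, norm_mul]
  exact mul_le_of_le_one_right (norm_nonneg _)
    (h.critical.norm_realSeries_le_one (h.norm_le_one hx))

theorem continuousOn (h : IsProgeny q g d) :
    ContinuousOn (realSeries g) (Metric.closedBall 0 1) :=
  continuousOn_realSeries h.nonneg h.summable

theorem mapsTo (h : IsProgeny q g d) :
    MapsTo (realSeries g) (Metric.closedBall 0 1) (Metric.closedBall 0 1) := fun x hx => by
  simpa using h.norm_le_one (x := x) (by simpa using hx)

theorem realSeries_one (h : IsProgeny q g d) : realSeries g 1 = 1 := by
  have h1 := h.rec_eq 1 (by simp)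
  rw [_root_.realSeries_one, one_mul] at h1
  rw [_root_.realSeries_one]
  set s : ℝ := ∑' n, g n
  have hs0 : 0 ≤ s := tsum_nonneg h.nonneg
  have hs1 : s ≤ 1 := h.tsum_le
  rw [h.critical.realSeries_eq (by rwa [Complex.norm_of_nonneg hs0])] at h1
  have h2 : (1 - (s : ℂ)) ^ 2 * slopeSeries₂ q s = 0 := by linear_combination -h1
  have h3 := (mul_eq_zero.1 h2).resolve_right (slopeSeries₂_ne_zero h.critical hs0 hs1)
  have h4 := pow_eq_zero_iff two_ne_zero |>.1 h3
  linear_combination -h4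

theorem pow_eq_one_of_norm_eq_one (h : IsProgeny q g d) (hx : ‖x‖ ≤ 1)
    (hG : ‖realSeries g x‖ = 1) : x ^ d = 1 := by
  have h1 := h.rec_eq x hx
  have hΦ := h.critical.norm_realSeries_le_one (h.norm_le_one hx)
  have h2 : ‖realSeries q (realSeries g x)‖ = 1 := by
    refine le_antisymm hΦ ?_
    rw [← hG]
    nth_rewrite 1 [h1]
    rw [norm_mul]
    exact mul_le_of_le_one_left (norm_nonneg _) hx
  have h3 := fun k => h.critical.pow_eq_one_of_norm_eq_one (k := k) hG.le h2
  have h4 : realSeries q (realSeries g x) = 1 := by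
    rw [← h.critical.realSeries_one_eq]
    refine tsum_congr fun k => ?_
    by_cases hk : q k = 0
    · simp [hk]
    · rw [h3 k hk, one_pow]
  rw [h4, mul_one] at h1
  rw [← h1]
  exact h.span.pow_eq_one _ fun k hk => h3 k hk

theorem realSeries_mul (h : IsProgeny q g d) {ω : ℂ} (hω : ω ^ d = 1) (x : ℂ) :
    realSeries g (ω * x) = ω * realSeries g x := by
  rw [realSeries, realSeries, ← tsum_mul_left]
  refine tsum_congr fun n => ?_
  by_cases hn : g n = 0
  · simp [hn]
  · obtain ⟨m, rfl⟩ := h.exists_eq n hn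
    rw [mul_pow, pow_succ ω, pow_mul, hω]
    ring

theorem offspring_mul (h : IsProgeny q g d) {ω : ℂ} (hω : ω ^ d = 1) (s : ℂ) :
    realSeries q (ω * s) = realSeries q s := by
  refine tsum_congr fun k => ?_
  by_cases hk : q k = 0
  · simp [hk]
  · obtain ⟨m, rfl⟩ := h.span.dvd k hk
    rw [mul_pow, pow_mul ω, hω, one_pow, one_mul]

theorem offspring_deriv_mul (h : IsProgeny q g d) {ω : ℂ} (hω : ω ^ d = 1) (s : ℂ) :
    ω * realSeries (derivCoeff q) (ω * s) = realSeries (derivCoeff q) s := by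
  rw [realSeries, realSeries, ← tsum_mul_left]
  refine tsum_congr fun k => ?_
  by_cases hk : q (k + 1) = 0
  · simp [derivCoeff, hk]
  · obtain ⟨m, hm⟩ := h.span.dvd _ hk
    have : ω ^ (k + 1) = 1 := by rw [hm, pow_mul, hω, one_pow]
    rw [mul_pow]
    linear_combination (derivCoeff q k : ℂ) * s ^ k * this

theorem offspring_deriv₂_mul (h : IsProgeny q g d) {ω : ℂ} (hω : ω ^ d = 1) (s : ℂ) :
    ω ^ 2 * realSeries (derivCoeff (derivCoeff q)) (ω * s) =
      realSeries (derivCoeff (derivCoeff q)) s := by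
  rw [realSeries, realSeries, ← tsum_mul_left]
  refine tsum_congr fun k => ?_
  by_cases hk : q (k + 1 + 1) = 0
  · simp [derivCoeff, hk]
  · obtain ⟨m, hm⟩ := h.span.dvd _ hk
    have : ω ^ (k + 1 + 1) = 1 := by rw [hm, pow_mul, hω, one_pow]
    rw [mul_pow]
    linear_combination (derivCoeff (derivCoeff q) k : ℂ) * s ^ k * this

theorem spineSeries_mul (h : IsProgeny q g d) {ω : ℂ} (hω : ω ^ d = 1) (x : ℂ) :
    spineSeries q g (ω * x) = spineSeries q g x := by
  rw [spineSeries, spineSeries, h.realSeries_mul hω, ← h.offspring_deriv_mul hω (realSeries g x)]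
  ring

theorem norm_spineSeries_le (h : IsProgeny q g d) (hx : ‖x‖ ≤ 1) :
    ‖spineSeries q g x‖ ≤ ‖x‖ := by
  rw [spineSeries, norm_mul]
  exact mul_le_of_le_one_right (norm_nonneg _) (h.critical.norm_deriv_le_one (h.norm_le_one hx))

theorem spineSeries_ne_one (h : IsProgeny q g d) (hx : ‖x‖ < 1) : 1 - spineSeries q g x ≠ 0 := by
  intro h0
  have := h.norm_spineSeries_le hx.le
  rw [← sub_eq_zero.1 h0, norm_one] at this
  linarith

theorem spineSeries_one (h : IsProgeny q g d) : spineSeries q g 1 = 1 := by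
  rw [spineSeries, h.realSeries_one, h.critical.realSeries_deriv_one, one_mul]

theorem continuousOn_spineSeries (h : IsProgeny q g d) :
    ContinuousOn (spineSeries q g) (Metric.closedBall 0 1) :=
  continuousOn_id.mul ((continuousOn_realSeries h.critical.deriv_nonneg
    h.critical.hasSum_deriv.summable).comp h.continuousOn h.mapsTo)

/-- Near the roots of unity of order `d`, or `G` is bounded away from the unit circle. -/
theorem exists_cover (h : IsProgeny q g d) {U : Set ℂ}
    (hU : U ∈ nhdsWithin (1 : ℂ) (Metric.closedBall 0 1)) :
    ∃ κ > 0, ∀ x : ℂ, ‖x‖ ≤ 1 →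
      (∃ ω : ℂ, ω ^ d = 1 ∧ ω * x ∈ U) ∨ κ ≤ 1 - ‖realSeries g x‖ := by
  obtain ⟨V, hVo, hV1, hVU⟩ := mem_nhdsWithin.1 hU
  set K : Set ℂ := Metric.closedBall 0 1 ∩ ⋂ ω ∈ {ω : ℂ | ω ^ d = 1}, (fun x => ω * x) ⁻¹' Vᶜ
  have hK : IsCompact K := (isCompact_closedBall _ _).inter_right
    (isClosed_biInter fun ω _ => hVo.isClosed_compl.preimage (by fun_prop))
  have hpos : ∀ x ∈ K, 0 < 1 - ‖realSeries g x‖ := by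
    intro x hx
    have hx1 : ‖x‖ ≤ 1 := by simpa using hx.1
    refine sub_pos.2 (lt_of_le_of_ne (h.norm_le_one hx1) fun heq => ?_)
    have hxd := h.pow_eq_one_of_norm_eq_one hx1 heq
    have hx0 : x ≠ 0 := by
      rintro rfl
      rw [zero_pow h.span.pos.ne'] at hxd
      exact zero_ne_one hxd
    have := mem_iInter₂.1 hx.2 x⁻¹ (by rw [mem_ofPred_eq, inv_pow, hxd, inv_one])
    exact this (by simpa [hx0] using hV1)
  have hcase : ∀ x : ℂ, ‖x‖ ≤ 1 → (∃ ω : ℂ, ω ^ d = 1 ∧ ω * x ∈ U) ∨ x ∈ K := by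
    intro x hx
    refine or_iff_not_imp_left.2 fun hn => ⟨by simpa using hx, mem_iInter₂.2 fun ω hω hωV => hn ?_⟩
    refine ⟨ω, hω, hVU ⟨hωV, ?_⟩⟩
    have : ‖ω‖ = 1 := Complex.norm_eq_one_of_pow_eq_one hω h.span.pos.ne'
    simpa [this] using hx
  rcases K.eq_empty_or_nonempty with hE | hE
  · exact ⟨1, one_pos, fun x hx => .inl ((hcase x hx).resolve_right (by simp [hE]))⟩
  · obtain ⟨x₀, hx₀, hmin⟩ := hK.exists_isMinOn hE (f := fun x => 1 - ‖realSeries g x‖)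
      (continuousOn_const.sub (h.continuousOn.norm.mono inter_subset_left))
    exact ⟨_, hpos x₀ hx₀, fun x hx => (hcase x hx).imp_right fun hxK => hmin hxK⟩

theorem hasDerivAt (h : IsProgeny q g d) (hx : ‖x‖ < 1) :
    HasDerivAt (realSeries g) (realSeries q (realSeries g x) / (1 - spineSeries q g x)) x := by
  have hmem : Metric.ball (0 : ℂ) 1 ∈ nhds x := Metric.isOpen_ball.mem_nhds (mem_ball_zero_iff.2 hx)
  have hd := ((differentiableOn_realSeries h.nonneg h.summable).differentiableAt hmem).hasDerivAt
  have hG : ‖realSeries g x‖ < 1 := (h.norm_le hx.le).trans_lt hx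
  have h2 := (hasDerivAt_id x).mul ((h.critical.hasDerivAt_realSeries hG).comp x hd)
  have h3 : HasDerivAt (realSeries g) _ x := h2.congr_of_eventuallyEq <| by
    filter_upwards [hmem] with y hy
    exact h.rec_eq y (mem_ball_zero_iff.1 hy).le
  have h4 := hd.unique h3
  simp only [id, Function.comp] at h4
  refine hd.congr_deriv (Eq.symm ?_)
  rw [div_eq_iff (h.spineSeries_ne_one hx), spineSeries]
  linear_combination -h4

theorem hasDerivAt_spineSeries (h : IsProgeny q g d) (hx : ‖x‖ < 1) :
    HasDerivAt (spineSeries q g) (realSeries (derivCoeff q) (realSeries g x) +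
      x * (realSeries (derivCoeff (derivCoeff q)) (realSeries g x) *
        (realSeries q (realSeries g x) / (1 - spineSeries q g x)))) x := by
  have hG : ‖realSeries g x‖ < 1 := (h.norm_le hx.le).trans_lt hx
  have := (hasDerivAt_id x).mul ((h.critical.hasDerivAt_deriv hG).comp x (h.hasDerivAt hx))
  exact this.congr_deriv (by simp)

end IsProgeny

/-- If `a` lies in the right half plane and `a ^ 2` is nearly in it, then `a` lies in a cone. -/
theorem abs_im_le_two_mul_re {a y ρ : ℂ} {r : ℝ} (ha : 0 ≤ a.re) (hy : 0 ≤ y.re) (hr : 0 < r)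
    (hρ : ‖ρ - r‖ ≤ 3 / 8 * r) (h : a ^ 2 = y * ρ) : |a.im| ≤ 2 * a.re := by
  have h1 : (a ^ 2).re = r * y.re + (y * (ρ - r)).re := by
    rw [h]; simp [mul_sub]; ring
  have h2 : -(‖y‖ * (3 / 8 * r)) ≤ (y * (ρ - r)).re := by
    have := (abs_le.1 (Complex.abs_re_le_norm (y * (ρ - r)))).1
    rw [norm_mul] at this
    have := mul_le_mul_of_nonneg_left hρ (norm_nonneg y)
    linarith
  have h3 : ‖a‖ ^ 2 = ‖y‖ * ‖ρ‖ := by rw [← norm_pow, h, norm_mul]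
  have h4 : 5 / 8 * r ≤ ‖ρ‖ := by
    have := norm_sub_norm_le (r : ℂ) ρ
    rw [norm_sub_rev, Complex.norm_of_nonneg hr.le] at this
    linarith
  have h5 : ‖y‖ * (5 / 8 * r) ≤ ‖a‖ ^ 2 := by
    rw [h3]; exact mul_le_mul_of_nonneg_left h4 (norm_nonneg y)
  have h6 : (a ^ 2).re = a.re ^ 2 - a.im ^ 2 := by rw [pow_two, Complex.mul_re]; ring
  have h7 : ‖a‖ ^ 2 = a.re ^ 2 + a.im ^ 2 := by
    rw [← Complex.normSq_eq_norm_sq, Complex.normSq_apply]; ring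
  have h8 : 0 ≤ r * y.re := mul_nonneg hr.le hy
  refine abs_le_of_sq_le_sq ?_ (by linarith)
  nlinarith

/-- Elements of a cone around the positive reals do not cancel against elements of a region
slightly larger than the right half plane. -/
theorem norm_add_ge_of_cone {a b : ℂ} (ha : |a.im| ≤ 2 * a.re) (hb : -(‖b‖ / 10) ≤ b.re) :
    (‖a‖ + ‖b‖) / 20 ≤ ‖a + b‖ := by
  have ha0 : 0 ≤ a.re := by linarith [abs_nonneg a.im]
  have ha1 : ‖a‖ ≤ 3 * a.re := (Complex.norm_le_abs_re_add_abs_im a).trans (by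
    rw [abs_of_nonneg ha0]; linarith)
  have hb1 : ‖b‖ ^ 2 = b.re ^ 2 + |b.im| ^ 2 := by
    rw [← Complex.normSq_eq_norm_sq, Complex.normSq_apply, sq_abs]; ring
  have hb0 := norm_nonneg b
  have hb2 : ‖b‖ / 10 ≤ b.re + |b.im| / 3 := by
    rcases le_total (‖b‖ / 10) b.re with h | h
    · linarith [abs_nonneg b.im]
    · have : 9 / 10 * ‖b‖ ≤ |b.im| := by
        refine le_of_sq_le_sq ?_ (abs_nonneg _)
        nlinarith
      linarith
  have hre := Complex.re_le_norm (a + b)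
  have him := Complex.abs_im_le_norm (a + b)
  have h3 : |b.im| - |a.im| ≤ |(a + b).im| := by
    have := abs_sub_abs_le_abs_sub b.im (-a.im)
    rw [abs_neg, sub_neg_eq_add, add_comm b.im] at this
    simpa using this
  rw [Complex.add_re] at hre
  linarith

theorem neg_le_re_one_sub_of_mem_Delta {δ : ℝ} {z : ℂ} (hz : z ∈ Delta (1 / 10) δ) :
    -(‖1 - z‖ / 10) ≤ (1 - z).re := by
  have h1 := hz.2.2
  have h2 : Real.cos (z - 1).arg ≤ 1 / 10 := by
    rw [← Real.cos_abs]
    refine (Real.cos_le_cos_of_nonneg_of_le_pi ?_ (Complex.abs_arg_le_pi _) h1.le).trans ?_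
    · linarith [Real.pi_gt_three]
    · rw [Real.cos_pi_div_two_sub]
      exact Real.sin_le (by norm_num)
  have h3 : (z - 1).re = ‖z - 1‖ * Real.cos (z - 1).arg := (Complex.norm_mul_cos_arg _).symm
  have h4 : (1 - z).re = -(z - 1).re := by simp
  rw [h4, h3, norm_sub_rev]
  have := mul_le_mul_of_nonneg_left h2 (norm_nonneg (z - 1))
  linarith

theorem norm_one_sub_pow_le {x : ℂ} (hx : ‖x‖ ≤ 1) (d : ℕ) : ‖1 - x ^ d‖ ≤ d * ‖1 - x‖ := by
  rw [← mul_neg_geom_sum, norm_mul, mul_comm]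
  exact mul_le_mul_of_nonneg_right (norm_geom_sum_le hx d) (norm_nonneg _)

/-- The ratio `(1 - x) / (1 - G(x)) ^ 2`. -/
noncomputable def progenyCurv (q g : ℕ → ℝ) (x : ℂ) : ℂ :=
  slopeSeries₂ q (realSeries g x) / realSeries q (realSeries g x)

/-- The ratio `(1 - x Φ'(G(x))) / (1 - G(x))`. -/
noncomputable def progenySlope (q g : ℕ → ℝ) (x : ℂ) : ℂ :=
  (1 - realSeries g x) * progenyCurv q g x + x * slopeSeries (derivCoeff q) (realSeries g x)

namespace IsProgeny

variable {q g : ℕ → ℝ} {d : ℕ} {x : ℂ}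

theorem tendsto_comp (h : IsProgeny q g d) {F : ℂ → ℂ}
    (hF : ContinuousOn F (Metric.closedBall 0 1)) :
    Tendsto (fun x => F (realSeries g x)) (nhdsWithin 1 (Metric.closedBall 0 1)) (nhds (F 1)) := by
  have := (hF.comp h.continuousOn h.mapsTo) 1 (by simp)
  simpa [ContinuousWithinAt, Function.comp_def, h.realSeries_one] using this

theorem tendsto_one (h : IsProgeny q g d) :
    Tendsto (realSeries g) (nhdsWithin 1 (Metric.closedBall 0 1)) (nhds 1) :=
  h.tendsto_comp continuousOn_id

theorem tendsto_offspring (h : IsProgeny q g d) :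
    Tendsto (fun x => realSeries q (realSeries g x)) (nhdsWithin 1 (Metric.closedBall 0 1))
      (nhds 1) := by
  have := h.tendsto_comp
    (continuousOn_realSeries h.critical.nonneg h.critical.hasSum.summable)
  rwa [h.critical.realSeries_one_eq] at this

theorem tendsto_curv (h : IsProgeny q g d) :
    Tendsto (progenyCurv q g) (nhdsWithin 1 (Metric.closedBall 0 1))
      (nhds (offspringVar q / 2)) := by
  have h1 := h.tendsto_comp (continuousOn_slopeSeries₂ h.critical.nonneg h.critical.summable_sq)
  rw [CriticalOffspring.slopeSeries₂_one] at h1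
  have := h1.div h.tendsto_offspring one_ne_zero
  rwa [div_one] at this

theorem tendsto_self (s : Set ℂ) : Tendsto (fun x : ℂ => x) (nhdsWithin 1 s) (nhds 1) :=
  tendsto_nhdsWithin_of_tendsto_nhds Filter.tendsto_id

theorem tendsto_slope (h : IsProgeny q g d) :
    Tendsto (progenySlope q g) (nhdsWithin 1 (Metric.closedBall 0 1)) (nhds (offspringVar q)) := by
  have h1 := h.tendsto_comp
    (continuousOn_slopeSeries h.critical.deriv_nonneg h.critical.hasSum_deriv_mean.summable)
  rw [h.critical.slopeSeries_deriv_one] at h1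
  have := ((tendsto_const_nhds (x := (1 : ℂ)).sub h.tendsto_one).mul h.tendsto_curv).add
    ((tendsto_self (Metric.closedBall 0 1)).mul h1)
  simp only [sub_self, zero_mul, zero_add, one_mul] at this
  exact this

theorem tendsto_sq_ratio (h : IsProgeny q g d) :
    Tendsto (fun x => progenySlope q g x ^ 2 / progenyCurv q g x)
      (nhdsWithin 1 (Metric.closedBall 0 1)) (nhds (2 * offspringVar q : ℝ)) := by
  have hσ : (offspringVar q : ℂ) ≠ 0 := Complex.ofReal_ne_zero.2 h.critical.var_pos.ne'
  have := (h.tendsto_slope.pow 2).div h.tendsto_curv (div_ne_zero hσ two_ne_zero)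
  have e : (offspringVar q : ℂ) ^ 2 / (offspringVar q / 2) = ((2 * offspringVar q : ℝ) : ℂ) := by
    push_cast
    field_simp
  rwa [e] at this

theorem tendsto_spineSeries (h : IsProgeny q g d) :
    Tendsto (spineSeries q g) (nhdsWithin 1 (Metric.closedBall 0 1)) (nhds 1) := by
  have := h.continuousOn_spineSeries 1 (by simp)
  rwa [ContinuousWithinAt, h.spineSeries_one] at this

theorem eventually_norm_le :
    ∀ᶠ x : ℂ in nhdsWithin 1 (Metric.closedBall 0 1), ‖x‖ ≤ 1 := by
  filter_upwards [self_mem_nhdsWithin] with x hx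
  simpa using hx

theorem eventually_one_sub_eq (h : IsProgeny q g d) :
    ∀ᶠ x in nhdsWithin 1 (Metric.closedBall 0 1),
      1 - x = (1 - realSeries g x) ^ 2 * progenyCurv q g x := by
  filter_upwards [eventually_norm_le, h.tendsto_offspring.eventually_ne one_ne_zero] with x hx h0
  have h1 := h.critical.realSeries_eq (h.norm_le_one hx)
  have h2 := h.rec_eq x hx
  rw [progenyCurv]
  field_simp
  linear_combination h1 + h2

theorem eventually_one_sub_spine_eq (h : IsProgeny q g d) :
    ∀ᶠ x in nhdsWithin 1 (Metric.closedBall 0 1),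
      1 - spineSeries q g x = (1 - realSeries g x) * progenySlope q g x := by
  filter_upwards [eventually_norm_le, h.eventually_one_sub_eq] with x hx h1
  rw [spineSeries, h.critical.realSeries_deriv_eq (h.norm_le_one hx), progenySlope]
  linear_combination h1

theorem eventually_one_sub_spine_sq (h : IsProgeny q g d) :
    ∀ᶠ x in nhdsWithin 1 (Metric.closedBall 0 1),
      (1 - spineSeries q g x) ^ 2 = (1 - x) * (progenySlope q g x ^ 2 / progenyCurv q g x) := by
  have hσ : (offspringVar q : ℂ) ≠ 0 := Complex.ofReal_ne_zero.2 h.critical.var_pos.ne'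
  filter_upwards [h.eventually_one_sub_eq, h.eventually_one_sub_spine_eq,
    h.tendsto_curv.eventually_ne (div_ne_zero hσ two_ne_zero)] with x h1 h2 h3
  rw [h2]
  nth_rewrite 1 [h1]
  field_simp

theorem one_sub_re_nonneg {y : ℂ} (hy : ‖y‖ ≤ 1) : 0 ≤ (1 - y).re := by
  have := (Complex.re_le_norm y).trans hy
  simpa using this

theorem eventually_cone (h : IsProgeny q g d) :
    ∀ᶠ x in nhdsWithin 1 (Metric.closedBall 0 1),
      |(1 - spineSeries q g x).im| ≤ 2 * (1 - spineSeries q g x).re := by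
  have hσ := h.critical.var_pos
  have hball := h.tendsto_sq_ratio (Metric.closedBall_mem_nhds _ (ε := 3 / 8 * (2 * offspringVar q))
    (by positivity))
  filter_upwards [eventually_norm_le, h.eventually_one_sub_spine_sq, hball] with x hx h1 h2
  refine abs_im_le_two_mul_re (one_sub_re_nonneg ((h.norm_spineSeries_le hx).trans hx))
    (one_sub_re_nonneg hx) (r := 2 * offspringVar q) (by positivity) ?_ h1
  simpa [dist_eq_norm] using h2

theorem eventually_le_sq (h : IsProgeny q g d) :
    ∀ᶠ x in nhdsWithin 1 (Metric.closedBall 0 1),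
      offspringVar q * ‖1 - x‖ ≤ ‖1 - spineSeries q g x‖ ^ 2 := by
  have hσ := h.critical.var_pos
  have hlt := h.tendsto_sq_ratio.norm.eventually_const_le (u := offspringVar q) (by
    rw [Complex.norm_of_nonneg (by positivity)]; linarith)
  filter_upwards [h.eventually_one_sub_spine_sq, hlt] with x h1 h2
  rw [← norm_pow, h1, norm_mul, mul_comm]
  exact mul_le_mul_of_nonneg_left h2 (norm_nonneg _)

theorem eventually_norm_progeny_le (h : IsProgeny q g d) :
    ∀ᶠ x in nhdsWithin 1 (Metric.closedBall 0 1),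
      ‖1 - spineSeries q g x‖ ≤ 16 * offspringVar q * (1 - ‖realSeries g x‖) := by
  have hσ := h.critical.var_pos
  have hσ' : (offspringVar q : ℂ) ≠ 0 := Complex.ofReal_ne_zero.2 hσ.ne'
  have hinv := h.tendsto_curv.inv₀ (div_ne_zero hσ' two_ne_zero)
  have hball := hinv (Metric.closedBall_mem_nhds _ (ε := 3 / 8 * (2 / offspringVar q))
    (by positivity))
  have hslope := h.tendsto_slope.norm.eventually_le_const (u := 2 * offspringVar q) (by
    rw [Complex.norm_of_nonneg (by positivity)]; linarith)
  have hsmall := h.tendsto_one (Metric.closedBall_mem_nhds _ (ε := 1 / 10) (by norm_num))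
  filter_upwards [eventually_norm_le, h.eventually_one_sub_eq, h.eventually_one_sub_spine_eq,
    hball, hslope, hsmall, h.tendsto_curv.eventually_ne (div_ne_zero hσ' two_ne_zero)]
    with x hx h1 h2 h3 h4 h5 h6
  set w := 1 - realSeries g x with hw
  have hwre : 0 ≤ w.re := one_sub_re_nonneg (h.norm_le_one hx)
  have hcone : |w.im| ≤ 2 * w.re := by
    refine abs_im_le_two_mul_re hwre (one_sub_re_nonneg hx) (r := 2 / offspringVar q)
      (ρ := (progenyCurv q g x)⁻¹) (by positivity) ?_ (by rw [h1]; field_simp)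
    simpa [dist_eq_norm] using h3
  have hw1 : ‖w‖ ≤ 1 / 10 := by
    rw [mem_preimage, Metric.mem_closedBall, dist_eq_norm, norm_sub_rev] at h5
    exact h5
  have hw2 : ‖w‖ ≤ 3 * w.re := (Complex.norm_le_abs_re_add_abs_im w).trans (by
    rw [abs_of_nonneg hwre]; linarith)
  have hG : realSeries g x = 1 - w := by rw [hw]; ring
  have h7 : ‖realSeries g x‖ ^ 2 = 1 - 2 * w.re + ‖w‖ ^ 2 := by
    rw [hG, ← Complex.normSq_eq_norm_sq, ← Complex.normSq_eq_norm_sq, Complex.normSq_sub]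
    simp; ring
  have h8 : ‖realSeries g x‖ ≤ 1 - ‖w‖ / 8 := by
    refine le_of_sq_le_sq ?_ (by linarith)
    rw [h7]
    nlinarith [norm_nonneg w]
  rw [h2, norm_mul]
  have h9 := mul_le_mul_of_nonneg_left h4 (norm_nonneg w)
  have h10 : ‖w‖ * (2 * offspringVar q) ≤ 8 * (1 - ‖realSeries g x‖) * (2 * offspringVar q) :=
    mul_le_mul_of_nonneg_right (by linarith) (by positivity)
  linarith

/-- Lower bounds for `1 - x Φ'(G(x))` and `1 - |G(x)|`, uniformly in the unit disc. -/
theorem exists_lower_bounds (h : IsProgeny q g d) : ∃ c > 0, ∀ x : ℂ, ‖x‖ ≤ 1 →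
    c * ‖1 - x ^ d‖ ≤ ‖1 - spineSeries q g x‖ ^ 2 ∧
      c * ‖1 - spineSeries q g x‖ ≤ 1 - ‖realSeries g x‖ := by
  have hσ := h.critical.var_pos
  have hd : (0 : ℝ) < d := by exact_mod_cast h.span.pos
  obtain ⟨c₁, hc₁, hc₁'⟩ := h.critical.exists_norm_deriv_le
  obtain ⟨κ, hκ, hcover⟩ := h.exists_cover (inter_mem eventually_norm_le
    (inter_mem h.eventually_le_sq h.eventually_norm_progeny_le))
  set c := min (min (offspringVar q / d) (1 / (16 * offspringVar q)))
    (min ((c₁ * κ) ^ 2 / 2) (κ / 2))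
  have hc : 0 < c := by positivity
  refine ⟨c, hc, fun x hx => ?_⟩
  rcases hcover x hx with ⟨ω, hω, hx', h1, h2⟩ | hx'
  · have e1 : ‖realSeries g (ω * x)‖ = ‖realSeries g x‖ := by
      rw [h.realSeries_mul hω, norm_mul, Complex.norm_eq_one_of_pow_eq_one hω h.span.pos.ne',
        one_mul]
    have e2 : (ω * x) ^ d = x ^ d := by rw [mul_pow, hω, one_mul]
    simp only [mem_ofPred_eq, h.spineSeries_mul hω, e1] at h1 h2 hx'
    constructor
    · have hle := norm_one_sub_pow_le hx' d
      rw [e2] at hle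
      calc c * ‖1 - x ^ d‖ ≤ offspringVar q / d * (d * ‖1 - ω * x‖) :=
            mul_le_mul ((min_le_left _ _).trans (min_le_left _ _)) hle (norm_nonneg _)
              (by positivity)
        _ = offspringVar q * ‖1 - ω * x‖ := by field_simp
        _ ≤ _ := h1
    · calc c * ‖1 - spineSeries q g x‖ ≤ 1 / (16 * offspringVar q) *
            (16 * offspringVar q * (1 - ‖realSeries g x‖)) :=
            mul_le_mul ((min_le_left _ _).trans (min_le_right _ _)) h2 (norm_nonneg _)
              (by positivity)
        _ = _ := by field_simp
  · have hu : ‖spineSeries q g x‖ ≤ 1 - c₁ * κ := by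
      rw [spineSeries, norm_mul]
      have h1 := hc₁' _ (h.norm_le_one hx)
      have h2 := mul_le_mul_of_nonneg_left hx' hc₁.le
      exact (mul_le_of_le_one_left (norm_nonneg _) hx).trans (by linarith)
    have hu1 := norm_sub_norm_le 1 (spineSeries q g x)
    have hu2 := norm_sub_le 1 (spineSeries q g x)
    have hx2 := norm_sub_le 1 (x ^ d)
    have hx3 : ‖x ^ d‖ ≤ 1 := by rw [norm_pow]; exact pow_le_one₀ (norm_nonneg _) hx
    rw [norm_one] at hu1 hu2 hx2
    have hpos := mul_pos hc₁ hκ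
    constructor
    · calc c * ‖1 - x ^ d‖ ≤ (c₁ * κ) ^ 2 / 2 * 2 :=
            mul_le_mul ((min_le_right _ _).trans (min_le_left _ _)) (by linarith) (norm_nonneg _)
              (by positivity)
        _ = (c₁ * κ) ^ 2 := by ring
        _ ≤ _ := by gcongr; linarith
    · calc c * ‖1 - spineSeries q g x‖ ≤ κ / 2 * 2 :=
            mul_le_mul ((min_le_right _ _).trans (min_le_right _ _)) (by linarith) (norm_nonneg _)
              (by positivity)
        _ = κ := by ring
        _ ≤ _ := hx'

/-- Lower bounds for `1 - z x Φ'(G(x))`, uniformly in `x` and in `z ∈ Δ(β, δ)`. -/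
theorem exists_lower_bounds_Delta (h : IsProgeny q g d) : ∃ c > 0, ∃ δ > 0, δ ≤ 1 ∧
    ∀ z ∈ Delta (1 / 10) δ, ∀ x : ℂ, ‖x‖ ≤ 1 →
      c * (‖1 - spineSeries q g x‖ + ‖1 - z‖) ≤ ‖1 - z * spineSeries q g x‖ := by
  obtain ⟨c₁, hc₁, hc₁'⟩ := h.critical.exists_norm_deriv_le
  have hsmall := h.tendsto_spineSeries (Metric.closedBall_mem_nhds _ (ε := 1 / 40) (by norm_num))
  obtain ⟨κ, hκ, hcover⟩ := h.exists_cover (inter_mem hsmall h.eventually_cone)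
  have hpos := mul_pos hc₁ hκ
  refine ⟨min (1 / 40) (c₁ * κ / 10), by positivity, min 1 (c₁ * κ / 2), by positivity,
    min_le_left _ _, fun z hz x hx => ?_⟩
  have hre := neg_le_re_one_sub_of_mem_Delta hz
  rcases hcover x hx with ⟨ω, hω, h1, h2⟩ | hx'
  · simp only [mem_ofPred_eq, mem_preimage, h.spineSeries_mul hω] at h1 h2
    set a := 1 - spineSeries q g x with ha
    set b := 1 - z with hb
    have ha1 : ‖a‖ ≤ 1 / 40 := by
      rw [Metric.mem_closedBall, dist_eq_norm, norm_sub_rev] at h1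
      exact h1
    have h3 := norm_add_ge_of_cone h2 hre
    have e : 1 - z * spineSeries q g x = a + b - a * b := by rw [ha, hb]; ring
    have h4 := norm_sub_norm_le (a + b) (a * b)
    rw [norm_mul] at h4
    have h5 := mul_le_mul_of_nonneg_right ha1 (norm_nonneg b)
    have h6 : min (1 / 40) (c₁ * κ / 10) * (‖a‖ + ‖b‖) ≤ 1 / 40 * (‖a‖ + ‖b‖) :=
      mul_le_mul_of_nonneg_right (min_le_left _ _) (by positivity)
    rw [e]
    linarith [norm_nonneg a]
  · have hu : ‖spineSeries q g x‖ ≤ 1 - c₁ * κ := by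
      rw [spineSeries, norm_mul]
      have h1 := hc₁' _ (h.norm_le_one hx)
      have h2 := mul_le_mul_of_nonneg_left hx' hc₁.le
      exact (mul_le_of_le_one_left (norm_nonneg _) hx).trans (by linarith)
    have hz1 : ‖z‖ ≤ 1 + c₁ * κ / 2 := hz.1.le.trans (by gcongr; exact min_le_right _ _)
    have hz2 : ‖z‖ ≤ 2 := hz.1.le.trans (by linarith [min_le_left 1 (c₁ * κ / 2)])
    have hu2 := norm_sub_le 1 (spineSeries q g x)
    have hz3 := norm_sub_le 1 z
    have h1 := norm_sub_norm_le 1 (z * spineSeries q g x)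
    rw [norm_one] at hu2 hz3 h1
    rw [norm_mul] at h1
    have h2 : ‖z‖ * ‖spineSeries q g x‖ ≤ (1 + c₁ * κ / 2) * (1 - c₁ * κ) :=
      mul_le_mul hz1 hu (norm_nonneg _) (by positivity)
    calc min (1 / 40) (c₁ * κ / 10) * (‖1 - spineSeries q g x‖ + ‖1 - z‖) ≤ c₁ * κ / 10 * 5 :=
          mul_le_mul (min_le_right _ _) (by linarith) (by positivity) (by positivity)
      _ ≤ _ := by nlinarith

end IsProgeny

/-- The function `t ↦ t ^ (-3 / 2)`. -/
noncomputable def decay (t : ℝ) : ℝ := (t * √t)⁻¹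

theorem decay_nonneg {t : ℝ} (ht : 0 ≤ t) : 0 ≤ decay t := by
  unfold decay; positivity

theorem decay_anti {s t : ℝ} (hs : 0 < s) (h : s ≤ t) : decay t ≤ decay s := by
  have ht := hs.trans_le h
  unfold decay; gcongr

theorem decay_div_nine (t : ℝ) : decay (t / 9) = 27 * decay t := by
  have h9 : √(9 : ℝ) = 3 := by
    rw [show (9 : ℝ) = 3 ^ 2 by norm_num, Real.sqrt_sq (by norm_num)]
  rw [decay, decay, Real.sqrt_div' _ (by norm_num), h9, mul_inv, mul_inv, inv_div, inv_div]
  ring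

theorem continuousOn_decay : ContinuousOn decay (Ioi 0) := by
  unfold decay
  refine ContinuousOn.inv₀ (by fun_prop) fun t ht => ?_
  have : 0 < t := ht
  positivity

theorem integral_decay_le {ε T : ℝ} (hε : 0 < ε) (hT : 0 ≤ T) :
    ∫ θ in (0 : ℝ)..T, decay (ε + θ) ≤ 2 / √ε := by
  have hpos : ∀ θ ∈ uIcc 0 T, 0 < ε + θ := fun θ hθ => by
    rw [uIcc_of_le hT] at hθ
    linarith [hθ.1]
  rw [intervalIntegral.integral_eq_sub_of_hasDerivAt (f := fun θ => -(2 / √(ε + θ)))]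
  · rw [add_zero]
    have : 0 ≤ 2 / √(ε + T) := by positivity
    linarith
  · intro θ hθ
    have h0 := hpos θ hθ
    have h1 : HasDerivAt (fun θ => ε + θ) 1 θ := (hasDerivAt_id θ).const_add ε
    have h2 := ((h1.sqrt h0.ne').inv (Real.sqrt_ne_zero'.2 h0)).const_mul (-2)
    have e : (fun θ => -(2 / √(ε + θ))) = fun θ => -2 * (√(ε + θ))⁻¹ := by
      funext; ring
    rw [e]
    refine h2.congr_deriv ?_
    have h3 := Real.sq_sqrt h0.le
    have h4 : √(ε + θ) ≠ 0 := Real.sqrt_ne_zero'.2 h0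
    rw [decay]
    field_simp
    rw [h3]
  · refine ContinuousOn.intervalIntegrable (continuousOn_decay.comp (by fun_prop) ?_)
    exact fun θ hθ => hpos θ hθ

theorem norm_one_sub_mul_exp_ge {ρ θ : ℝ} (h0 : 0 ≤ ρ) (h1 : ρ < 1) (hθ : |θ| ≤ Real.pi) :
    (1 - ρ + |θ|) / 9 ≤ ‖1 - ρ * Complex.exp (θ * Complex.I)‖ := by
  have hπ := Real.pi_lt_d2
  have hexp : ‖Complex.exp (θ * Complex.I)‖ = 1 := Complex.norm_exp_ofReal_mul_I θ
  have hge : 1 - ρ ≤ ‖1 - ρ * Complex.exp (θ * Complex.I)‖ := by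
    have := norm_sub_norm_le 1 (ρ * Complex.exp (θ * Complex.I))
    rwa [norm_one, norm_mul, hexp, mul_one, Complex.norm_of_nonneg h0] at this
  rcases le_total ρ (1 / 2) with h | h
  · linarith
  · have hsq : ‖1 - ρ * Complex.exp (θ * Complex.I)‖ ^ 2 =
        (1 - ρ) ^ 2 + 4 * ρ * Real.sin (θ / 2) ^ 2 := by
      have hc : Real.cos θ = 1 - 2 * Real.sin (θ / 2) ^ 2 := by
        have h2 := Real.cos_sq' (θ / 2)
        have h3 := Real.cos_two_mul (θ / 2)
        rw [mul_div_cancel₀ _ two_ne_zero] at h3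
        rw [h3, h2]; ring
      rw [← Complex.normSq_eq_norm_sq, Complex.normSq_sub, Complex.normSq_mul,
        Complex.normSq_eq_norm_sq (Complex.exp _), hexp, Complex.exp_mul_I]
      simp [← Complex.ofReal_cos, ← Complex.ofReal_sin]
      rw [hc]
      ring
    have hsin : |θ| / 4 ≤ |Real.sin (θ / 2)| := by
      have h2 := Real.mul_abs_le_abs_sin (x := θ / 2) (by rw [abs_div, abs_two]; linarith)
      rw [abs_div, abs_two] at h2
      refine le_trans ?_ h2
      rw [div_mul_div_comm, div_le_div_iff₀ (by norm_num) (by positivity)]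
      nlinarith [abs_nonneg θ]
    have hsin2 : (|θ| / 4) ^ 2 ≤ Real.sin (θ / 2) ^ 2 := by
      rw [← sq_abs (Real.sin _)]
      gcongr
    refine le_of_sq_le_sq ?_ (norm_nonneg _)
    rw [hsq]
    nlinarith [sq_nonneg (1 - ρ - |θ|), abs_nonneg θ, sq_nonneg (|θ|)]

theorem one_sub_mul_exp_ne_zero {ρ : ℝ} (h0 : 0 ≤ ρ) (h1 : ρ < 1) (θ : ℝ) :
    0 < ‖1 - ρ * Complex.exp (θ * Complex.I)‖ := by
  have := norm_sub_norm_le 1 (ρ * Complex.exp (θ * Complex.I))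
  rw [norm_one, norm_mul, Complex.norm_exp_ofReal_mul_I, mul_one, Complex.norm_of_nonneg h0] at this
  linarith

theorem continuous_decay_circle {ρ : ℝ} (h0 : 0 ≤ ρ) (h1 : ρ < 1) :
    Continuous fun θ : ℝ => decay ‖1 - ρ * Complex.exp (θ * Complex.I)‖ :=
  continuousOn_decay.comp_continuous (by fun_prop) fun θ => one_sub_mul_exp_ne_zero h0 h1 θ

theorem periodic_decay_circle (ρ : ℝ) :
    Function.Periodic (fun θ : ℝ => decay ‖1 - ρ * Complex.exp (θ * Complex.I)‖)
      (2 * Real.pi) := fun θ => by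
  have : ((θ + 2 * Real.pi : ℝ) : ℂ) * Complex.I = θ * Complex.I + 2 * Real.pi * Complex.I := by
    push_cast; ring
  simp only [this, Complex.exp_periodic _]

theorem integral_decay_circle_le {ρ : ℝ} (h0 : 0 ≤ ρ) (h1 : ρ < 1) :
    ∫ θ in (0 : ℝ)..2 * Real.pi, decay ‖1 - ρ * Complex.exp (θ * Complex.I)‖ ≤
      108 / √(1 - ρ) := by
  set F : ℝ → ℝ := fun θ => decay ‖1 - ρ * Complex.exp (θ * Complex.I)‖ with hF
  have hcont : Continuous F := continuous_decay_circle h0 h1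
  have hε : 0 < 1 - ρ := by linarith
  have hle : ∀ θ, |θ| ≤ Real.pi → F θ ≤ 27 * decay (1 - ρ + |θ|) := fun θ hθ => by
    rw [← decay_div_nine]
    exact decay_anti (by positivity) (norm_one_sub_mul_exp_ge h0 h1 hθ)
  have hintegral : ∀ G : ℝ → ℝ, Continuous G →
      (∀ θ ∈ Icc 0 Real.pi, G θ ≤ 27 * decay (1 - ρ + θ)) →
      ∫ θ in (0 : ℝ)..Real.pi, G θ ≤ 54 / √(1 - ρ) := by
    intro G hG hGle
    have hc : ContinuousOn (fun θ => 27 * decay (1 - ρ + θ)) (uIcc 0 Real.pi) := by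
      refine continuousOn_const.mul (continuousOn_decay.comp (by fun_prop) fun θ hθ => ?_)
      rw [uIcc_of_le Real.pi_pos.le] at hθ
      have := hθ.1
      simp only [mem_Ioi]
      linarith
    refine (intervalIntegral.integral_mono_on Real.pi_pos.le (hG.intervalIntegrable _ _)
      hc.intervalIntegrable hGle).trans ?_
    rw [intervalIntegral.integral_const_mul]
    refine (mul_le_mul_of_nonneg_left (integral_decay_le hε Real.pi_pos.le)
      (by norm_num)).trans_eq ?_
    ring
  have hper := (periodic_decay_circle ρ).intervalIntegral_add_eq 0 (-Real.pi)
  rw [zero_add, show -Real.pi + 2 * Real.pi = Real.pi by ring] at hper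
  rw [hper, ← intervalIntegral.integral_add_adjacent_intervals (hcont.intervalIntegrable _ 0)
    (hcont.intervalIntegrable _ _)]
  have hneg : ∫ θ in (-Real.pi)..0, F θ = ∫ θ in (0 : ℝ)..Real.pi, F (-θ) := by
    rw [intervalIntegral.integral_comp_neg, neg_zero]
  have hr := hintegral F hcont fun θ hθ => by
    have := hle θ (by rw [abs_of_nonneg hθ.1]; exact hθ.2)
    rwa [abs_of_nonneg hθ.1] at this
  have hl := hintegral (fun θ => F (-θ)) (by fun_prop) fun θ hθ => by
    have := hle (-θ) (by rw [abs_neg, abs_of_nonneg hθ.1]; exact hθ.2)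
    rwa [abs_neg, abs_of_nonneg hθ.1] at this
  rw [← hneg] at hl
  have : 108 / √(1 - ρ) = 54 / √(1 - ρ) + 54 / √(1 - ρ) := by ring
  linarith

theorem circleMap_pow (r : ℝ) (d : ℕ) (θ : ℝ) :
    circleMap 0 r θ ^ d = ((r ^ d : ℝ) : ℂ) * Complex.exp (((d * θ : ℝ) : ℂ) * Complex.I) := by
  rw [circleMap_zero, mul_pow, ← Complex.exp_nat_mul]
  push_cast
  congr 2
  ring

theorem integral_decay_pow_le {d : ℕ} (hd : 0 < d) {r : ℝ} (h0 : 0 ≤ r) (h1 : r < 1) :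
    ∫ θ in (0 : ℝ)..2 * Real.pi, decay ‖1 - circleMap 0 r θ ^ d‖ ≤ 108 / √(1 - r) := by
  have hd' : (d : ℝ) ≠ 0 := by exact_mod_cast hd.ne'
  have hρ0 : 0 ≤ r ^ d := by positivity
  have hρr : r ^ d ≤ r := pow_le_of_le_one h0 h1.le hd.ne'
  have hρ1 : r ^ d < 1 := hρr.trans_lt h1
  simp only [circleMap_pow]
  rw [intervalIntegral.integral_comp_mul_left
    (fun θ : ℝ => decay ‖1 - ((r ^ d : ℝ) : ℂ) * Complex.exp (θ * Complex.I)‖) hd', mul_zero]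
  have hper := (periodic_decay_circle (r ^ d)).intervalIntegral_add_zsmul_eq d 0
    fun _ _ => (continuous_decay_circle hρ0 hρ1).intervalIntegrable _ _
  simp only [zero_add, zsmul_eq_mul, Int.cast_natCast] at hper
  rw [hper, smul_eq_mul, inv_mul_cancel_left₀ hd']
  refine (integral_decay_circle_le hρ0 hρ1).trans ?_
  have : 0 < 1 - r := by linarith
  gcongr

/-- Transfer: a bound for the derivative of an analytic function on the unit disc, with
singularities of order `3 / 2` at the roots of unity, yields bounds for its coefficients. -/
theorem norm_coeff_le_of_norm_deriv_le {d : ℕ} (hd : 0 < d) {f : ℂ → ℂ} {a : ℕ → ℂ} {A M : ℝ}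
    (hA : 0 ≤ A) (hM : 0 ≤ M) (hf : DifferentiableOn ℂ f (Metric.ball 0 1))
    (ha : ∀ᶠ x in nhds 0, HasSum (fun n => a n * x ^ n) (f x))
    (hf' : ∀ x : ℂ, ‖x‖ < 1 → ‖deriv f x‖ ≤ A * decay ‖1 - x ^ d‖ + M) {n : ℕ} (hn : 1 ≤ n) :
    ‖a n‖ ≤ 108 * A / √n + 2 * M / n := by
  obtain ⟨m, rfl⟩ := Nat.exists_eq_add_of_le' hn
  set N : ℝ := ((m + 1 : ℕ) : ℝ) with hN
  have hN1 : 1 ≤ N := by rw [hN]; exact_mod_cast hn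
  set r : ℝ := 1 - 1 / (2 * N) with hr
  have hr2 : 1 / (2 * N) ≤ 1 / 2 := by gcongr; linarith
  have hr0 : 0 < r := by rw [hr]; linarith
  have hr1 : r < 1 := by rw [hr]; have : 0 < 1 / (2 * N) := by positivity
                         linarith
  have hball : Metric.ball (0 : ℂ) 1 ∈ nhds 0 := Metric.ball_mem_nhds _ one_pos
  have hd1 : DifferentiableOn ℂ (deriv f) (Metric.ball 0 1) := hf.deriv Metric.isOpen_ball
  have hsub : Metric.closedBall (0 : ℂ) r ⊆ Metric.ball 0 1 := Metric.closedBall_subset_ball hr1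
  have hps := (DifferentiableOn.hasFPowerSeriesOnBall (R := ⟨r, hr0.le⟩) (hd1.mono hsub)
    hr0).hasFPowerSeriesAt
  have e1 := hps.eq_formalMultilinearSeries (hd1.analyticAt hball).hasFPowerSeriesAt
  have e2 : HasFPowerSeriesAt f (FormalMultilinearSeries.ofScalars ℂ a) 0 := by
    rw [hasFPowerSeriesAt_iff]
    filter_upwards [ha] with x hx
    simpa [FormalMultilinearSeries.coeff_ofScalars, mul_comm] using hx
  have e3 := e2.eq_formalMultilinearSeries (hf.analyticAt hball).hasFPowerSeriesAt
  have e4 : a (m + 1) = iteratedDeriv m (deriv f) 0 / (m + 1).factorial := by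
    have := congrArg (fun p : FormalMultilinearSeries ℂ ℂ ℂ => p.coeff (m + 1)) e3
    simpa only [FormalMultilinearSeries.coeff_ofScalars, iteratedDeriv_succ'] using this
  have e5 : (cauchyPowerSeries (deriv f) 0 r).coeff m =
      iteratedDeriv m (deriv f) 0 / m.factorial := by
    have e1' : cauchyPowerSeries (deriv f) 0 r = _ := e1
    rw [e1', FormalMultilinearSeries.coeff_ofScalars]
  have e6 : ‖a (m + 1)‖ = ‖cauchyPowerSeries (deriv f) 0 r m‖ / N := by
    rw [FormalMultilinearSeries.norm_apply_eq_norm_coef, e5, e4, Nat.factorial_succ, hN]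
    push_cast
    rw [norm_div, norm_div, norm_mul, div_div, mul_comm ‖(m.factorial : ℂ)‖]
    congr 2
    exact_mod_cast Complex.norm_natCast (m + 1)
  have hmaps : ∀ θ, ‖circleMap 0 r θ‖ = r := fun θ => by
    rw [norm_circleMap_zero, abs_of_pos hr0]
  have hpowlt : ∀ θ, 0 < ‖1 - circleMap 0 r θ ^ d‖ := fun θ => by
    rw [circleMap_pow]
    exact one_sub_mul_exp_ne_zero (by positivity) (pow_lt_one₀ hr0.le hr1 hd.ne') _
  have hintegral : ∫ θ in (0 : ℝ)..2 * Real.pi, ‖deriv f (circleMap 0 r θ)‖ ≤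
      A * (108 / √(1 - r)) + M * (2 * Real.pi) := by
    have hc1 : Continuous fun θ => ‖deriv f (circleMap 0 r θ)‖ :=
      (hd1.continuousOn.comp_continuous (continuous_circleMap 0 r) fun θ => by
        rw [mem_ball_zero_iff, hmaps]; exact hr1).norm
    have hc2 : Continuous fun θ => decay ‖1 - circleMap 0 r θ ^ d‖ :=
      continuousOn_decay.comp_continuous
        ((continuous_const.sub ((continuous_circleMap 0 r).pow d)).norm) hpowlt
    have hc3 : Continuous fun θ => A * decay ‖1 - circleMap 0 r θ ^ d‖ + M := by fun_prop
    refine (intervalIntegral.integral_mono_on (by positivity) (hc1.intervalIntegrable _ _)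
      (hc3.intervalIntegrable _ _) fun θ _ => hf' _ (by rw [hmaps]; exact hr1)).trans ?_
    rw [intervalIntegral.integral_add ((hc2.intervalIntegrable _ _).const_mul A)
      (by simp), intervalIntegral.integral_const_mul]
    gcongr
    · exact integral_decay_pow_le hd hr0.le hr1
    · simp [mul_comm]
  have hrm : |r|⁻¹ ^ m ≤ 2 := by
    rw [abs_of_pos hr0, inv_pow]
    refine inv_le_of_inv_le₀ (by norm_num) ?_
    have hb := one_add_mul_le_pow (a := -(1 / (2 * N))) (by linarith) m
    have : 1 + (m : ℝ) * -(1 / (2 * N)) ≥ 1 / 2 := by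
      have hmN : (m : ℝ) ≤ N := by rw [hN]; push_cast; linarith
      have : (m : ℝ) * (1 / (2 * N)) ≤ N * (1 / (2 * N)) := by gcongr
      have h2 : N * (1 / (2 * N)) = 1 / 2 := by field_simp
      linarith
    rw [hr, sub_eq_add_neg]
    linarith
  have hsq : √(1 - r) = 1 / √(2 * N) := by
    rw [hr, sub_sub_cancel, Real.sqrt_div zero_le_one, Real.sqrt_one]
  have hfin := norm_cauchyPowerSeries_le (deriv f) 0 r m
  have hsq2 : √(2 * N) ≤ 3 / 2 * √N := by
    rw [Real.sqrt_mul (by norm_num)]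
    have : √(2 : ℝ) ≤ 3 / 2 := Real.sqrt_le_iff.2 (by norm_num)
    gcongr
  rw [e6, div_le_iff₀ (by linarith)]
  refine hfin.trans ?_
  have hπ := Real.pi_gt_three
  rw [hsq, div_div_eq_mul_div, div_one] at hintegral
  calc ((2 * Real.pi)⁻¹ * ∫ θ in (0 : ℝ)..2 * Real.pi, ‖deriv f (circleMap 0 r θ)‖) * |r|⁻¹ ^ m
      ≤ ((2 * Real.pi)⁻¹ * (A * (108 * (3 / 2 * √N)) + M * (2 * Real.pi))) * 2 := by
        gcongr
        exact hintegral.trans (by gcongr)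
    _ = (2 * Real.pi)⁻¹ * 324 * A * √N + 2 * M := by field_simp; ring
    _ ≤ 6⁻¹ * 324 * A * √N + 2 * M := by gcongr; linarith
    _ ≤ 108 * A * √N + 2 * M := by
        have : 0 ≤ A * √N := by positivity
        nlinarith
    _ = (108 * A / √N + 2 * M / N) * N := by
        rw [add_mul, div_mul_cancel₀ _ (by positivity), div_mul_eq_mul_div, mul_div_assoc,
          Real.div_sqrt]

theorem cube_le_decay {c t y : ℝ} (hc : 0 < c) (ht : 0 < t) (hy : 0 < y) (h : c * t ≤ y ^ 2) :
    y⁻¹ ^ 3 ≤ decay c * decay t := by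
  have h1 : √(c * t) ≤ y := Real.sqrt_le_iff.2 ⟨hy.le, h⟩
  have h2 : decay c * decay t = (c * t * √(c * t))⁻¹ := by
    rw [decay, decay, Real.sqrt_mul hc.le, ← mul_inv]
    congr 1
    ring
  rw [h2, inv_pow]
  have h3 : c * t * √(c * t) ≤ y ^ 2 * y := by gcongr
  rw [← pow_succ] at h3
  gcongr

/-- The bivariate generating function of distances: the coefficient of `x ^ n` is
`P(|𝒯| = n)` times the expectation of `∑ z ^ d(v, w)` over the tree conditioned to have size
`n`. -/
noncomputable def distGenFun (q g : ℕ → ℝ) (z x : ℂ) : ℂ :=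
  (2 * (realSeries g x * (1 - z * spineSeries q g x)⁻¹) - realSeries g x +
    z ^ 2 * (x * (realSeries (derivCoeff (derivCoeff q)) (realSeries g x) *
      (realSeries g x * (1 - z * spineSeries q g x)⁻¹) ^ 2))) * (1 - spineSeries q g x)⁻¹

theorem norm_distGenFun_deriv_le {G Φ Φ₁ Φ₂ Φ₃ B V z x : ℂ} {K : ℝ} (hK : 1 ≤ K) (hG : ‖G‖ ≤ 1)
    (hΦ : ‖Φ‖ ≤ 1) (hΦ₁ : ‖Φ₁‖ ≤ 1) (hΦ₂ : ‖Φ₂‖ ≤ K) (hΦ₃ : ‖Φ₃‖ ≤ K * ‖B‖) (hz : ‖z‖ ≤ 2)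
    (hx : ‖x‖ ≤ 1) (hB : 1 ≤ 2 * ‖B‖) (hV : 1 ≤ 3 * ‖V‖) (hVB : ‖V‖ ≤ K * ‖B‖) {G' u' Q Q' : ℂ}
    (hG' : G' = Φ * B) (hu' : u' = Φ₁ + x * (Φ₂ * (Φ * B))) (hQ : Q = G * V)
    (hQ' : Q' = G' * V + G * (z * u' * V ^ 2)) :
    ‖(2 * Q' - G' + z ^ 2 * (Φ₂ * Q ^ 2 + x * (Φ₃ * G' * Q ^ 2 + Φ₂ * (2 * Q * Q')))) * B +
      (2 * Q - G + z ^ 2 * (x * (Φ₂ * Q ^ 2))) * (u' * B ^ 2)‖ ≤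
        203 * K ^ 3 * ‖V‖ ^ 2 * ‖B‖ ^ 3 := by
  set b := ‖B‖
  set v := ‖V‖
  have hb0 : 0 < b := by linarith
  have hv0 : 0 < v := by linarith
  have hK0 : 0 < K := by linarith
  have nG' : ‖G'‖ ≤ b := by
    rw [hG', norm_mul]; exact mul_le_of_le_one_left hb0.le hΦ
  have nu' : ‖u'‖ ≤ 3 * K * b := by
    have h1 : ‖x * (Φ₂ * (Φ * B))‖ ≤ 1 * (K * (1 * b)) := by
      rw [norm_mul, norm_mul, norm_mul]; gcongr
    have h2 : 1 ≤ 2 * (K * b) := by nlinarith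
    rw [hu']
    exact (norm_add_le _ _).trans (by linarith)
  have nQ : ‖Q‖ ≤ v := by
    rw [hQ, norm_mul]; exact mul_le_of_le_one_left hv0.le hG
  have hv2 : v ≤ 3 * v ^ 2 := by nlinarith
  have hv3 : 1 ≤ 9 * v ^ 2 := by nlinarith
  have hb2 : b ≤ 2 * b ^ 2 := by nlinarith
  have hb3 : 1 ≤ 4 * b ^ 2 := by nlinarith
  have hK2 : K ≤ K ^ 2 := by nlinarith
  have hK3 : K ^ 2 ≤ K ^ 3 := by nlinarith [sq_nonneg K]
  have nQ' : ‖Q'‖ ≤ 9 * K * b * v ^ 2 := by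
    have h1 : ‖G' * V‖ ≤ b * v := by rw [norm_mul]; gcongr
    have h2 : ‖G * (z * u' * V ^ 2)‖ ≤ 1 * (2 * (3 * K * b) * v ^ 2) := by
      rw [norm_mul, norm_mul, norm_mul, norm_pow]; gcongr
    have h3 : b * v ≤ K * b * (3 * v ^ 2) := by
      calc b * v ≤ b * (3 * v ^ 2) := by gcongr
        _ ≤ K * (b * (3 * v ^ 2)) := le_mul_of_one_le_left (by positivity) hK
        _ = _ := by ring
    rw [hQ']
    exact (norm_add_le _ _).trans (by linarith)
  have nN : ‖2 * Q - G + z ^ 2 * (x * (Φ₂ * Q ^ 2))‖ ≤ 19 * K * v ^ 2 := by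
    have h1 : ‖2 * Q‖ ≤ 2 * v := by rw [norm_mul, Complex.norm_two]; gcongr
    have h2 : ‖z ^ 2 * (x * (Φ₂ * Q ^ 2))‖ ≤ 2 ^ 2 * (1 * (K * v ^ 2)) := by
      rw [norm_mul, norm_mul, norm_mul, norm_pow, norm_pow]; gcongr
    have h3 := (norm_add_le (2 * Q - G) (z ^ 2 * (x * (Φ₂ * Q ^ 2)))).trans
      (add_le_add_left (norm_sub_le _ _) _)
    have h4 : v ^ 2 ≤ K * v ^ 2 := le_mul_of_one_le_left (by positivity) hK
    linarith
  have nN' : ‖2 * Q' - G' + z ^ 2 * (Φ₂ * Q ^ 2 + x * (Φ₃ * G' * Q ^ 2 + Φ₂ * (2 * Q * Q')))‖ ≤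
      146 * K ^ 3 * b ^ 2 * v ^ 2 := by
    have h1 : ‖2 * Q'‖ ≤ 2 * (9 * K * b * v ^ 2) := by rw [norm_mul, Complex.norm_two]; gcongr
    have h2 : ‖Φ₂ * Q ^ 2‖ ≤ K * v ^ 2 := by rw [norm_mul, norm_pow]; gcongr
    have h3 : ‖Φ₃ * G' * Q ^ 2‖ ≤ K * b * b * v ^ 2 := by
      rw [norm_mul, norm_mul, norm_pow]; gcongr
    have h4 : ‖Φ₂ * (2 * Q * Q')‖ ≤ K * (2 * v * (9 * K * b * v ^ 2)) := by
      rw [norm_mul, norm_mul, norm_mul, Complex.norm_two]; gcongr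
    have h5 : ‖x * (Φ₃ * G' * Q ^ 2 + Φ₂ * (2 * Q * Q'))‖ ≤
        K * b * b * v ^ 2 + K * (2 * v * (9 * K * b * v ^ 2)) := by
      rw [norm_mul]
      exact (mul_le_of_le_one_left (norm_nonneg _) hx).trans
        ((norm_add_le _ _).trans (add_le_add h3 h4))
    have h6 : ‖z ^ 2 * (Φ₂ * Q ^ 2 + x * (Φ₃ * G' * Q ^ 2 + Φ₂ * (2 * Q * Q')))‖ ≤
        2 ^ 2 * (K * v ^ 2 + (K * b * b * v ^ 2 + K * (2 * v * (9 * K * b * v ^ 2)))) := by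
      rw [norm_mul, norm_pow]
      gcongr
      exact (norm_add_le _ _).trans (add_le_add h2 h5)
    have h7 := (norm_add_le (2 * Q' - G')
      (z ^ 2 * (Φ₂ * Q ^ 2 + x * (Φ₃ * G' * Q ^ 2 + Φ₂ * (2 * Q * Q'))))).trans
      (add_le_add_left (norm_sub_le _ _) _)
    have hKK : K ≤ K ^ 3 := hK2.trans hK3
    have t1 : 2 * (9 * K * b * v ^ 2) ≤ 36 * K ^ 3 * b ^ 2 * v ^ 2 := by
      calc 2 * (9 * K * b * v ^ 2) ≤ 2 * (9 * K ^ 3 * (2 * b ^ 2) * v ^ 2) := by gcongr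
        _ = _ := by ring
    have t2 : b ≤ 18 * K ^ 3 * b ^ 2 * v ^ 2 := by
      calc b ≤ 2 * b ^ 2 * (9 * v ^ 2) := hb2.trans (le_mul_of_one_le_right (by positivity) hv3)
        _ ≤ K ^ 3 * (2 * b ^ 2 * (9 * v ^ 2)) :=
            le_mul_of_one_le_left (by positivity) (by linarith)
        _ = _ := by ring
    have t3 : K * v ^ 2 ≤ 4 * K ^ 3 * b ^ 2 * v ^ 2 := by
      calc K * v ^ 2 ≤ K ^ 3 * v ^ 2 * (4 * b ^ 2) :=
            (mul_le_mul_of_nonneg_right hKK (by positivity)).trans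
              (le_mul_of_one_le_right (by positivity) hb3)
        _ = _ := by ring
    have t4 : K * b * b * v ^ 2 ≤ K ^ 3 * b ^ 2 * v ^ 2 := by
      calc K * b * b * v ^ 2 ≤ K ^ 3 * b * b * v ^ 2 := by gcongr
        _ = _ := by ring
    have t5 : K * (2 * v * (9 * K * b * v ^ 2)) ≤ 18 * K ^ 3 * b ^ 2 * v ^ 2 := by
      calc K * (2 * v * (9 * K * b * v ^ 2)) ≤ K * (2 * (K * b) * (9 * K * b * v ^ 2)) := by gcongr
        _ = _ := by ring
    linarith
  have h1 : ‖(2 * Q' - G' + z ^ 2 * (Φ₂ * Q ^ 2 + x * (Φ₃ * G' * Q ^ 2 + Φ₂ * (2 * Q * Q')))) * B‖ ≤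
      146 * K ^ 3 * b ^ 2 * v ^ 2 * b := by rw [norm_mul]; gcongr
  have h2 : ‖(2 * Q - G + z ^ 2 * (x * (Φ₂ * Q ^ 2))) * (u' * B ^ 2)‖ ≤
      19 * K * v ^ 2 * (3 * K * b * b ^ 2) := by
    rw [norm_mul, norm_mul u', norm_pow]; gcongr
  have h3 : 19 * K * v ^ 2 * (3 * K * b * b ^ 2) ≤ 57 * K ^ 3 * v ^ 2 * b ^ 3 := by
    calc 19 * K * v ^ 2 * (3 * K * b * b ^ 2) = 57 * K ^ 2 * v ^ 2 * b ^ 3 := by ring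
      _ ≤ _ := by gcongr
  refine (norm_add_le _ _).trans ((add_le_add h1 (h2.trans h3)).trans_eq (by ring))

namespace IsProgeny

variable {q g : ℕ → ℝ} {d : ℕ} {x z : ℂ}

theorem hasDerivAt_distGenFun (h : IsProgeny q g d) (hx : ‖x‖ < 1)
    (hz : 1 - z * spineSeries q g x ≠ 0) {G Φ Φ₁ Φ₂ Φ₃ B V G' u' Q Q' : ℂ}
    (hG : G = realSeries g x) (hΦ : Φ = realSeries q G) (hΦ₁ : Φ₁ = realSeries (derivCoeff q) G)
    (hΦ₂ : Φ₂ = realSeries (derivCoeff (derivCoeff q)) G)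
    (hΦ₃ : Φ₃ = deriv (realSeries (derivCoeff (derivCoeff q))) G)
    (hB : B = (1 - spineSeries q g x)⁻¹) (hV : V = (1 - z * spineSeries q g x)⁻¹)
    (hG' : G' = Φ * B) (hu' : u' = Φ₁ + x * (Φ₂ * (Φ * B))) (hQ : Q = G * V)
    (hQ' : Q' = G' * V + G * (z * u' * V ^ 2)) :
    HasDerivAt (distGenFun q g z)
      ((2 * Q' - G' + z ^ 2 * (Φ₂ * Q ^ 2 + x * (Φ₃ * G' * Q ^ 2 + Φ₂ * (2 * Q * Q')))) * B +
        (2 * Q - G + z ^ 2 * (x * (Φ₂ * Q ^ 2))) * (u' * B ^ 2)) x := by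
  have hGlt : ‖realSeries g x‖ < 1 := (h.norm_le hx.le).trans_lt hx
  have dG : HasDerivAt (realSeries g) G' x := by
    rw [hG', hΦ, hB, hG, ← div_eq_mul_inv]; exact h.hasDerivAt hx
  have du : HasDerivAt (spineSeries q g) u' x := by
    rw [hu', hΦ₁, hΦ₂, hΦ, hB, hG, ← div_eq_mul_inv]; exact h.hasDerivAt_spineSeries hx
  have dB : HasDerivAt (fun x => (1 - spineSeries q g x)⁻¹) (u' * B ^ 2) x := by
    refine ((du.const_sub 1).fun_inv (h.spineSeries_ne_one hx)).congr_deriv ?_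
    rw [hB, neg_neg, inv_pow, div_eq_mul_inv]
  have dV : HasDerivAt (fun x => (1 - z * spineSeries q g x)⁻¹) (z * u' * V ^ 2) x := by
    refine (((du.const_mul z).const_sub 1).fun_inv hz).congr_deriv ?_
    rw [hV, neg_neg, inv_pow, div_eq_mul_inv]
  have dQ : HasDerivAt (fun x => realSeries g x * (1 - z * spineSeries q g x)⁻¹) Q' x := by
    refine (dG.fun_mul dV).congr_deriv ?_
    rw [hQ', hG, hV]
  have dΦ₂ : HasDerivAt (fun x => realSeries (derivCoeff (derivCoeff q)) (realSeries g x))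
      (Φ₃ * G') x := by
    rw [hΦ₃, hG]
    exact (h.critical.differentiableAt_deriv₂ hGlt).hasDerivAt.comp x dG
  have dT := ((((dQ.const_mul 2).fun_sub dG).fun_add
    (((hasDerivAt_id x).fun_mul (dΦ₂.fun_mul (dQ.fun_pow 2))).const_mul (z ^ 2))).fun_mul dB)
  refine dT.congr_deriv ?_
  subst hG
  simp only [id, ← hΦ₂, ← hV, ← hB, ← hQ]
  ring

/-- The derivative of the bivariate generating function, uniformly in `z ∈ Δ(β, δ)`. -/
theorem exists_norm_deriv_distGenFun_le (h : IsProgeny q g d) : ∃ C > 0, ∃ δ > 0,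
    δ ≤ 1 ∧ ∀ z ∈ Delta (1 / 10) δ, DifferentiableOn ℂ (distGenFun q g z) (Metric.ball 0 1) ∧
      ∀ x : ℂ, ‖x‖ < 1 →
        ‖deriv (distGenFun q g z) x‖ ≤ C / ‖1 - z‖ ^ 2 * decay ‖1 - x ^ d‖ := by
  obtain ⟨c, hc, hlow⟩ := h.exists_lower_bounds
  obtain ⟨c', hc', δ, hδ, hδ1, hlow'⟩ := h.exists_lower_bounds_Delta
  have hσ := h.critical.var_pos
  set K : ℝ := 1 + offspringVar q + 2 * offspringVar q / c + 1 / c' with hKdef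
  have hK1 : 0 < 2 * offspringVar q / c := by positivity
  have hK2 : 0 < 1 / c' := by positivity
  have hK : 1 ≤ K := by linarith
  have hdc : 0 < decay c := by unfold decay; positivity
  refine ⟨203 * K ^ 3 * (1 / c') ^ 2 * decay c, by positivity, δ, hδ, hδ1, fun z hz => ?_⟩
  have hz1 : 0 < ‖1 - z‖ := norm_pos_iff.2 (sub_ne_zero.2 (Ne.symm hz.2.1))
  have hne : ∀ x : ℂ, ‖x‖ < 1 → 1 - z * spineSeries q g x ≠ 0 := fun x hx => by
    refine norm_pos_iff.1 (lt_of_lt_of_le ?_ (hlow' z hz x hx.le))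
    positivity
  refine ⟨fun x hx => (h.hasDerivAt_distGenFun (mem_ball_zero_iff.1 hx)
    (hne x (mem_ball_zero_iff.1 hx)) rfl rfl rfl rfl rfl rfl rfl rfl rfl rfl
    rfl).differentiableAt.differentiableWithinAt, fun x hx => ?_⟩
  rw [(h.hasDerivAt_distGenFun hx (hne x hx) rfl rfl rfl rfl rfl rfl rfl rfl rfl rfl rfl).deriv]
  have hz2 : ‖z‖ ≤ 2 := hz.1.le.trans (by linarith)
  have hGlt : ‖realSeries g x‖ < 1 := (h.norm_le hx.le).trans_lt hx
  have hu := (h.norm_spineSeries_le hx.le).trans hx.le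
  have ha0 : 0 < ‖1 - spineSeries q g x‖ := norm_pos_iff.2 (h.spineSeries_ne_one hx)
  have hb0 : 0 < ‖1 - z * spineSeries q g x‖ := norm_pos_iff.2 (hne x hx)
  have ha2 : ‖1 - spineSeries q g x‖ ≤ 2 := by
    have := norm_sub_le 1 (spineSeries q g x)
    rw [norm_one] at this; linarith
  have hb3 : ‖1 - z * spineSeries q g x‖ ≤ 3 := by
    have := norm_sub_le 1 (z * spineSeries q g x)
    rw [norm_one, norm_mul] at this
    nlinarith [norm_nonneg z, norm_nonneg (spineSeries q g x)]
  have hl := hlow x hx.le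
  have hl' := hlow' z hz x hx.le
  have ht : 0 < ‖1 - x ^ d‖ := by
    refine norm_pos_iff.2 (sub_ne_zero.2 fun h1 => ?_)
    have := congrArg norm h1
    rw [norm_one, norm_pow] at this
    exact (pow_lt_one₀ (norm_nonneg _) hx h.span.pos.ne').ne this.symm
  refine (norm_distGenFun_deriv_le hK hGlt.le (h.critical.norm_realSeries_le_one hGlt.le)
    (h.critical.norm_deriv_le_one hGlt.le) ((h.critical.norm_deriv₂_le hGlt.le).trans
      (by linarith)) ?_ hz2 hx.le ?_ ?_ ?_ rfl rfl rfl rfl).trans ?_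
  · refine (h.critical.norm_deriv_deriv₂_le hGlt).trans ?_
    rw [norm_inv]
    calc 2 * offspringVar q / (1 - ‖realSeries g x‖)
        ≤ 2 * offspringVar q / (c * ‖1 - spineSeries q g x‖) := by gcongr; exact hl.2
      _ = 2 * offspringVar q / c * ‖1 - spineSeries q g x‖⁻¹ := by field_simp
      _ ≤ _ := by gcongr; linarith
  · rw [norm_inv, ← div_eq_mul_inv, le_div_iff₀ ha0, one_mul]; exact ha2
  · rw [norm_inv, ← div_eq_mul_inv, le_div_iff₀ hb0, one_mul]; exact hb3
  · rw [norm_inv, norm_inv]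
    calc ‖1 - z * spineSeries q g x‖⁻¹ ≤ (c' * ‖1 - spineSeries q g x‖)⁻¹ := by
          gcongr; nlinarith
      _ = 1 / c' * ‖1 - spineSeries q g x‖⁻¹ := by field_simp
      _ ≤ _ := by gcongr; linarith
  · have hv : ‖(1 - z * spineSeries q g x)⁻¹‖ ≤ 1 / c' * ‖1 - z‖⁻¹ := by
      rw [norm_inv]
      calc ‖1 - z * spineSeries q g x‖⁻¹ ≤ (c' * ‖1 - z‖)⁻¹ := by
            gcongr; nlinarith
        _ = 1 / c' * ‖1 - z‖⁻¹ := by field_simp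
    have hb := cube_le_decay hc ht ha0 hl.1
    rw [← norm_inv] at hb
    calc 203 * K ^ 3 * ‖(1 - z * spineSeries q g x)⁻¹‖ ^ 2 * ‖(1 - spineSeries q g x)⁻¹‖ ^ 3
        ≤ 203 * K ^ 3 * (1 / c' * ‖1 - z‖⁻¹) ^ 2 * (decay c * decay ‖1 - x ^ d‖) := by gcongr
      _ = _ := by field_simp

end IsProgeny

/-- The Taylor coefficients of `(1 - x) ^ (-1 / 2)`. -/
noncomputable def invSqrtCoeff : ℕ → ℝ
  | 0 => 1
  | n + 1 => invSqrtCoeff n * ((2 * n + 1) / (2 * n + 2))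

theorem invSqrtCoeff_pos (n : ℕ) : 0 < invSqrtCoeff n := by
  induction n with
  | zero => simp [invSqrtCoeff]
  | succ n ih => rw [invSqrtCoeff]; positivity

theorem one_le_mul_invSqrtCoeff_sq {n : ℕ} (hn : 1 ≤ n) : 1 ≤ 4 * n * invSqrtCoeff n ^ 2 := by
  induction n, hn using Nat.le_induction with
  | base => norm_num [invSqrtCoeff]
  | succ n hn ih =>
    have hn' : (0 : ℝ) < n := by exact_mod_cast hn
    refine ih.trans ?_
    rw [invSqrtCoeff, mul_pow, div_pow]
    push_cast
    have : 4 * (n : ℝ) ≤ 4 * (n + 1) * ((2 * n + 1) ^ 2 / (2 * n + 2) ^ 2) := by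
      rw [← mul_div_assoc, le_div_iff₀ (by positivity)]
      nlinarith
    nlinarith [mul_le_mul_of_nonneg_right this (sq_nonneg (invSqrtCoeff n))]

theorem inv_le_invSqrtCoeff {n : ℕ} (hn : 1 ≤ n) : 1 / (2 * √n) ≤ invSqrtCoeff n := by
  have hn' : (0 : ℝ) < n := by exact_mod_cast hn
  have h := one_le_mul_invSqrtCoeff_sq hn
  rw [div_le_iff₀ (by positivity)]
  refine (sq_le_sq₀ zero_le_one (mul_nonneg (invSqrtCoeff_pos n).le (by positivity))).1 ?_
  rw [mul_pow, mul_pow, Real.sq_sqrt hn'.le]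
  linarith

theorem ringChoose_eq_invSqrtCoeff (n : ℕ) :
    Ring.choose ((2⁻¹ : ℂ) + n - 1) n = (invSqrtCoeff n : ℂ) := by
  have key : ∀ n : ℕ, Polynomial.eval (2⁻¹ : ℂ) (ascPochhammer ℂ n) =
      (n.factorial : ℂ) * (invSqrtCoeff n : ℂ) := by
    intro n
    induction n with
    | zero => simp [invSqrtCoeff]
    | succ n ih =>
      rw [ascPochhammer_succ_eval, ih, invSqrtCoeff, Nat.factorial_succ]
      push_cast
      have : (2 * (n : ℂ) + 2) ≠ 0 := by
        exact_mod_cast (by positivity : (2 * (n : ℝ) + 2) ≠ 0)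
      field_simp
      ring
  have h := Ring.factorial_nsmul_multichoose_eq_ascPochhammer (2⁻¹ : ℂ) n
  rw [Polynomial.ascPochhammer_smeval_eq_eval, key, nsmul_eq_mul] at h
  rw [Ring.choose, show (2⁻¹ : ℂ) + n - 1 - n + 1 = 2⁻¹ by ring]
  exact mul_left_cancel₀ (by exact_mod_cast n.factorial_ne_zero) h

theorem hasSum_invSqrtCoeff {x : ℂ} (hx : ‖x‖ < 1) :
    HasSum (fun n => (invSqrtCoeff n : ℂ) * x ^ n) ((1 - x) ^ (2⁻¹ : ℂ))⁻¹ := by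
  have h := (Complex.one_div_one_sub_cpow_hasFPowerSeriesOnBall_zero 2⁻¹).hasSum
    (y := x)
    (by rw [Metric.mem_eball, edist_zero_right, ← ofReal_norm, ENNReal.ofReal_lt_one]; exact hx)
  simp only [FormalMultilinearSeries.ofScalars_apply_eq, ringChoose_eq_invSqrtCoeff, smul_eq_mul,
    zero_add, one_div] at h
  exact h

theorem hasSum_invSqrtCoeff_pow {d : ℕ} (hd : 0 < d) {x : ℂ} (hx : ‖x‖ < 1) :
    HasSum (fun n => ((if d ∣ n then invSqrtCoeff (n / d) else 0 : ℝ) : ℂ) * x ^ n)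
      ((1 - x ^ d) ^ (2⁻¹ : ℂ))⁻¹ := by
  have hinj : Function.Injective (fun m : ℕ => d * m) :=
    fun a b hab => Nat.eq_of_mul_eq_mul_left hd hab
  have hxd : ‖x ^ d‖ < 1 := by
    rw [norm_pow]; exact pow_lt_one₀ (norm_nonneg _) hx hd.ne'
  rw [← hinj.hasSum_iff]
  · refine (hasSum_invSqrtCoeff hxd).congr_fun ?_
    intro m
    simp [Nat.mul_div_cancel_left m hd, pow_mul]
  · intro n hn
    rw [if_neg]
    · simp
    · rintro ⟨m, rfl⟩
      exact hn ⟨m, rfl⟩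

theorem sq_sqrt_cpow (y : ℂ) : (y ^ (2⁻¹ : ℂ)) ^ 2 = y := by
  exact_mod_cast Complex.cpow_nat_inv_pow y (n := 2) two_ne_zero

theorem re_sqrt_cpow_nonneg (y : ℂ) : 0 ≤ (y ^ (2⁻¹ : ℂ)).re := by
  rcases eq_or_ne y 0 with rfl | hy
  · simp
  rw [Complex.cpow_def_of_ne_zero hy, Complex.exp_re]
  refine mul_nonneg (Real.exp_nonneg _) (Real.cos_nonneg_of_mem_Icc ?_)
  have e : (Complex.log y * 2⁻¹).im = Complex.arg y / 2 := by
    rw [show (2⁻¹ : ℂ) = ((2⁻¹ : ℝ) : ℂ) by simp, Complex.im_mul_ofReal, Complex.log_im]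
    ring
  rw [e]
  constructor <;> linarith [Complex.neg_pi_lt_arg y, Complex.arg_le_pi y]

theorem norm_inv_sqrt_cpow_cube (y : ℂ) : ‖(y ^ (2⁻¹ : ℂ))⁻¹‖ ^ 3 = decay ‖y‖ := by
  have h : ‖y ^ (2⁻¹ : ℂ)‖ = √‖y‖ := by
    rw [← sq_sqrt_cpow y, norm_pow, Real.sqrt_sq (norm_nonneg _), sq_sqrt_cpow]
  rw [norm_inv, h, decay, inv_pow, pow_succ, Real.sq_sqrt (norm_nonneg _)]

theorem tendsto_of_sq_tendsto {α : Type*} {l : Filter α} {r : α → ℂ} {L : ℝ} (hL : 0 < L)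
    (hsq : Tendsto (fun x => r x ^ 2) l (nhds ((L : ℂ) ^ 2)))
    (hr : ∀ᶠ x in l, L / 3 ≤ ‖r x + L‖) : Tendsto r l (nhds L) := by
  rw [tendsto_iff_norm_sub_tendsto_zero] at hsq ⊢
  have h3 : Tendsto (fun x => ‖r x ^ 2 - (L : ℂ) ^ 2‖ * (3 / L)) l (nhds 0) := by
    simpa using hsq.mul_const (3 / L)
  refine tendsto_of_tendsto_of_tendsto_of_le_of_le' tendsto_const_nhds h3
    (Eventually.of_forall fun _ => norm_nonneg _) ?_
  filter_upwards [hr] with x hx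
  rw [sq_sub_sq, norm_mul]
  have h1 : 1 ≤ ‖r x + L‖ * (3 / L) := by
    calc (1 : ℝ) = L / 3 * (3 / L) := by field_simp
      _ ≤ _ := by gcongr
  calc ‖r x - L‖ = 1 * ‖r x - L‖ := (one_mul _).symm
    _ ≤ (‖r x + L‖ * (3 / L)) * ‖r x - L‖ := by gcongr
    _ = _ := by ring

/-- The square root of `1 - x ^ d`. -/
noncomputable def rootOneSubPow (d : ℕ) (x : ℂ) : ℂ := (1 - x ^ d) ^ (2⁻¹ : ℂ)

theorem rootOneSubPow_sq (d : ℕ) (x : ℂ) : rootOneSubPow d x ^ 2 = 1 - x ^ d := sq_sqrt_cpow _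

theorem norm_pow_lt_one {d : ℕ} (hd : 0 < d) {x : ℂ} (hx : ‖x‖ < 1) : ‖x ^ d‖ < 1 := by
  rw [norm_pow]; exact pow_lt_one₀ (norm_nonneg _) hx hd.ne'

theorem one_sub_pow_ne_zero {d : ℕ} (hd : 0 < d) {x : ℂ} (hx : ‖x‖ < 1) : 1 - x ^ d ≠ 0 := by
  intro h
  have := norm_pow_lt_one hd hx
  rw [← sub_eq_zero.1 h, norm_one] at this
  exact lt_irrefl _ this

theorem rootOneSubPow_ne_zero {d : ℕ} (hd : 0 < d) {x : ℂ} (hx : ‖x‖ < 1) :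
    rootOneSubPow d x ≠ 0 := by
  intro h
  have := rootOneSubPow_sq d x
  rw [h, zero_pow two_ne_zero] at this
  exact one_sub_pow_ne_zero hd hx this.symm

theorem hasDerivAt_inv_rootOneSubPow {d : ℕ} (hd : 0 < d) {x : ℂ} (hx : ‖x‖ < 1) :
    HasDerivAt (fun x => (rootOneSubPow d x)⁻¹)
      (d / 2 * x ^ (d - 1) * (rootOneSubPow d x)⁻¹ ^ 3) x := by
  have hs := rootOneSubPow_ne_zero hd hx
  have h0 := one_sub_pow_ne_zero hd hx
  have hmem : 1 - x ^ d ∈ Complex.slitPlane := by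
    left
    have := (Complex.re_le_norm (x ^ d)).trans_lt (norm_pow_lt_one hd hx)
    simpa using this
  have h1 : HasDerivAt (fun x : ℂ => 1 - x ^ d) (-(d * x ^ (d - 1))) x :=
    (hasDerivAt_pow d x).const_sub 1
  have h2 := (h1.cpow_const (c := 2⁻¹) hmem).fun_inv hs
  refine h2.congr_deriv ?_
  have e : (1 - x ^ d) ^ ((2⁻¹ : ℂ) - 1) = (rootOneSubPow d x)⁻¹ := by
    rw [Complex.cpow_sub _ _ h0, Complex.cpow_one, ← rootOneSubPow_sq d x,
      show ((rootOneSubPow d x) ^ 2) ^ (2⁻¹ : ℂ) = rootOneSubPow d x by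
        rw [rootOneSubPow_sq]; rfl]
    field_simp
  rw [e]
  change _ / (rootOneSubPow d x) ^ 2 = _
  field_simp

theorem tendsto_rootOneSubPow (d : ℕ) (s : Set ℂ) :
    Tendsto (rootOneSubPow d) (nhdsWithin 1 s) (nhds 0) := by
  have h : Tendsto (fun x : ℂ => √‖1 - x ^ d‖) (nhds 1) (nhds 0) := by
    have : Continuous (fun x : ℂ => √‖1 - x ^ d‖) := by fun_prop
    simpa using this.tendsto 1
  rw [tendsto_zero_iff_norm_tendsto_zero]
  refine (h.mono_left nhdsWithin_le_nhds).congr fun x => ?_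
  rw [← rootOneSubPow_sq, norm_pow, Real.sqrt_sq (norm_nonneg _)]

/-- The limit at `1` of the ratio of the square root of `1 - x ^ d` and `1 - spineSeries q g x`. -/
noncomputable def rootRatio (q : ℕ → ℝ) (d : ℕ) : ℝ := √(d / (2 * offspringVar q))

/-- The coefficient of the leading singularity of the derivative of the progeny generating
function. -/
noncomputable def singCoeff (q : ℕ → ℝ) (d : ℕ) : ℝ :=
  2 * offspringVar q * rootRatio q d ^ 3 / d

/-- The derivative of the progeny generating function minus its leading singular part. -/
noncomputable def singRemainder (q g : ℕ → ℝ) (d : ℕ) (x : ℂ) : ℂ :=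
  realSeries q (realSeries g x) * (1 - spineSeries q g x)⁻¹ -
    singCoeff q d * (rootOneSubPow d x)⁻¹

/-- The derivative of `singRemainder`. -/
noncomputable def singRemainderDeriv (q g : ℕ → ℝ) (d : ℕ) (x : ℂ) : ℂ :=
  2 * realSeries q (realSeries g x) * realSeries (derivCoeff q) (realSeries g x) *
      (1 - spineSeries q g x)⁻¹ ^ 2 +
    x * realSeries q (realSeries g x) ^ 2 *
      realSeries (derivCoeff (derivCoeff q)) (realSeries g x) * (1 - spineSeries q g x)⁻¹ ^ 3 -
    singCoeff q d * (d / 2 * x ^ (d - 1) * (rootOneSubPow d x)⁻¹ ^ 3)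

namespace IsProgeny

variable {q g : ℕ → ℝ} {d : ℕ} {x : ℂ}

theorem rootRatio_pos (h : IsProgeny q g d) : 0 < rootRatio q d := by
  have := h.critical.var_pos
  have := h.span.pos
  unfold rootRatio
  positivity

theorem singCoeff_pos (h : IsProgeny q g d) : 0 < singCoeff q d := by
  have := h.critical.var_pos
  have := h.span.pos
  have := h.rootRatio_pos
  unfold singCoeff
  positivity

theorem hasDerivAt_singRemainder (h : IsProgeny q g d) (hx : ‖x‖ < 1) :
    HasDerivAt (singRemainder q g d) (singRemainderDeriv q g d x) x := by
  have hG : ‖realSeries g x‖ < 1 := (h.norm_le hx.le).trans_lt hx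
  have hu := h.spineSeries_ne_one hx
  have h1 := (h.critical.hasDerivAt_realSeries hG).comp x (h.hasDerivAt hx)
  have h2 := ((h.hasDerivAt_spineSeries hx).const_sub 1).fun_inv hu
  have h3 := (hasDerivAt_inv_rootOneSubPow h.span.pos hx).const_mul (singCoeff q d : ℂ)
  refine ((h1.fun_mul h2).fun_sub h3).congr_deriv ?_
  simp only [singRemainderDeriv, Function.comp_apply, sub_left_inj]
  field_simp
  ring

theorem tendsto_rootRatio (h : IsProgeny q g d) :
    Tendsto (fun x => rootOneSubPow d x * (1 - spineSeries q g x)⁻¹)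
      (nhdsWithin 1 (Metric.ball 0 1)) (nhds (rootRatio q d)) := by
  have hle : nhdsWithin (1 : ℂ) (Metric.ball 0 1) ≤ nhdsWithin 1 (Metric.closedBall 0 1) :=
    nhdsWithin_mono _ Metric.ball_subset_closedBall
  have hσ := h.critical.var_pos
  have hL := h.rootRatio_pos
  refine tendsto_of_sq_tendsto hL ?_ ?_
  · have hsum : Tendsto (fun x : ℂ => ∑ i ∈ Finset.range d, x ^ i)
        (nhdsWithin 1 (Metric.ball 0 1)) (nhds d) := by
      have : Continuous (fun x : ℂ => ∑ i ∈ Finset.range d, x ^ i) := by fun_prop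
      simpa using (this.tendsto 1).mono_left nhdsWithin_le_nhds
    have hR := (hsum.div (h.tendsto_sq_ratio.mono_left hle)
      (Complex.ofReal_ne_zero.2 (by positivity)))
    have e : (d : ℂ) / ((2 * offspringVar q : ℝ) : ℂ) = (rootRatio q d : ℂ) ^ 2 := by
      rw [← Complex.ofReal_pow, rootRatio, Real.sq_sqrt (by positivity)]
      push_cast
      rfl
    rw [← e]
    refine hR.congr' ?_
    filter_upwards [h.eventually_one_sub_spine_sq.filter_mono hle, self_mem_nhdsWithin]
      with x hx hx1
    rw [mem_ball_zero_iff] at hx1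
    have hne : (1 : ℂ) - x ≠ 0 := by
      simpa using one_sub_pow_ne_zero one_pos hx1
    rw [mul_pow, inv_pow, hx, rootOneSubPow_sq, ← mul_neg_geom_sum x d, Pi.div_apply,
      mul_inv, mul_comm (1 - x)⁻¹, mul_assoc, mul_left_comm, mul_comm, mul_assoc]
    field_simp
  · filter_upwards [h.eventually_cone.filter_mono hle, self_mem_nhdsWithin] with x hx hx1
    rw [mem_ball_zero_iff] at hx1
    have hu := h.spineSeries_ne_one hx1
    set w := 1 - spineSeries q g x
    have hw : ‖w‖ ≤ 3 * w.re := by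
      have := Complex.norm_le_abs_re_add_abs_im w
      have h0 : 0 ≤ w.re := by linarith [abs_nonneg w.im]
      rw [abs_of_nonneg h0] at this
      linarith
    have e : rootOneSubPow d x * w⁻¹ + rootRatio q d =
        (rootOneSubPow d x + rootRatio q d * w) * w⁻¹ := by
      field_simp
    have h1 : rootRatio q d * (‖w‖ / 3) ≤ ‖rootOneSubPow d x + rootRatio q d * w‖ := by
      refine le_trans ?_ (Complex.re_le_norm _)
      rw [Complex.add_re, Complex.re_ofReal_mul]
      have := re_sqrt_cpow_nonneg (1 - x ^ d)
      change 0 ≤ (rootOneSubPow d x).re at this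
      nlinarith
    rw [e, norm_mul, norm_inv]
    have hw0 : 0 < ‖w‖ := norm_pos_iff.2 hu
    rw [← div_eq_mul_inv, le_div_iff₀ hw0]
    linarith

theorem tendsto_singRemainderDeriv (h : IsProgeny q g d) :
    Tendsto (fun x => singRemainderDeriv q g d x * rootOneSubPow d x ^ 3)
      (nhdsWithin 1 (Metric.ball 0 1)) (nhds 0) := by
  have hle : nhdsWithin (1 : ℂ) (Metric.ball 0 1) ≤ nhdsWithin 1 (Metric.closedBall 0 1) :=
    nhdsWithin_mono _ Metric.ball_subset_closedBall
  have hd : (d : ℂ) ≠ 0 := by exact_mod_cast h.span.pos.ne'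
  have hΦ := h.tendsto_offspring.mono_left hle
  have hΦ₁ := (h.tendsto_comp (continuousOn_realSeries h.critical.deriv_nonneg
    h.critical.hasSum_deriv.summable)).mono_left hle
  have hΦ₂ := (h.tendsto_comp (continuousOn_realSeries h.critical.deriv₂_nonneg
    h.critical.hasSum_deriv₂.summable)).mono_left hle
  rw [h.critical.realSeries_deriv_one] at hΦ₁
  rw [h.critical.realSeries_deriv₂_one] at hΦ₂
  have hs := tendsto_rootOneSubPow d (Metric.ball 0 1)
  have hr := h.tendsto_rootRatio
  have hx := tendsto_self (Metric.ball (0 : ℂ) 1)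
  have key := ((((hΦ.mul hΦ₁).mul (hs.mul (hr.pow 2))).const_mul 2).add
    ((hx.mul ((hΦ.pow 2).mul hΦ₂)).mul (hr.pow 3))).sub
    (((hx.pow (d - 1)).const_mul ((d : ℂ) / 2)).const_mul (singCoeff q d : ℂ))
  have e : (2 * (1 * 1 * (0 * (rootRatio q d : ℂ) ^ 2)) +
      1 * (1 ^ 2 * (offspringVar q : ℂ)) * (rootRatio q d : ℂ) ^ 3 -
      singCoeff q d * ((d : ℂ) / 2 * 1 ^ (d - 1))) = 0 := by
    rw [singCoeff]
    push_cast
    field_simp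
    ring
  rw [e] at key
  refine key.congr' ?_
  filter_upwards [self_mem_nhdsWithin] with x hx1
  rw [mem_ball_zero_iff] at hx1
  have hs0 := rootOneSubPow_ne_zero h.span.pos hx1
  have hu := h.spineSeries_ne_one hx1
  rw [singRemainderDeriv]
  field_simp

end IsProgeny

namespace IsProgeny

variable {q g : ℕ → ℝ} {d : ℕ} {x : ℂ}

theorem singRemainderDeriv_mul (h : IsProgeny q g d) {ω : ℂ} (hω : ω ^ d = 1) (x : ℂ) :
    ω * singRemainderDeriv q g d (ω * x) = singRemainderDeriv q g d x := by
  have e1 := h.offspring_deriv_mul hω (realSeries g x)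
  have e2 := h.offspring_deriv₂_mul hω (realSeries g x)
  have e3 : ω * ω ^ (d - 1) = 1 := by
    rw [← pow_succ', Nat.sub_add_cancel h.span.pos, hω]
  have e4 : rootOneSubPow d (ω * x) = rootOneSubPow d x := by
    rw [rootOneSubPow, mul_pow, hω, one_mul, rootOneSubPow]
  rw [singRemainderDeriv, singRemainderDeriv, h.realSeries_mul hω, h.offspring_mul hω,
    h.spineSeries_mul hω, e4, mul_pow, ← e1, ← e2]
  linear_combination (- (singCoeff q d : ℂ) * (d / 2 * x ^ (d - 1) *
    (rootOneSubPow d x)⁻¹ ^ 3)) * e3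

theorem exists_cover_pow (h : IsProgeny q g d) {U : Set ℂ}
    (hU : U ∈ nhdsWithin (1 : ℂ) (Metric.closedBall 0 1)) :
    ∃ m > 0, ∀ x : ℂ, ‖x‖ ≤ 1 → (∃ ω : ℂ, ω ^ d = 1 ∧ ω * x ∈ U) ∨ m ≤ ‖1 - x ^ d‖ := by
  obtain ⟨κ, hκ, hcov⟩ := h.exists_cover hU
  set K : Set ℂ := Metric.closedBall 0 1 ∩ (fun x => 1 - ‖realSeries g x‖) ⁻¹' Ici κ
  have hK : IsCompact K := by
    refine (isCompact_closedBall (0 : ℂ) 1).of_isClosed_subset ?_ inter_subset_left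
    exact (continuousOn_const.sub h.continuousOn.norm).preimage_isClosed_of_isClosed
      Metric.isClosed_closedBall isClosed_Ici
  have hpos : ∀ x ∈ K, 0 < ‖1 - x ^ d‖ := by
    rintro x ⟨-, hx⟩
    refine norm_pos_iff.2 fun h0 => ?_
    have hxd : x ^ d = 1 := (sub_eq_zero.1 h0).symm
    have h1 := h.realSeries_mul hxd 1
    rw [mul_one, h.realSeries_one, mul_one] at h1
    have hx1 : ‖x‖ = 1 := by
      have : ‖x‖ ^ d = 1 := by rw [← norm_pow, hxd, norm_one]
      exact (pow_eq_one_iff_of_nonneg (norm_nonneg _) h.span.pos.ne').1 this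
    rw [mem_preimage, h1, hx1, sub_self] at hx
    exact absurd hx (not_le.2 hκ)
  obtain ⟨m, hm, hKm⟩ : ∃ m > 0, ∀ x ∈ K, m ≤ ‖1 - x ^ d‖ := by
    rcases K.eq_empty_or_nonempty with hE | hne
    · exact ⟨1, one_pos, by simp [hE]⟩
    · obtain ⟨x₀, hx₀, hmin⟩ := hK.exists_isMinOn hne
        (f := fun x : ℂ => ‖1 - x ^ d‖) (by fun_prop)
      exact ⟨_, hpos x₀ hx₀, fun x hx => hmin hx⟩
  refine ⟨m, hm, fun x hx => (hcov x hx).imp_right fun hxκ => hKm x ⟨by simpa using hx, hxκ⟩⟩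

theorem exists_norm_singRemainderDeriv_le (h : IsProgeny q g d) {ε : ℝ} (hε : 0 < ε) :
    ∃ M, 0 ≤ M ∧ ∀ x : ℂ, ‖x‖ < 1 →
      ‖singRemainderDeriv q g d x‖ ≤ ε * decay ‖1 - x ^ d‖ + M := by
  have hev : ∀ᶠ x in nhdsWithin (1 : ℂ) (Metric.ball 0 1),
      ‖singRemainderDeriv q g d x * rootOneSubPow d x ^ 3‖ ≤ ε := by
    have := h.tendsto_singRemainderDeriv.norm
    rw [norm_zero] at this
    exact this.eventually_le_const hε
  have hev' : {x : ℂ | x ∈ Metric.ball (0 : ℂ) 1 →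
      ‖singRemainderDeriv q g d x * rootOneSubPow d x ^ 3‖ ≤ ε} ∈
      nhdsWithin (1 : ℂ) (Metric.closedBall 0 1) :=
    nhdsWithin_le_nhds (eventually_nhdsWithin_iff.1 hev)
  obtain ⟨m, hm, hcov⟩ := h.exists_cover_pow hev'
  obtain ⟨c, hc, hlow⟩ := h.exists_lower_bounds
  have hσ := h.critical.var_pos
  have hc0 := h.singCoeff_pos
  set b := √(c * m)
  have hb : 0 < b := Real.sqrt_pos.2 (by positivity)
  refine ⟨2 * b⁻¹ ^ 2 + offspringVar q * b⁻¹ ^ 3 + singCoeff q d * (d / 2 * decay m), ?_, ?_⟩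
  · have := decay_nonneg hm.le
    positivity
  intro x hx
  have hM : 0 ≤ 2 * b⁻¹ ^ 2 + offspringVar q * b⁻¹ ^ 3 + singCoeff q d * (d / 2 * decay m) := by
    have := decay_nonneg hm.le
    positivity
  rcases hcov x hx.le with ⟨ω, hω, hmem⟩ | hxm
  · have hωn : ‖ω‖ = 1 := by
      have : ‖ω‖ ^ d = 1 := by rw [← norm_pow, hω, norm_one]
      exact (pow_eq_one_iff_of_nonneg (norm_nonneg _) h.span.pos.ne').1 this
    have hωx : ‖ω * x‖ < 1 := by rw [norm_mul, hωn, one_mul]; exact hx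
    have h1 := hmem (by simpa using hωx)
    rw [norm_mul, norm_pow] at h1
    have hs := rootOneSubPow_ne_zero h.span.pos hωx
    have hs' : 0 < ‖rootOneSubPow d (ω * x)‖ := norm_pos_iff.2 hs
    have e : ‖singRemainderDeriv q g d x‖ = ‖singRemainderDeriv q g d (ω * x)‖ := by
      rw [← h.singRemainderDeriv_mul hω, norm_mul, hωn, one_mul]
    have e2 : decay ‖1 - x ^ d‖ = ‖rootOneSubPow d (ω * x)‖⁻¹ ^ 3 := by
      rw [← norm_inv_sqrt_cpow_cube, rootOneSubPow, mul_pow, hω, one_mul, norm_inv]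
    rw [e, e2]
    refine le_add_of_le_of_nonneg ?_ hM
    rw [inv_pow, ← div_eq_mul_inv, le_div_iff₀ (by positivity)]
    exact h1
  · have hG : ‖realSeries g x‖ ≤ 1 := h.norm_le_one hx.le
    have hB : ‖(1 - spineSeries q g x)⁻¹‖ ≤ b⁻¹ := by
      rw [norm_inv]
      refine inv_anti₀ hb (Real.sqrt_le_iff.2 ⟨norm_nonneg _, ?_⟩)
      exact (mul_le_mul_of_nonneg_left hxm hc.le).trans (hlow x hx.le).1
    have h0 := h.critical.norm_realSeries_le_one hG
    have h1 := h.critical.norm_deriv_le_one hG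
    have h2 := h.critical.norm_deriv₂_le hG
    have hr : ‖(rootOneSubPow d x)⁻¹‖ ^ 3 ≤ decay m := by
      rw [rootOneSubPow, norm_inv_sqrt_cpow_cube]
      exact decay_anti hm hxm
    refine le_add_of_nonneg_of_le (mul_nonneg hε.le (decay_nonneg (norm_nonneg _))) ?_
    rw [singRemainderDeriv]
    refine (norm_sub_le _ _).trans (add_le_add ((norm_add_le _ _).trans (add_le_add ?_ ?_)) ?_)
    · rw [norm_mul, norm_mul, norm_mul, norm_pow, Complex.norm_two]
      calc _ ≤ 2 * 1 * 1 * b⁻¹ ^ 2 := by gcongr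
        _ = _ := by ring
    · rw [norm_mul, norm_mul, norm_mul, norm_pow, norm_pow]
      calc _ ≤ 1 * 1 ^ 2 * offspringVar q * b⁻¹ ^ 3 := by gcongr
        _ = _ := by ring
    · rw [norm_mul, norm_mul, norm_mul, norm_pow, norm_pow, norm_div, Complex.norm_two,
        Complex.norm_natCast, Complex.norm_real, Real.norm_of_nonneg hc0.le]
      have : ‖x‖ ^ (d - 1) ≤ 1 := pow_le_one₀ (norm_nonneg _) hx.le
      calc _ ≤ singCoeff q d * (d / 2 * 1 * decay m) := by gcongr
        _ = _ := by ring

theorem hasSum_deriv (h : IsProgeny q g d) (hx : ‖x‖ < 1 / 2) :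
    HasSum (fun k => (((k + 1 : ℕ) * g (k + 1) : ℝ) : ℂ) * x ^ k)
      (realSeries q (realSeries g x) * (1 - spineSeries q g x)⁻¹) := by
  set c : ℕ → ℝ := fun k => g k * (1 / 2) ^ k
  have hg1 : ∀ k, g k ≤ 1 := fun k =>
    (h.summable.le_tsum k fun j _ => h.nonneg j).trans h.tsum_le
  have hc0 : ∀ k, 0 ≤ c k := fun k => mul_nonneg (h.nonneg k) (by positivity)
  have hc : Summable fun k : ℕ => (k : ℝ) * c k := by
    have h1 := summable_pow_mul_geometric_of_norm_lt_one 1 (r := (1 / 2 : ℝ)) (by norm_num)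
    refine Summable.of_nonneg_of_le (fun k => mul_nonneg k.cast_nonneg (hc0 k)) (fun k => ?_) h1
    rw [pow_one]
    gcongr
    exact mul_le_of_le_one_left (by positivity) (hg1 k)
  have hx2 : ‖2 * x‖ < 1 := by
    rw [norm_mul, Complex.norm_two]; linarith
  have h1 := (hasDerivAt_realSeries hc0 hc hx2).comp x ((hasDerivAt_id x).const_mul 2)
  have e : (realSeries c ∘ HMul.hMul (2 : ℂ)) = realSeries g := by
    ext y
    simp only [Function.comp_apply, realSeries, c]
    refine tsum_congr fun k => ?_
    rw [mul_pow]
    push_cast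
    rw [div_pow, one_pow]
    field_simp
  rw [e] at h1
  have h2 := h1.unique (h.hasDerivAt (by linarith))
  rw [div_eq_mul_inv] at h2
  rw [← h2]
  have hs : Summable (derivCoeff c) := by
    refine ((summable_nat_add_iff 1).2 hc).congr fun k => ?_
    simp [derivCoeff]
  have hc1 : ∀ k, 0 ≤ derivCoeff c k := fun k => by
    have := hc0 (k + 1)
    unfold derivCoeff
    positivity
  refine ((hasSum_realSeries hc1 hs hx2.le).mul_right (2 * 1)).congr_fun fun k => ?_
  simp only [derivCoeff, c, mul_pow, pow_succ]
  push_cast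
  rw [div_pow, one_pow]
  field_simp

theorem exists_le_coeff (h : IsProgeny q g d) :
    ∃ c > 0, ∀ n : ℕ, g n ≠ 0 → c / (n * √n) ≤ g n := by
  set c₀ := singCoeff q d
  have hc₀ : 0 < c₀ := h.singCoeff_pos
  obtain ⟨M, hM, hbound⟩ := h.exists_norm_singRemainderDeriv_le (ε := c₀ / 864) (by positivity)
  have hcoeff : ∀ k : ℕ, 1 ≤ k → d ∣ k → c₀ / (2 * √k) - (c₀ / (8 * √k) + 2 * M / k) ≤
      (k + 1 : ℕ) * g (k + 1) := by
    intro k hk hdk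
    have key := norm_coeff_le_of_norm_deriv_le (n := k) h.span.pos (f := singRemainder q g d)
      (a := fun k => ((((k + 1 : ℕ) * g (k + 1) -
        c₀ * (if d ∣ k then invSqrtCoeff (k / d) else 0) : ℝ)) : ℂ))
      (A := c₀ / 864) (M := M) (by positivity) hM
      (fun x hx => (h.hasDerivAt_singRemainder
        (by simpa using hx)).differentiableAt.differentiableWithinAt) ?_ ?_ hk
    · rw [Complex.norm_real, Real.norm_eq_abs, if_pos hdk] at key
      obtain ⟨m, rfl⟩ := hdk
      have hm : 1 ≤ m := by
        rcases Nat.eq_zero_or_pos m with rfl | hm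
        · simp at hk
        · exact hm
      rw [Nat.mul_div_cancel_left m h.span.pos] at key
      have hb := inv_le_invSqrtCoeff hm
      have hmd : √(m : ℝ) ≤ √((d * m : ℕ) : ℝ) := by
        apply Real.sqrt_le_sqrt
        exact_mod_cast Nat.le_mul_of_pos_left m h.span.pos
      have hm0 : 0 < √(m : ℝ) := Real.sqrt_pos.2 (by exact_mod_cast hm)
      have hb' : 1 / (2 * √((d * m : ℕ) : ℝ)) ≤ invSqrtCoeff m :=
        le_trans (by gcongr) hb
      have hb'' := mul_le_mul_of_nonneg_left hb' hc₀.le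
      rw [mul_one_div] at hb''
      have e : 108 * (c₀ / 864) / √((d * m : ℕ) : ℝ) = c₀ / (8 * √((d * m : ℕ) : ℝ)) := by
        field_simp
        norm_num
      rw [e] at key
      have := (abs_le.1 key).1
      linarith
    · filter_upwards [Metric.ball_mem_nhds (0 : ℂ) (by norm_num : (0 : ℝ) < 1 / 2)] with x hx
      rw [mem_ball_zero_iff] at hx
      have h1 := (h.hasSum_deriv hx).sub
        ((hasSum_invSqrtCoeff_pow h.span.pos (x := x) (by linarith)).mul_left (c₀ : ℂ))
      refine h1.congr_fun fun k => ?_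
      simp only [Complex.ofReal_sub, Complex.ofReal_mul c₀]
      ring
    · intro x hx
      rw [(h.hasDerivAt_singRemainder hx).deriv]
      exact hbound x hx
  obtain ⟨K, hK⟩ := exists_nat_ge (max 1 ((16 * M / c₀) ^ 2))
  obtain ⟨c₁, hc₁, hsmall⟩ : ∃ c₁ > 0, ∀ n ∈ Finset.range (K + 1), g n ≠ 0 → c₁ ≤ g n := by
    rcases ((Finset.range (K + 1)).filter fun n => g n ≠ 0).eq_empty_or_nonempty with hE | hne
    · refine ⟨1, one_pos, fun n hn hgn => ?_⟩
      have : n ∈ (Finset.range (K + 1)).filter fun n => g n ≠ 0 := Finset.mem_filter.2 ⟨hn, hgn⟩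
      simp [hE] at this
    · obtain ⟨m, hm, hmin⟩ := Finset.exists_min_image _ g hne
      exact ⟨g m, lt_of_le_of_ne (h.nonneg m) (Finset.mem_filter.1 hm).2.symm,
        fun n hn hgn => hmin n (Finset.mem_filter.2 ⟨hn, hgn⟩)⟩
  refine ⟨min c₁ (c₀ / 4), by positivity, fun n hgn => ?_⟩
  obtain ⟨m, hm⟩ := h.exists_eq n hgn
  have hn1 : (1 : ℝ) ≤ n := by exact_mod_cast (by omega : 1 ≤ n)
  have hsn : 1 ≤ √(n : ℝ) := Real.one_le_sqrt.2 hn1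
  rcases lt_or_ge n (K + 1) with hlt | hge
  · have h1 := hsmall n (Finset.mem_range.2 hlt) hgn
    refine le_trans (div_le_self (by positivity) (by nlinarith)) ((min_le_left _ _).trans h1)
  · obtain ⟨k, rfl⟩ : ∃ k, n = k + 1 := ⟨d * m, hm⟩
    have hKk : (K : ℝ) ≤ k := by exact_mod_cast (by omega : K ≤ k)
    have hk1 : (1 : ℝ) ≤ k := (le_max_left _ _).trans (hK.trans hKk)
    have hkM : 16 * M / c₀ ≤ √(k : ℝ) :=
      Real.le_sqrt_of_sq_le ((le_max_right _ _).trans (hK.trans hKk))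
    have h1 := hcoeff k (by exact_mod_cast hk1) ⟨m, by omega⟩
    have hsk : 1 ≤ √(k : ℝ) := Real.one_le_sqrt.2 hk1
    have h2 : 2 * M / k ≤ c₀ / (8 * √(k : ℝ)) := by
      rw [div_le_iff₀ hc₀] at hkM
      rw [div_le_div_iff₀ (by positivity) (by positivity)]
      have := Real.mul_self_sqrt (by positivity : (0 : ℝ) ≤ k)
      nlinarith
    have h3 : c₀ / 4 / √(k : ℝ) = c₀ / (2 * √(k : ℝ)) - (c₀ / (8 * √(k : ℝ)) +
        c₀ / (8 * √(k : ℝ))) := by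
      field_simp
      norm_num
    have h4 : c₀ / 4 / √((k + 1 : ℕ) : ℝ) ≤ c₀ / 4 / √(k : ℝ) := by
      gcongr
      simp
    have h5 : min c₁ (c₀ / 4) / √((k + 1 : ℕ) : ℝ) ≤ c₀ / 4 / √((k + 1 : ℕ) : ℝ) := by
      gcongr
      exact min_le_right _ _
    rw [mul_comm, ← div_div, div_le_iff₀ (by positivity)]
    linarith

end IsProgeny

theorem hasSum_toReal_of_tsum_eq {ι : Type*} {f : ι → ℝ≥0∞} {a : ℝ≥0∞} (h : ∑' i, f i = a)
    (ha : a ≠ ⊤) : HasSum (fun i => (f i).toReal) a.toReal := by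
  rw [← h] at ha ⊢
  rw [ENNReal.tsum_toReal_eq fun i => ENNReal.ne_top_of_tsum_ne_top ha i]
  exact ENNReal.hasSum_toReal ha

theorem criticalOffspring_toReal {p : ℕ → ℝ≥0∞} (hp : ∑' k, p k = 1)
    (hmean : ∑' k : ℕ, (k : ℝ≥0∞) * p k = 1) (hvar_pos : 0 < xiVar p) (hvar_fin : xiVar p ≠ ⊤) :
    CriticalOffspring fun k => (p k).toReal := by
  have h0 : HasSum (fun k => (p k).toReal) 1 := by
    simpa using hasSum_toReal_of_tsum_eq hp ENNReal.one_ne_top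
  have h1 : HasSum (fun k : ℕ => (k : ℝ) * (p k).toReal) 1 := by
    simpa using hasSum_toReal_of_tsum_eq hmean ENNReal.one_ne_top
  have hv : HasSum (fun k : ℕ => (p k).toReal * ((k : ℝ) - 1) ^ 2) (xiVar p).toReal := by
    refine (hasSum_toReal_of_tsum_eq (f := fun k : ℕ => p k * ENNReal.ofReal (((k : ℝ) - 1) ^ 2))
      rfl hvar_fin).congr_fun fun k => ?_
    rw [ENNReal.toReal_mul, ENNReal.toReal_ofReal (sq_nonneg _)]
  refine ⟨fun k => ENNReal.toReal_nonneg, h0, h1, ?_, ?_⟩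
  · refine ((hv.summable.add (h1.summable.mul_left 2)).sub h0.summable).congr fun k => ?_
    ring
  · refine lt_of_le_of_ne ENNReal.toReal_nonneg fun hzero => ?_
    have hdiff : HasSum (fun k : ℕ => (k : ℝ) * (p k).toReal - (p k).toReal) 0 := by
      simpa using h1.sub h0
    have hnn : ∀ k : ℕ, 0 ≤ (k : ℝ) * (p k).toReal - (p k).toReal := by
      intro k
      rcases Nat.eq_zero_or_pos k with rfl | hk
      · simp [← hzero]
      · have : (1 : ℝ) ≤ k := by exact_mod_cast hk
        nlinarith [ENNReal.toReal_nonneg (a := p k)]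
    have hz := (hasSum_zero_iff_of_nonneg hnn).1 hdiff
    have hv0 : HasSum (fun k : ℕ => (p k).toReal * ((k : ℝ) - 1) ^ 2) 0 := by
      refine hasSum_zero.congr_fun fun k => ?_
      have := congrFun hz k
      simp only [Pi.zero_apply] at this
      linear_combination ((k : ℝ) - 1) * this
    have := hv.unique hv0
    exact (ENNReal.toReal_pos hvar_pos.ne' hvar_fin).ne' this

namespace PlaneTree

/-- The sum of `P(𝒯 = t) D(t)` over the trees `t` with `n` vertices. -/
noncomputable def sizeSum (p : ℕ → ℝ≥0∞) (D : PlaneTree → ℂ) (n : ℕ) : ℂ :=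
  ∑' t, if size t = n then ((gwProb p t).toReal : ℂ) * D t else 0

section SizeSum

variable {p : ℕ → ℝ≥0∞} {D : PlaneTree → ℂ} {B : ℕ → ℝ} {x s : ℂ}

theorem hasSum_sizeSum (hp : ∑' k, p k = 1) (hD : ∀ t, ‖D t‖ ≤ B (size t)) (n : ℕ) :
    HasSum (fun t => if size t = n then ((gwProb p t).toReal : ℂ) * D t else 0)
      (sizeSum p D n) := by
  refine (Summable.of_norm_bounded ((summable_gwProb hp).mul_right |B n|) fun t => ?_).hasSum
  split_ifs with h
  · rw [norm_mul, Complex.norm_of_nonneg ENNReal.toReal_nonneg]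
    refine mul_le_mul_of_nonneg_left ?_ ENNReal.toReal_nonneg
    exact ((hD t).trans_eq (by rw [h])).trans (le_abs_self _)
  · rw [norm_zero]
    exact mul_nonneg ENNReal.toReal_nonneg (abs_nonneg _)

theorem hasSum_sizeSum_mul_pow (hp : ∑' k, p k = 1) (hD : ∀ t, ‖D t‖ ≤ B (size t))
    (hs : HasSum (fun t => weight p x t * D t) s) :
    HasSum (fun n => sizeSum p D n * x ^ n) s := by
  refine HasSum.sigma ((Equiv.sigmaFiberEquiv size).hasSum_iff.2 hs) fun n => ?_
  have h := (hasSum_sizeSum hp hD n).mul_right (x ^ n)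
  refine (hasSum_subtype_iff_indicator (s := {t | size t = n})
    (f := fun t => weight p x t * D t)).2 (h.congr_fun fun t => ?_)
  by_cases ht : size t = n
  · rw [indicator_of_mem (by exact ht), if_pos ht, weight, ht]
    ring
  · rw [indicator_of_notMem (by exact ht), if_neg ht, zero_mul]

end SizeSum

theorem tsum_probSize (p : ℕ → ℝ≥0∞) : ∑' n, probSize p n = ∑' t, gwProb p t := by
  unfold probSize
  rw [ENNReal.tsum_comm]
  exact tsum_congr fun t => by simp

theorem probSize_ne_top {p : ℕ → ℝ≥0∞} (hp : ∑' k, p k = 1) (n : ℕ) : probSize p n ≠ ⊤ := by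
  refine ne_top_of_le_ne_top ENNReal.one_ne_top ?_
  exact (ENNReal.le_tsum n).trans ((tsum_probSize p).trans_le (tsum_gwProb_le_one hp))

theorem sizeSum_one {p : ℕ → ℝ≥0∞} (hp : ∑' k, p k = 1) (n : ℕ) :
    sizeSum p (fun _ => 1) n = ((probSize p n).toReal : ℂ) := by
  have h := hasSum_toReal_of_tsum_eq (rfl : _ = probSize p n) (probSize_ne_top hp n)
  refine (hasSum_sizeSum (B := fun _ => 1) hp (fun _ => by simp) n).unique ?_
  refine ((Complex.hasSum_ofReal).2 h).congr_fun fun t => ?_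
  split_ifs <;> simp

theorem exists_size_eq {p : ℕ → ℝ≥0∞} {d : ℕ} (hd : ∀ k, p k ≠ 0 → d ∣ k) (t : PlaneTree)
    (ht : gwProb p t ≠ 0) : ∃ m, size t = d * m + 1 := by
  induction t using induction_ofFn with
  | _ m f ih =>
    rw [gwProb_ofFn, mul_ne_zero_iff, Finset.prod_ne_zero_iff] at ht
    choose a ha using fun i => ih i (ht.2 i (Finset.mem_univ i))
    obtain ⟨b, hb⟩ := hd m ht.1
    refine ⟨∑ i, a i + b, ?_⟩
    rw [size_ofFn, Finset.sum_congr rfl fun i _ => ha i, Finset.sum_add_distrib, ← Finset.mul_sum]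
    simp only [Finset.sum_const, Finset.card_univ, Fintype.card_fin, smul_eq_mul, mul_one]
    rw [mul_add, ← hb]
    ring

end PlaneTree

theorem hasSum_probSize {p : ℕ → ℝ≥0∞} (hp : ∑' k, p k = 1) {x : ℂ} (hx : ‖x‖ ≤ 1) :
    HasSum (fun n => ((probSize p n).toReal : ℂ) * x ^ n) (∑' t, PlaneTree.weight p x t) := by
  have h := PlaneTree.hasSum_sizeSum_mul_pow (D := fun _ => 1) (B := fun _ => 1) hp
    (fun _ => by simp) (x := x) (s := ∑' t, PlaneTree.weight p x t)
    (by simpa using (PlaneTree.absHasSum_weight hp hx).2)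
  simpa only [PlaneTree.sizeSum_one hp] using h

theorem isProgeny_probSize {p : ℕ → ℝ≥0∞} (hp : ∑' k, p k = 1) {d : ℕ}
    (hq : CriticalOffspring fun k => (p k).toReal) (hd : IsSpan (fun k => (p k).toReal) d) :
    IsProgeny (fun k => (p k).toReal) (fun n => (probSize p n).toReal) d := by
  have hle := (PlaneTree.tsum_probSize p).trans_le (tsum_gwProb_le_one hp)
  have hg := hasSum_toReal_of_tsum_eq (rfl : _ = ∑' n, probSize p n)
    (ne_top_of_le_ne_top ENNReal.one_ne_top hle)
  refine ⟨hq, hd, fun n => ENNReal.toReal_nonneg, hg.summable, ?_, fun x hx => ?_, fun n hn => ?_⟩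
  · rw [hg.tsum_eq]
    exact ENNReal.toReal_le_of_le_ofReal zero_le_one (by simpa using hle)
  · have e : realSeries (fun n => (probSize p n).toReal) x = ∑' t, PlaneTree.weight p x t :=
      (hasSum_probSize hp hx).tsum_eq
    have h := (PlaneTree.hasSum_weight_rec (PlaneTree.absHasSum_weight hp hx)).tsum_eq
    rw [← e] at h
    refine h.symm.trans ?_
    generalize realSeries (fun n => (probSize p n).toReal) x = α
    rw [realSeries, ← tsum_mul_left]
    exact tsum_congr fun m => by ring
  · have : probSize p n ≠ 0 := fun h0 => hn (by simp [h0])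
    rw [probSize, ne_eq, ENNReal.tsum_eq_zero, not_forall] at this
    obtain ⟨t, ht⟩ := this
    rw [ite_eq_right_iff, Classical.not_imp] at ht
    obtain ⟨rfl, ht⟩ := ht
    refine PlaneTree.exists_size_eq (fun k hk => hd.dvd k ?_) t ht
    refine (ENNReal.toReal_pos hk ?_).ne'
    exact ENNReal.ne_top_of_tsum_ne_top (hp.trans_ne ENNReal.one_ne_top) k

theorem CriticalOffspring.hasSum_mul_deriv {q : ℕ → ℝ} (hq : CriticalOffspring q) {s : ℂ}
    (hs : ‖s‖ ≤ 1) :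
    HasSum (fun m : ℕ => (q m : ℂ) * (m * s ^ (m - 1))) (realSeries (derivCoeff q) s) := by
  have h := hasSum_realSeries hq.deriv_nonneg hq.hasSum_deriv.summable hs
  rw [← hasSum_nat_add_iff' 1]
  simp only [Finset.range_one, Finset.sum_singleton, Nat.cast_zero, zero_mul, mul_zero, sub_zero]
  refine h.congr_fun fun m => ?_
  simp only [derivCoeff, Nat.add_sub_cancel]
  push_cast
  ring

theorem CriticalOffspring.hasSum_mul_deriv₂ {q : ℕ → ℝ} (hq : CriticalOffspring q) {s : ℂ}
    (hs : ‖s‖ ≤ 1) :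
    HasSum (fun m : ℕ => (q m : ℂ) * (m * (m - 1) * s ^ (m - 2)))
      (realSeries (derivCoeff (derivCoeff q)) s) := by
  have h := hasSum_realSeries hq.deriv₂_nonneg hq.hasSum_deriv₂.summable hs
  rw [← hasSum_nat_add_iff' 2]
  simp only [Finset.sum_range_succ, Finset.range_one, Finset.sum_singleton, Nat.cast_zero,
    zero_mul, mul_zero, sub_zero, Nat.cast_one, sub_self, add_zero]
  refine h.congr_fun fun m => ?_
  simp only [derivCoeff, Nat.add_sub_cancel]
  push_cast
  ring

theorem hasSum_distGenFun {p : ℕ → ℝ≥0∞} (hp : ∑' k, p k = 1) {d : ℕ}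
    (h : IsProgeny (fun k => (p k).toReal) (fun n => (probSize p n).toReal) d) {z x : ℂ} {R : ℝ}
    (hR : 1 ≤ R) (hz : ‖z‖ ≤ R) (hx : ‖x‖ * (4 * R ^ 2) ≤ 1) :
    HasSum (fun n => PlaneTree.sizeSum p (PlaneTree.distSum z) n * x ^ n)
      (distGenFun (fun k => (p k).toReal) (fun n => (probSize p n).toReal) z x) := by
  have hx0 := norm_nonneg x
  have hR2 : 1 ≤ R ^ 2 := one_le_pow₀ hR
  have hx4 : ‖x‖ ≤ 1 / 4 := by nlinarith
  have hxR : ‖x‖ * R ≤ 1 / 4 := by nlinarith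
  have hx1 : ‖x‖ ≤ 1 := by linarith
  have hsize : ∀ n : ℕ, ‖x‖ ^ n * ((n : ℝ) ^ 2 * (R ^ 2) ^ n) ≤ 1 := by
    intro n
    have h2 : (n : ℝ) ^ 2 ≤ 4 ^ n := by
      have : (n : ℝ) ≤ 2 ^ n := by exact_mod_cast n.lt_two_pow_self.le
      calc (n : ℝ) ^ 2 ≤ (2 ^ n) ^ 2 := by gcongr
        _ = 4 ^ n := by rw [← pow_mul, mul_comm, pow_mul]; norm_num
    calc ‖x‖ ^ n * ((n : ℝ) ^ 2 * (R ^ 2) ^ n) ≤ ‖x‖ ^ n * (4 ^ n * (R ^ 2) ^ n) := by gcongr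
      _ = (‖x‖ * (4 * R ^ 2)) ^ n := by rw [mul_pow, mul_pow]
      _ ≤ 1 := pow_le_one₀ (by positivity) hx
  have ha := PlaneTree.absHasSum_weight hp hx1
  have hb := PlaneTree.absHasSum_weight_mul hp (x := x) (D := PlaneTree.depthSum z) (M := 1) <| by
    intro t
    rw [norm_mul, norm_pow]
    refine le_trans ?_ (hsize t.size)
    gcongr
    refine (PlaneTree.norm_depthSum_le hR hz t).trans ?_
    have ht : (1 : ℝ) ≤ t.size := by exact_mod_cast t.size_pos
    gcongr
    · nlinarith
    · nlinarith
  have hc := PlaneTree.absHasSum_weight_mul hp (x := x) (D := PlaneTree.distSum z) (M := 1) <| by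
    intro t
    rw [norm_mul, norm_pow]
    refine le_trans ?_ (hsize t.size)
    gcongr
    exact PlaneTree.norm_distSum_le hR hz t
  have e : ∑' t, PlaneTree.weight p x t = realSeries (fun n => (probSize p n).toReal) x :=
    (hasSum_probSize hp hx1).tsum_eq.symm
  rw [e] at ha
  set q : ℕ → ℝ := fun k => (p k).toReal
  set g : ℕ → ℝ := fun n => (probSize p n).toReal
  set α := realSeries g x
  set β := ∑' t, PlaneTree.weight p x t * PlaneTree.depthSum z t
  set γ := ∑' t, PlaneTree.weight p x t * PlaneTree.distSum z t
  have hα : ‖α‖ ≤ 1 := h.norm_le_one hx1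
  have s0 := (hasSum_realSeries h.critical.nonneg h.critical.hasSum.summable hα).mul_left x
  rw [← h.rec_eq x hx1] at s0
  have s1 := (h.critical.hasSum_mul_deriv hα).mul_left x
  have s2 := (h.critical.hasSum_mul_deriv₂ hα).mul_left x
  have hβ : β = α + z * (spineSeries q g x * β) := by
    refine (PlaneTree.hasSum_depth_rec ha hb).unique ?_
    refine (s0.add ((s1.mul_right β).mul_left z)).congr_fun fun m => ?_
    ring
  have hγ : γ = α + 2 * z * (spineSeries q g x * β) + spineSeries q g x * γ +
      z ^ 2 * (x * realSeries (derivCoeff (derivCoeff q)) α * β ^ 2) := by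
    refine (PlaneTree.hasSum_dist_rec ha hb hc).unique ?_
    refine (((s0.add ((s1.mul_right β).mul_left (2 * z))).add (s1.mul_right γ)).add
      ((s2.mul_right (β ^ 2)).mul_left (z ^ 2))).congr_fun fun m => ?_
    ring
  have hu := h.norm_spineSeries_le hx1
  have hzu : 1 - z * spineSeries q g x ≠ 0 := by
    intro h0
    have h1 : ‖z * spineSeries q g x‖ = 1 := by rw [← sub_eq_zero.1 h0, norm_one]
    rw [norm_mul] at h1
    have : ‖z‖ * ‖spineSeries q g x‖ ≤ R * ‖x‖ := by gcongr
    linarith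
  have hu1 := h.spineSeries_ne_one (x := x) (by linarith)
  have eβ : α * (1 - z * spineSeries q g x)⁻¹ = β := by
    rw [← div_eq_mul_inv, div_eq_iff hzu]
    linear_combination -hβ
  have eγ : distGenFun q g z x = γ := by
    rw [distGenFun, eβ, ← div_eq_mul_inv, div_eq_iff hu1]
    linear_combination -hγ + 2 * hβ
  rw [eγ]
  exact PlaneTree.hasSum_sizeSum_mul_pow hp (B := fun n => (n : ℝ) ^ 2 * (R ^ 2) ^ n)
    (PlaneTree.norm_distSum_le hR hz) hc.2

namespace PlaneTree

theorem pairCount_le (t : PlaneTree) {k : ℕ} (hk : k ≠ 0) : pairCount t k ≤ size t ^ 2 := by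
  have h1 := card_filter_treeDist t hk
  have h2 := Finset.card_filter_le ((verts t) ×ˢ (verts t)) fun a => treeDist a.1 a.2 = k
  rw [Finset.card_product, card_verts, ← sq] at h2
  omega

theorem hasSum_expPairCount {p : ℕ → ℝ≥0∞} (hp : ∑' k, p k = 1) {n k : ℕ} (hk : k ≠ 0)
    (hn : probSize p n ≠ 0) :
    HasSum (fun t => if size t = n then ((gwProb p t).toReal : ℂ) * pairCount t k else 0)
      ((probSize p n).toReal * expPairCount p n k) := by
  set S := ∑' t : PlaneTree, if size t = n then gwProb p t * (pairCount t k : ℝ≥0∞) else 0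
  have hS : S ≠ ⊤ := by
    have hle : S ≤ ∑' t, gwProb p t * (n ^ 2 : ℕ) := by
      refine ENNReal.tsum_le_tsum fun t => ?_
      split_ifs with ht
      · gcongr
        rw [← ht]
        exact pairCount_le t hk
      · exact zero_le
    refine ne_top_of_le_ne_top ?_ hle
    rw [ENNReal.tsum_mul_right]
    exact ENNReal.mul_ne_top (ne_top_of_le_ne_top ENNReal.one_ne_top (tsum_gwProb_le_one hp))
      (ENNReal.natCast_ne_top _)
  have hg : (probSize p n).toReal ≠ 0 := (ENNReal.toReal_pos hn (probSize_ne_top hp n)).ne'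
  have e : S.toReal = (probSize p n).toReal * expPairCount p n k := by
    rw [expPairCount, condExp, ENNReal.toReal_div, mul_div_cancel₀ _ hg]
  have h := Complex.hasSum_ofReal.2 (hasSum_toReal_of_tsum_eq (rfl : _ = S) hS)
  rw [e, Complex.ofReal_mul] at h
  refine h.congr_fun fun t => ?_
  split_ifs <;> simp

theorem sizeSum_distSum {p : ℕ → ℝ≥0∞} (hp : ∑' k, p k = 1) {n : ℕ} (hn : probSize p n ≠ 0)
    (z : ℂ) : sizeSum p (distSum z) n = (probSize p n).toReal *
      (n + 2 * ∑ k ∈ Finset.range (2 * n), (expPairCount p n (k + 1) : ℂ) * z ^ (k + 1)) := by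
  have h1 := (hasSum_sizeSum (D := fun _ => 1) (B := fun _ => 1) hp (fun _ => by simp) n).mul_right
    (n : ℂ)
  rw [sizeSum_one hp] at h1
  have h2 := (hasSum_sum (s := Finset.range (2 * n)) fun k _ =>
    (hasSum_expPairCount hp (Nat.succ_ne_zero k) hn).mul_right (z ^ (k + 1))).mul_left 2
  have h := (h1.add h2).tsum_eq
  rw [mul_add, mul_left_comm, Finset.mul_sum]
  simp only [← mul_assoc]
  refine Eq.trans ?_ h
  rw [sizeSum]
  refine tsum_congr fun t => ?_
  split_ifs with ht
  · rw [distSum_eq, ht, mul_add, mul_left_comm, Finset.mul_sum]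
    simp [mul_assoc]
  · simp

end PlaneTree

theorem expPairCount_eq_zero {p : ℕ → ℝ≥0∞} {n k : ℕ} (hk : 2 * n ≤ k) :
    expPairCount p n k = 0 := by
  have : ∀ t : PlaneTree, (if t.size = n then gwProb p t * (pairCount t k : ℝ≥0∞) else 0) = 0 := by
    intro t
    split_ifs with ht
    · rw [PlaneTree.pairCount_eq_zero (by rw [ht]; exact hk), Nat.cast_zero, mul_zero]
    · rfl
  simp [expPairCount, condExp, this]

theorem genFun_eq_sum (p : ℕ → ℝ≥0∞) (n : ℕ) (z : ℂ) : genFun p n z =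
    ∑ k ∈ Finset.range (2 * n), (expPairCount p n (k + 1) : ℂ) * z ^ (k + 1) := by
  refine tsum_eq_sum fun k hk => ?_
  rw [Finset.mem_range, not_lt] at hk
  rw [expPairCount_eq_zero (by omega), Complex.ofReal_zero, zero_mul]

/-- Theorem 2 of Devroye–Janson.  There are constants `C, β, δ > 0` such
that for every `n ≥ 1`, the generating function `f_n` extends to an analytic function on
`Δ(β, δ)` satisfying `|f_n(z)| ≤ C n |1 - z|⁻²` there. -/
theorem genFun_extends_and_bound
    (p : ℕ → ℝ≥0∞) (hp : ∑' k : ℕ, p k = 1)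
    (hmean : ∑' k : ℕ, (k : ℝ≥0∞) * p k = 1)
    (hvar_pos : 0 < xiVar p) (hvar_fin : xiVar p ≠ ⊤) :
    ∃ C β δ : ℝ, 0 < C ∧ 0 < β ∧ β < Real.pi / 2 ∧ 0 < δ ∧
      ∀ n : ℕ, 1 ≤ n → probSize p n ≠ 0 →
        ∃ g : ℂ → ℂ, AnalyticOnNhd ℂ g (Metric.ball (0 : ℂ) 1 ∪ Delta β δ) ∧
          (∀ z ∈ Metric.ball (0 : ℂ) 1, g z = genFun p n z) ∧
          ∀ z ∈ Delta β δ, ‖g z‖ ≤ C * n / ‖1 - z‖ ^ 2 := by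
  have hq := criticalOffspring_toReal hp hmean hvar_pos hvar_fin
  obtain ⟨d, hd⟩ := hq.exists_isSpan
  have h := isProgeny_probSize hp hq hd
  obtain ⟨A, hA, δ, hδ, hδ1, hbound⟩ := h.exists_norm_deriv_distGenFun_le
  obtain ⟨c, hc, hlow⟩ := h.exists_le_coeff
  refine ⟨108 * A / c + 9, 1 / 10, δ, by positivity, by norm_num, ?_, hδ, fun n hn hgn => ?_⟩
  · linarith [Real.pi_gt_three]
  refine ⟨genFun p n, ?_, fun z _ => rfl, fun z hz => ?_⟩
  · have e : genFun p n = fun z =>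
        ∑ k ∈ Finset.range (2 * n), (expPairCount p n (k + 1) : ℂ) * z ^ (k + 1) :=
      funext (genFun_eq_sum p n)
    have hdiff : Differentiable ℂ (genFun p n) := by
      rw [e]
      fun_prop
    exact fun z _ => hdiff.analyticAt z
  have hz1 : 0 < ‖1 - z‖ := norm_pos_iff.2 (sub_ne_zero.2 hz.2.1.symm)
  have hz3 : ‖1 - z‖ ≤ 3 := by
    have := norm_sub_le (1 : ℂ) z
    rw [norm_one] at this
    linarith [hz.1]
  have hn0 : (0 : ℝ) < n := by exact_mod_cast hn
  obtain ⟨hdiff, hder⟩ := hbound z hz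
  have hcoeff := norm_coeff_le_of_norm_deriv_le (n := n) hd.pos
    (a := PlaneTree.sizeSum p (PlaneTree.distSum z)) (A := A / ‖1 - z‖ ^ 2) (M := 0)
    (by positivity) le_rfl hdiff ?_ (fun x hx => by rw [add_zero]; exact hder x hx) hn
  · have hg : c / (n * √n) ≤ (probSize p n).toReal :=
      hlow n (ENNReal.toReal_pos hgn (PlaneTree.probSize_ne_top hp n)).ne'
    rw [PlaneTree.sizeSum_distSum hp hgn, ← genFun_eq_sum, norm_mul,
      Complex.norm_of_nonneg ENNReal.toReal_nonneg, mul_zero, zero_div, add_zero] at hcoeff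
    have h1 : ‖(n : ℂ) + 2 * genFun p n z‖ ≤ 108 * A / c * n / ‖1 - z‖ ^ 2 := by
      have h2 := (mul_le_mul_of_nonneg_right hg (norm_nonneg _)).trans hcoeff
      rw [div_mul_eq_mul_div, div_le_div_iff₀ (by positivity) (by positivity)] at h2
      rw [show 108 * A / c * n / ‖1 - z‖ ^ 2 = 108 * A * n / ‖1 - z‖ ^ 2 / c by ring,
        le_div_iff₀ hc]
      have hs : 0 < √(n : ℝ) := Real.sqrt_pos.2 hn0
      have h3 : 108 * (A / ‖1 - z‖ ^ 2) * (n * √n) =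
        108 * A * n / ‖1 - z‖ ^ 2 * √n := by ring
      rw [h3] at h2
      linarith [le_of_mul_le_mul_right h2 hs]
    have h5 : (n : ℝ) ≤ 9 * n / ‖1 - z‖ ^ 2 := by
      rw [le_div_iff₀ (by positivity), mul_comm]
      gcongr
      nlinarith
    have h6 : ‖2 * genFun p n z‖ ≤ ‖(n : ℂ) + 2 * genFun p n z‖ + n := by
      have := norm_sub_le ((n : ℂ) + 2 * genFun p n z) n
      rwa [add_sub_cancel_left, Complex.norm_natCast] at this
    rw [norm_mul, Complex.norm_two] at h6
    have h7 : (108 * A / c + 9) * n / ‖1 - z‖ ^ 2 =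
      108 * A / c * n / ‖1 - z‖ ^ 2 + 9 * n / ‖1 - z‖ ^ 2 := by ring
    rw [h7]
    linarith [norm_nonneg (genFun p n z)]
  · set R := max 1 ‖z‖
    have hR : 1 ≤ R := le_max_left _ _
    have hr : 0 < 1 / (4 * R ^ 2) := by positivity
    filter_upwards [Metric.ball_mem_nhds (0 : ℂ) hr] with x hx
    rw [mem_ball_zero_iff, lt_div_iff₀ (by positivity)] at hx
    exact hasSum_distGenFun hp h hR (le_max_right _ _) hx.le
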